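/- arXiv:1605.09055 — 2 statements merged into one kernel-verified Lean document; each statement's English description precedes it below -/
import Mathlib

section
/- There exists a constant C > 0 such that the following holds: if G is a simple graph on n vertices with exactly ⌊n²/4⌋ + 1 edges, and the edge set of G is partitioned into a set R of red edges and a set B of blue edges such that no blue edge lies on a cycle of length 5 in G, then |R| ≥ ((2+√2)/16)·n² − C·n^{15/8}. -/
open SimpleGraph

/-- An edge `e` of `G` occurs in `C_m`: `G` contains a cycle of length `m`
whose edge set contains `e`. -/
def occursInC {V : Type*} (G : SimpleGraph V) (m : ℕ) (e : Sym2 V) : Prop :=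
  ∃ (u : V) (w : G.Walk u u), w.IsCycle ∧ w.length = m ∧ e ∈ w.edges

section Helpers
open scoped Classical

/-- The bilinear form of the adjacency matrix. -/
noncomputable def Wt {V : Type*} [Fintype V] (H : SimpleGraph V) (x y : V → ℝ) : ℝ :=
  ∑ a, ∑ b, if H.Adj a b then x a * y b else 0

/-- weighted degree -/
noncomputable def wd {V : Type*} [Fintype V] (H : SimpleGraph V) (y : V → ℝ) (a : V) : ℝ :=
  ∑ b, if H.Adj a b then y b else 0

variable {V : Type*} [Fintype V]

lemma Wt_eq (H : SimpleGraph V) (x y : V → ℝ) : Wt H x y = ∑ a, x a * wd H y a := by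
  unfold Wt wd
  refine Finset.sum_congr rfl fun a _ => ?_
  rw [Finset.mul_sum]
  refine Finset.sum_congr rfl fun b _ => ?_
  split_ifs <;> simp

lemma Wt_comm (H : SimpleGraph V) (x y : V → ℝ) : Wt H x y = Wt H y x := by
  unfold Wt
  rw [Finset.sum_comm]
  refine Finset.sum_congr rfl fun a _ => Finset.sum_congr rfl fun b _ => ?_
  simp only [H.adj_comm b a, mul_comm]

lemma Wt_comb_left (H : SimpleGraph V) (x x' y : V → ℝ) (s t : ℝ) :
    Wt H (fun a => s * x a + t * x' a) y = s * Wt H x y + t * Wt H x' y := by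
  simp only [Wt_eq, Finset.mul_sum, ← Finset.sum_add_distrib]
  exact Finset.sum_congr rfl fun a _ => by ring

lemma Wt_comb_right (H : SimpleGraph V) (x x' y : V → ℝ) (s t : ℝ) :
    Wt H y (fun a => s * x a + t * x' a) = s * Wt H y x + t * Wt H y x' := by
  rw [Wt_comm, Wt_comb_left, Wt_comm H x, Wt_comm H x']

lemma Wt_quad (H : SimpleGraph V) (x y : V → ℝ) (s t : ℝ) :
    Wt H (fun a => s * x a + t * y a) (fun a => s * x a + t * y a)
      = s ^ 2 * Wt H x x + 2 * s * t * Wt H y x + t ^ 2 * Wt H y y := by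
  rw [Wt_comb_left, Wt_comb_right, Wt_comb_right, Wt_comm H x y]; ring

lemma wd_mono (H : SimpleGraph V) (x y : V → ℝ) (h : ∀ a, x a ≤ y a) (a : V) :
    wd H x a ≤ wd H y a := by
  unfold wd
  refine Finset.sum_le_sum fun b _ => ?_
  split_ifs
  · exact h b
  · exact le_rfl

lemma wd_nonneg (H : SimpleGraph V) (x : V → ℝ) (h : ∀ a, 0 ≤ x a) (a : V) :
    0 ≤ wd H x a := by
  unfold wd
  refine Finset.sum_nonneg fun b _ => ?_
  split_ifs
  · exact h b
  · exact le_rfl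

lemma Wt_nonneg (H : SimpleGraph V) (x y : V → ℝ) (hx : ∀ a, 0 ≤ x a) (hy : ∀ a, 0 ≤ y a) :
    0 ≤ Wt H x y := by
  rw [Wt_eq]
  exact Finset.sum_nonneg fun a _ => mul_nonneg (hx a) (wd_nonneg H y hy a)

/-- Weighted Mantel. -/
lemma mantel (H : SimpleGraph V) (x : V → ℝ) (hx : ∀ a, 0 ≤ x a) (hs : ∑ a, x a = 1)
    (hE : 1 / 2 < Wt H x x) :
    ∃ a b c, 0 < x a ∧ 0 < x b ∧ 0 < x c ∧ H.Adj a b ∧ H.Adj b c ∧ H.Adj c a := by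
  by_contra hno
  push Not at hno
  have key : ∀ a b, 0 < x a → 0 < x b → H.Adj a b → wd H x a + wd H x b ≤ 1 := by
    intro a b ha hb hab
    unfold wd
    rw [← Finset.sum_add_distrib, ← hs]
    refine Finset.sum_le_sum fun c _ => ?_
    have hc := hx c
    by_cases h1 : H.Adj a c <;> by_cases h2 : H.Adj b c <;> simp [h1, h2, hc]
    rcases hc.lt_or_eq with h | h
    · exact absurd h1.symm (hno a b c ha hb h hab h2)
    · simp [← h]
  have h1 : (∑ a, ∑ b, if H.Adj a b then x a * x b * (wd H x a + wd H x b) else 0) ≤ Wt H x x := by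
    unfold Wt
    refine Finset.sum_le_sum fun a _ => Finset.sum_le_sum fun b _ => ?_
    split_ifs with hab
    · rcases (hx a).lt_or_eq with h | h
      · rcases (hx b).lt_or_eq with h' | h'
        · have := key a b h h' hab
          nlinarith [mul_pos h h']
        · simp [← h']
      · simp [← h]
    · exact le_rfl
  have h2 : (∑ a, ∑ b, if H.Adj a b then x a * x b * (wd H x a + wd H x b) else 0)
      = 2 * ∑ a, x a * wd H x a ^ 2 := by
    have e1 : (∑ a, ∑ b, if H.Adj a b then x a * x b * (wd H x a + wd H x b) else 0)
        = Wt H (fun a => x a * wd H x a) x + Wt H x (fun a => x a * wd H x a) := by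
      unfold Wt
      simp only [← Finset.sum_add_distrib]
      refine Finset.sum_congr rfl fun a _ => Finset.sum_congr rfl fun b _ => ?_
      split_ifs
      · ring
      · simp
    rw [e1, Wt_comm H x, Wt_eq]
    rw [← two_mul]
    congr 1
    exact Finset.sum_congr rfl fun a _ => by ring
  have h3 : 0 ≤ ∑ a, x a * (wd H x a - Wt H x x) ^ 2 :=
    Finset.sum_nonneg fun a _ => mul_nonneg (hx a) (sq_nonneg _)
  have h4 : ∑ a, x a * (wd H x a - Wt H x x) ^ 2
      = ∑ a, x a * wd H x a ^ 2 - 2 * Wt H x x * Wt H x x + Wt H x x ^ 2 * 1 := by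
    have hW := Wt_eq H x x
    generalize Wt H x x = E at hW ⊢
    have e5 : 2 * E * E = 2 * E * ∑ a, x a * wd H x a := by rw [← hW]
    rw [e5, ← hs, Finset.mul_sum, Finset.mul_sum, ← Finset.sum_sub_distrib, ← Finset.sum_add_distrib]
    exact Finset.sum_congr rfl fun a _ => by ring
  nlinarith

lemma numeric (a b w k : ℝ) (ha : 0 ≤ a) (hb : 0 ≤ b) (hk : 0 ≤ k)
    (hs : a + b + w + k = 1) (hE : 1 / 2 < 2 * (a * b + a * w + w * k) + k ^ 2) :
    2 * (a * b) ≤ (2 - Real.sqrt 2) / 8 := by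
  set q := Real.sqrt 2 with hq
  have hq2 : q ^ 2 = 2 := Real.sq_sqrt (by norm_num)
  have hq0 : 0 ≤ q := Real.sqrt_nonneg _
  have hq1 : q < 2 := by nlinarith
  obtain ⟨r, hr⟩ : ∃ r, r = 1 / 2 - (w + b) := ⟨_, rfl⟩
  have hw : w = 1 / 2 - r - b := by linarith
  have ha' : a = 1 / 2 + r - k := by linarith
  subst hw
  have h1 : k * b < k ^ 2 / 2 - r ^ 2 := by rw [ha'] at hE; nlinarith
  have hk0 : 0 < k := by
    rcases hk.lt_or_eq with h | h
    · exact h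
    · rw [← h] at h1; nlinarith [sq_nonneg r]
  have hrk : r < k := by nlinarith [mul_nonneg hk hb]
  -- (k^2/2 - r^2) ≤ (2-q) k (k-r)
  have h2 : k ^ 2 / 2 - r ^ 2 ≤ (2 - q) * k * (k - r) := by
    nlinarith [sq_nonneg (r - (1 - q / 2) * k)]
  have h3 : a * (k - r) ≤ 1 / 16 := by rw [ha']; nlinarith [sq_nonneg (k - r - 1 / 4)]
  have h4 : k * (a * b) ≤ k * ((2 - q) / 16) := by
    calc k * (a * b) = a * (k * b) := by ring
      _ ≤ a * ((2 - q) * k * (k - r)) := by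
        apply mul_le_mul_of_nonneg_left _ ha; linarith
      _ = ((2 - q) * k) * (a * (k - r)) := by ring
      _ ≤ ((2 - q) * k) * (1 / 16) := by
        apply mul_le_mul_of_nonneg_left h3; apply mul_nonneg <;> linarith
      _ = _ := by ring
  have := le_of_mul_le_mul_left h4 hk0
  linarith

/-- Moving along a direction until a coordinate vanishes. -/
lemma move (x y : V → ℝ) (hx : ∀ a, 0 ≤ x a) (hsupp : ∀ a, x a = 0 → y a = 0)
    (hneg : ∃ a, y a < 0) :
    ∃ s : ℝ, 0 ≤ s ∧ (∀ a, 0 ≤ x a + s * y a) ∧ ∃ a, x a ≠ 0 ∧ x a + s * y a = 0 := by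
  obtain ⟨a0, ha0⟩ := hneg
  obtain ⟨i, hi, hmin⟩ := Finset.exists_min_image (Finset.univ.filter fun a => y a < 0)
    (fun a => x a / (- y a)) ⟨a0, by simpa using ha0⟩
  simp only [Finset.mem_filter, Finset.mem_univ, true_and] at hi hmin
  refine ⟨x i / (- y i), div_nonneg (hx i) (by linarith), ?_, i, ?_, ?_⟩
  · intro a
    by_cases h : y a < 0
    · have := hmin a h
      rw [le_div_iff₀ (by linarith)] at this
      linarith
    · have : 0 ≤ x i / (- y i) := div_nonneg (hx i) (by linarith)
      have h' : 0 ≤ y a := by linarith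
      have := mul_nonneg this h'
      linarith [hx a]
  · intro h
    have := hsupp i h
    linarith
  · have : y i ≠ 0 := by linarith
    field_simp
    ring

/-- Three pairwise nonadjacent support vertices allow a reduction of the support. -/
lemma reduce (G B : SimpleGraph V) (hle : B ≤ G) (x : V → ℝ) (hx : ∀ a, 0 ≤ x a)
    (hs : ∑ a, x a = 1) (t1 t2 t3 : V) (h1 : x t1 ≠ 0) (h2 : x t2 ≠ 0) (h3 : x t3 ≠ 0)
    (h12 : t1 ≠ t2) (h13 : t1 ≠ t3) (h23 : t2 ≠ t3)
    (n12 : ¬ G.Adj t1 t2) (n13 : ¬ G.Adj t1 t3) (n23 : ¬ G.Adj t2 t3) :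
    ∃ x' : V → ℝ, (∀ a, 0 ≤ x' a) ∧ ∑ a, x' a = 1 ∧ Wt G x x ≤ Wt G x' x' ∧
      Wt B x x ≤ Wt B x' x' ∧
      (Finset.univ.filter fun a => x' a ≠ 0).card < (Finset.univ.filter fun a => x a ≠ 0).card := by
  let Y : ℝ → ℝ → ℝ → V → ℝ := fun y1 y2 y3 a =>
    if a = t1 then y1 else if a = t2 then y2 else if a = t3 then y3 else 0
  have hYsum : ∀ (f : V → ℝ) y1 y2 y3,
      ∑ a, Y y1 y2 y3 a * f a = y1 * f t1 + y2 * f t2 + y3 * f t3 := by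
    intro f y1 y2 y3
    have : ∀ a, Y y1 y2 y3 a * f a = (if a = t1 then y1 * f t1 else 0)
        + (if a = t2 then y2 * f t2 else 0) + (if a = t3 then y3 * f t3 else 0) := by
      intro a
      simp only [Y]
      split_ifs <;> simp_all
    simp only [this, Finset.sum_add_distrib, Finset.sum_ite_eq', Finset.mem_univ, if_true]
  have hYY : ∀ (H : SimpleGraph V), H ≤ G → ∀ y1 y2 y3, Wt H (Y y1 y2 y3) (Y y1 y2 y3) = 0 := by
    intro H hH y1 y2 y3
    unfold Wt
    refine Finset.sum_eq_zero fun a _ => Finset.sum_eq_zero fun b _ => ?_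
    split_ifs with hab
    · have hab' := hH hab
      by_cases ha : a = t1 ∨ a = t2 ∨ a = t3
      · by_cases hb : b = t1 ∨ b = t2 ∨ b = t3
        · exfalso
          rcases ha with rfl | rfl | rfl <;> rcases hb with rfl | rfl | rfl <;>
            first
            | exact hab'.ne rfl
            | contradiction
            | exact absurd hab'.symm (by assumption)
        · push Not at hb
          simp [Y, hb]
      · push Not at ha
        simp [Y, ha]
    · rfl
  -- direction
  obtain ⟨y1, y2, y3, hsum, hd, hnz⟩ : ∃ y1 y2 y3 : ℝ, y1 + y2 + y3 = 0 ∧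
      y1 * wd G x t1 + y2 * wd G x t2 + y3 * wd G x t3 = 0 ∧ (y1 ≠ 0 ∨ y2 ≠ 0 ∨ y3 ≠ 0) := by
    by_cases h : wd G x t1 = wd G x t2
    · exact ⟨1, -1, 0, by ring, by rw [h]; ring, by simp⟩
    · refine ⟨wd G x t2 - wd G x t3, wd G x t3 - wd G x t1, wd G x t1 - wd G x t2,
        by ring, by ring, Or.inr (Or.inr (sub_ne_zero.2 h))⟩
  obtain ⟨y1, y2, y3, hsum, hd, hnz, hδ⟩ : ∃ y1 y2 y3 : ℝ, y1 + y2 + y3 = 0 ∧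
      y1 * wd G x t1 + y2 * wd G x t2 + y3 * wd G x t3 = 0 ∧ (y1 ≠ 0 ∨ y2 ≠ 0 ∨ y3 ≠ 0) ∧
      0 ≤ y1 * wd B x t1 + y2 * wd B x t2 + y3 * wd B x t3 := by
    rcases le_total 0 (y1 * wd B x t1 + y2 * wd B x t2 + y3 * wd B x t3) with h | h
    · exact ⟨y1, y2, y3, hsum, hd, hnz, h⟩
    · refine ⟨-y1, -y2, -y3, by linarith, by linarith, ?_, by linarith⟩
      simpa using hnz
  have Y1 : Y y1 y2 y3 t1 = y1 := by simp [Y]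
  have Y2 : Y y1 y2 y3 t2 = y2 := by simp [Y, h12.symm]
  have Y3 : Y y1 y2 y3 t3 = y3 := by simp [Y, h13.symm, h23.symm]
  have hneg : ∃ a, Y y1 y2 y3 a < 0 := by
    by_contra hcon
    push Not at hcon
    have g1 := hcon t1; have g2 := hcon t2; have g3 := hcon t3
    rw [Y1] at g1; rw [Y2] at g2; rw [Y3] at g3
    rcases hnz with h | h | h <;> apply h <;> linarith
  obtain ⟨s, hs0, hpos, a0, ha0, ha0'⟩ := move x (Y y1 y2 y3) hx (by
    intro a ha
    have e1 : a ≠ t1 := by rintro rfl; exact h1 ha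
    have e2 : a ≠ t2 := by rintro rfl; exact h2 ha
    have e3 : a ≠ t3 := by rintro rfl; exact h3 ha
    simp [Y, e1, e2, e3]) hneg
  have q := fun H => Wt_quad (V := V) H x (Y y1 y2 y3) 1 s
  simp only [one_mul, one_pow, mul_one] at q
  refine ⟨fun a => x a + s * Y y1 y2 y3 a, hpos, ?_, ?_, ?_, ?_⟩
  · rw [Finset.sum_add_distrib, ← Finset.mul_sum, hs]
    have := hYsum (fun _ => 1) y1 y2 y3
    simp only [mul_one] at this
    rw [this, hsum]; ring
  · rw [q, hYY G le_rfl, Wt_eq G (Y y1 y2 y3), hYsum, hd]; linarith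
  · rw [q, hYY B hle, Wt_eq B (Y y1 y2 y3), hYsum]
    nlinarith [mul_nonneg hs0 hδ]
  · apply Finset.card_lt_card
    rw [Finset.ssubset_iff_of_subset]
    · exact ⟨a0, by simpa using ha0, by simpa using ha0'⟩
    · intro a
      simp only [Finset.mem_filter, Finset.mem_univ, true_and]
      intro h hxa
      apply h
      have e1 : a ≠ t1 := by rintro rfl; exact h1 hxa
      have e2 : a ≠ t2 := by rintro rfl; exact h2 hxa
      have e3 : a ≠ t3 := by rintro rfl; exact h3 hxa
      simp [Y, e1, e2, e3, hxa]

/-- No blue edge lies on a closed walk of length five. -/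
def NoWalk {V : Type*} (G B : SimpleGraph V) : Prop :=
  ∀ u v x y z, B.Adj u v → G.Adj u x → G.Adj x y → G.Adj y z → G.Adj z v → False

lemma NoWalk.tri {G B : SimpleGraph V} (h : NoWalk G B) (hle : B ≤ G) {i j y z : V}
    (hb : B.Adj j i) (h1 : G.Adj i y) (h2 : G.Adj y z) (h3 : G.Adj z i) : False :=
  h j i i y z hb (hle hb) h1 h2 h3

lemma final1 (G B : SimpleGraph V) (hle : B ≤ G) (hw : NoWalk G B) (x : V → ℝ)
    (hx : ∀ a, 0 ≤ x a) (hs : ∑ a, x a = 1)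
    (hα : ∀ t1 t2 t3, x t1 ≠ 0 → x t2 ≠ 0 → x t3 ≠ 0 → t1 ≠ t2 → t1 ≠ t3 → t2 ≠ t3 →
      G.Adj t1 t2 ∨ G.Adj t1 t3 ∨ G.Adj t2 t3)
    (hE : 1 / 2 < Wt G x x) (u v : V) (hu : x u ≠ 0) (hv : x v ≠ 0) (huv : B.Adj u v)
    (hQ : ∀ a, x a ≠ 0 → G.Adj v a → a = u) :
    Wt B x x ≤ (2 - Real.sqrt 2) / 8 := by
  have huvne : u ≠ v := huv.ne
  have huvG := hle huv
  obtain ⟨p, q, r, hp, hq, hr, hpq, hqr, hrp⟩ := mantel G x hx hs hE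
  -- blue support edges other than uv are impossible
  have hclique : ∀ i j, x i ≠ 0 → x j ≠ 0 → i ≠ u → i ≠ v → j ≠ u → j ≠ v → i ≠ j → G.Adj i j := by
    intro i j hi hj hiu hiv hju hjv hij
    rcases hα v i j hv hi hj hiv.symm hjv.symm hij with h | h | h
    · exact absurd (hQ i hi h) hiu
    · exact absurd (hQ j hj h) hju
    · exact h
  have hntri : ∀ i y z, (i = u ∨ i = v) → G.Adj i y → G.Adj y z → G.Adj z i → False := by
    rintro i y z (rfl | rfl) h1 h2 h3
    · exact hw.tri hle huv.symm h1 h2 h3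
    · exact hw.tri hle huv h1 h2 h3
  have hpu : p ≠ u ∧ p ≠ v := by
    constructor <;> rintro rfl
    · exact hntri _ _ _ (Or.inl rfl) hpq hqr hrp
    · exact hntri _ _ _ (Or.inr rfl) hpq hqr hrp
  have hqu : q ≠ u ∧ q ≠ v := by
    constructor <;> rintro rfl
    · exact hntri _ _ _ (Or.inl rfl) hqr hrp hpq
    · exact hntri _ _ _ (Or.inr rfl) hqr hrp hpq
  have hru : r ≠ u ∧ r ≠ v := by
    constructor <;> rintro rfl
    · exact hntri _ _ _ (Or.inl rfl) hrp hpq hqr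
    · exact hntri _ _ _ (Or.inr rfl) hrp hpq hqr
  have hCtri : ∀ i j, x i ≠ 0 → i ≠ u → i ≠ v → B.Adj j i → False := by
    intro i j hi hiu hiv hb
    by_cases h1 : i = p
    · subst h1; exact hw.tri hle hb hpq hqr hrp
    by_cases h2 : i = q
    · subst h2; exact hw.tri hle hb hqr hrp hpq
    exact hw.tri hle hb (hclique i p hi hp.ne' hiu hiv hpu.1 hpu.2 h1) hpq
      (hclique i q hi hq.ne' hiu hiv hqu.1 hqu.2 h2).symm
  have hblue : ∀ i j, x i ≠ 0 → x j ≠ 0 → B.Adj i j → (i = u ∧ j = v) ∨ (i = v ∧ j = u) := by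
    intro i j hi hj hb
    by_cases h1 : i = u
    · by_cases h2 : j = v
      · exact Or.inl ⟨h1, h2⟩
      · exfalso
        refine hCtri j i hj ?_ h2 hb
        rintro rfl; exact hb.ne h1
    · by_cases h2 : i = v
      · right
        exact ⟨h2, hQ j hj (by rw [← h2]; exact hle hb)⟩
      · exact (hCtri i j hi h1 h2 hb.symm).elim
  have hB : Wt B x x = 2 * (x u * x v) := by
    have hterm : ∀ i j, (if B.Adj i j then x i * x j else 0)
        = (if i = u then if j = v then x u * x v else 0 else 0)
          + (if i = v then if j = u then x u * x v else 0 else 0) := by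
      intro i j
      by_cases hi : x i = 0
      · have e1 : i ≠ u := by rintro rfl; exact hu hi
        have e2 : i ≠ v := by rintro rfl; exact hv hi
        simp [hi, e1, e2]
      by_cases hj : x j = 0
      · have e1 : j ≠ u := by rintro rfl; exact hu hj
        have e2 : j ≠ v := by rintro rfl; exact hv hj
        simp [hj, e1, e2]
      by_cases hb : B.Adj i j
      · rcases hblue i j hi hj hb with ⟨rfl, rfl⟩ | ⟨rfl, rfl⟩
        · simp [hb, huvne]
        · simp [hb, huvne.symm, mul_comm]
      · have c1 : ¬ (i = u ∧ j = v) := by rintro ⟨rfl, rfl⟩; exact hb huv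
        have c2 : ¬ (i = v ∧ j = u) := by rintro ⟨rfl, rfl⟩; exact hb huv.symm
        rw [if_neg hb, ← ite_and, ← ite_and, if_neg c1, if_neg c2]; ring
    unfold Wt
    simp only [hterm, Finset.sum_add_distrib]
    simp
    ring
  -- upper bound on the edges
  set w : ℝ := ∑ a, if G.Adj u a ∧ a ≠ v then x a else 0 with hwdef
  set k : ℝ := ∑ a, if ¬ G.Adj u a ∧ a ≠ u then x a else 0 with hkdef
  have hk0 : 0 ≤ k := Finset.sum_nonneg fun a _ => by split_ifs; exacts [hx a, le_rfl]
  have hw0 : 0 ≤ w := Finset.sum_nonneg fun a _ => by split_ifs; exacts [hx a, le_rfl]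
  have htot : x u + x v + w + k = 1 := by
    have e1 : x u = ∑ a, if a = u then x a else 0 := by simp
    have e2 : x v = ∑ a, if a = v then x a else 0 := by simp
    rw [e1, e2, ← hs, hwdef, hkdef]
    simp only [← Finset.sum_add_distrib]
    refine Finset.sum_congr rfl fun a _ => ?_
    by_cases h1 : a = u
    · subst h1; simp [huvne]
    by_cases h2 : a = v
    · subst h2; simp [huvne.symm, huvG]
    by_cases h3 : G.Adj u a <;> simp [h1, h2, h3]
  have du : wd G x u ≤ x v + w := by
    have e2 : x v = ∑ a, if a = v then x a else 0 := by simp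
    rw [e2, hwdef, ← Finset.sum_add_distrib]
    refine Finset.sum_le_sum fun a _ => ?_
    by_cases h2 : a = v
    · subst h2; simp [huvG]
    by_cases h3 : G.Adj u a <;> simp [h2, h3]
  have dv : wd G x v ≤ x u := by
    have e1 : x u = ∑ a, if a = u then x a else 0 := by simp
    rw [e1]
    refine Finset.sum_le_sum fun a _ => ?_
    by_cases h0 : x a = 0
    · simp [h0]
    by_cases h3 : G.Adj v a
    · have := hQ a h0 h3; subst this; simp [huvG.symm]
    · simp only [h3, if_false]; split_ifs; exacts [hx a, le_rfl]
  have dP : ∀ j, G.Adj u j → j ≠ v → wd G x j ≤ x u + k := by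
    intro j hj hjv
    have e1 : x u = ∑ a, if a = u then x a else 0 := by simp
    rw [e1, hkdef, ← Finset.sum_add_distrib]
    refine Finset.sum_le_sum fun a _ => ?_
    by_cases h1 : a = u
    · subst h1; simp [hj.symm]
    by_cases h3 : G.Adj j a
    · have : ¬ G.Adj u a := fun h => hntri u j a (Or.inl rfl) hj h3 h.symm
      simp [h1, h3, this]
    · simp only [h3, h1, if_false]; split_ifs <;> simp [hx a]
  have dZ : ∀ j, x j ≠ 0 → ¬ G.Adj u j → j ≠ u → wd G x j ≤ w + k := by
    intro j hj0 hj hju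
    rw [hwdef, hkdef, ← Finset.sum_add_distrib]
    refine Finset.sum_le_sum fun a _ => ?_
    by_cases h3 : G.Adj j a
    · have h1 : a ≠ u := by rintro rfl; exact hj h3.symm
      have h2 : a ≠ v := by
        rintro rfl
        exact hju (hQ j hj0 h3.symm)
      by_cases h4 : G.Adj u a <;> simp [h1, h2, h3, h4]
    · simp only [h3, if_false]
      have := hx a
      split_ifs <;> simp [this]
  have hEup : Wt G x x ≤ 2 * (x u * x v + x u * w + w * k) + k ^ 2 := by
    have step : Wt G x x ≤ ∑ a, ((if a = u then x a * (x v + w) else 0)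
        + (if a = v then x a * x u else 0)
        + (if G.Adj u a ∧ a ≠ v then x a else 0) * (x u + k)
        + (if ¬ G.Adj u a ∧ a ≠ u then x a else 0) * (w + k)) := by
      rw [Wt_eq]
      refine Finset.sum_le_sum fun a _ => ?_
      have hxa := hx a
      by_cases h1 : a = u
      · subst h1; simp [huvne]; exact mul_le_mul_of_nonneg_left du hxa
      by_cases h2 : a = v
      · subst h2; simp [huvne.symm, huvG]; exact mul_le_mul_of_nonneg_left dv hxa
      by_cases h3 : G.Adj u a
      · simp [h1, h2, h3]; exact mul_le_mul_of_nonneg_left (dP a h3 h2) hxa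
      · by_cases h0 : x a = 0
        · simp [h0]
        simp [h1, h2, h3]; exact mul_le_mul_of_nonneg_left (dZ a h0 h3 h1) hxa
    simp only [Finset.sum_add_distrib, ← Finset.sum_mul, ← hwdef, ← hkdef] at step
    simp only [Finset.sum_ite_eq', Finset.mem_univ, if_true] at step
    linarith
  rw [hB]
  exact numeric (x u) (x v) w k (hx u) (hx v) hk0 htot (lt_of_lt_of_le hE hEup)

lemma final2 (G B : SimpleGraph V) (hle : B ≤ G) (hw : NoWalk G B) (x : V → ℝ)
    (hx : ∀ a, 0 ≤ x a) (hs : ∑ a, x a = 1)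
    (hα : ∀ t1 t2 t3, x t1 ≠ 0 → x t2 ≠ 0 → x t3 ≠ 0 → t1 ≠ t2 → t1 ≠ t3 → t2 ≠ t3 →
      G.Adj t1 t2 ∨ G.Adj t1 t3 ∨ G.Adj t2 t3)
    (hE : 1 / 2 < Wt G x x) :
    Wt B x x ≤ (2 - Real.sqrt 2) / 8 := by
  by_cases hex : ∃ u v, x u ≠ 0 ∧ x v ≠ 0 ∧ B.Adj u v
  swap
  · push Not at hex
    have : Wt B x x = 0 := by
      unfold Wt
      refine Finset.sum_eq_zero fun a _ => Finset.sum_eq_zero fun b _ => ?_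
      by_cases ha : x a = 0
      · simp [ha]
      by_cases hb : x b = 0
      · simp [hb]
      simp [hex a b ha hb]
    rw [this]
    have : Real.sqrt 2 ≤ 2 := by
      rw [Real.sqrt_le_left (by norm_num)]; norm_num
    linarith
  obtain ⟨u, v, hu, hv, huv⟩ := hex
  by_cases hQ : ∀ a, x a ≠ 0 → G.Adj v a → a = u
  · exact final1 G B hle hw x hx hs hα hE u v hu hv huv hQ
  by_cases hP : ∀ a, x a ≠ 0 → G.Adj u a → a = v
  · exact final1 G B hle hw x hx hs hα hE v u hv hu huv.symm hP
  exfalso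
  push Not at hQ hP
  obtain ⟨q, hq0, hvq, hqu⟩ := hQ
  obtain ⟨p, hp0, hup, hpv⟩ := hP
  have huvG := hle huv
  obtain ⟨a, b, c, ha, hb, hc, hab, hbc, hca⟩ := mantel G x hx hs hE
  have hntri : ∀ i y z, (i = u ∨ i = v) → G.Adj i y → G.Adj y z → G.Adj z i → False := by
    rintro i y z (rfl | rfl) h1 h2 h3
    · exact hw.tri hle huv.symm h1 h2 h3
    · exact hw.tri hle huv h1 h2 h3
  have hPQ : ∀ z, x z ≠ 0 → G.Adj u z ∨ G.Adj v z := by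
    intro z hz
    by_contra hcon
    push Not at hcon
    obtain ⟨h1, h2⟩ := hcon
    have zu : z ≠ u := by rintro rfl; exact h2 huvG.symm
    have zv : z ≠ v := by rintro rfl; exact h1 huvG
    have zp : z ≠ p := by rintro rfl; exact h1 hup
    have zq : z ≠ q := by rintro rfl; exact h2 hvq
    have nuq : ¬ G.Adj u q := fun h => hntri u q v (Or.inl rfl) h hvq.symm huvG.symm
    have nvp : ¬ G.Adj v p := fun h => hntri v p u (Or.inr rfl) h hup.symm huvG
    have a1 : G.Adj z q := by
      rcases hα u z q hu hz hq0 zu.symm hqu.symm zq with h | h | h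
      · exact absurd h h1
      · exact absurd h nuq
      · exact h
    have a2 : G.Adj z p := by
      rcases hα v z p hv hz hp0 zv.symm hpv.symm zp with h | h | h
      · exact absurd h h2
      · exact absurd h nvp
      · exact h
    exact hw u v p z q huv hup a2.symm a1 hvq.symm
  have two : ∀ i j, G.Adj i j → (G.Adj u i → G.Adj u j → False) ∧ (G.Adj v i → G.Adj v j → False) := by
    intro i j hij
    exact ⟨fun h1 h2 => hntri u i j (Or.inl rfl) h1 hij h2.symm,
      fun h1 h2 => hntri v i j (Or.inr rfl) h1 hij h2.symm⟩
  have t1 := two a b hab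
  have t2 := two b c hbc
  have t3 := two c a hca
  have := hPQ a ha.ne'; have := hPQ b hb.ne'; have := hPQ c hc.ne'
  tauto

theorem weighted (G B : SimpleGraph V) (hle : B ≤ G) (hw : NoWalk G B) :
    ∀ (N : ℕ) (x : V → ℝ), (Finset.univ.filter fun a => x a ≠ 0).card = N →
    (∀ a, 0 ≤ x a) → ∑ a, x a = 1 → 1 / 2 < Wt G x x → Wt B x x ≤ (2 - Real.sqrt 2) / 8 := by
  intro N
  induction N using Nat.strong_induction_on with
  | _ N ih =>
    intro x hN hx hs hE
    by_cases hα : ∀ t1 t2 t3, x t1 ≠ 0 → x t2 ≠ 0 → x t3 ≠ 0 → t1 ≠ t2 → t1 ≠ t3 → t2 ≠ t3 →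
      G.Adj t1 t2 ∨ G.Adj t1 t3 ∨ G.Adj t2 t3
    · exact final2 G B hle hw x hx hs hα hE
    push Not at hα
    obtain ⟨t1, t2, t3, h1, h2, h3, h12, h13, h23, n12, n13, n23⟩ := hα
    obtain ⟨x', hx', hs', hE', hB', hc⟩ :=
      reduce G B hle x hx hs t1 t2 t3 h1 h2 h3 h12 h13 h23 n12 n13 n23
    exact hB'.trans (ih _ (hN ▸ hc) x' rfl hx' hs' (lt_of_lt_of_le hE hE'))

/-- No blue edge lies on a five-cycle. -/
def NoC5 {V : Type*} (G B : SimpleGraph V) : Prop :=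
  ∀ a b c d e, B.Adj a b → G.Adj b c → G.Adj c d → G.Adj d e → G.Adj e a →
    a ≠ c → a ≠ d → b ≠ d → b ≠ e → c ≠ e → False

/-- Pairs deleted in the cleaning step on behalf of `u`. -/
def Del {V : Type*} (G B : SimpleGraph V) (u x y : V) : Prop :=
  B.Adj u x ∧ ∃ z, G.Adj x y ∧ G.Adj y z ∧ G.Adj z x ∧ u ≠ y ∧ u ≠ z

lemma Del_card (G B : SimpleGraph V) (hle : B ≤ G) (h5 : NoC5 G B) (u y : V) :
    (Finset.univ.filter fun x => Del G B u x y).card ≤ 2 := by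
  by_contra hcon
  push Not at hcon
  rw [Finset.two_lt_card] at hcon
  obtain ⟨x1, m1, x2, m2, x3, m3, n12, n13, n23⟩ := hcon
  simp only [Finset.mem_filter, Finset.mem_univ, true_and] at m1 m2 m3
  obtain ⟨b1, z1, a1, c1, d1, e1, f1⟩ := m1
  obtain ⟨b2, z2, a2, c2, d2, e2, f2⟩ := m2
  obtain ⟨b3, z3, a3, c3, d3, e3, f3⟩ := m3
  have key : ∀ w, B.Adj u w → G.Adj w y → w ≠ x1 → w = z1 := by
    intro w hw hwy hne
    by_contra hz
    exact h5 x1 u w y z1 b1.symm (hle hw) hwy c1 d1 hne.symm a1.ne e1 f1 hz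
  have k2 := key x2 b2 a2 n12.symm
  have k3 := key x3 b3 a3 n13.symm
  exact n23 (k2.trans k3.symm)

lemma sum_ind {α : Type*} (s : Finset α) (p : α → Prop) [DecidablePred p] :
    (∑ a ∈ s, if p a then (1 : ℝ) else 0) = ((s.filter p).card : ℝ) := by
  rw [Finset.sum_ite]; simp

lemma clean (G B : SimpleGraph V) (hle : B ≤ G) (h5 : NoC5 G B) (hV : 0 < Fintype.card V) :
    ∃ G' B' : SimpleGraph V, G' ≤ G ∧ B' ≤ G' ∧ NoWalk G' B' ∧
      Wt G (fun _ => 1) (fun _ => 1) - 6 * (Fintype.card V * Real.sqrt (Fintype.card V))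
        ≤ Wt G' (fun _ => 1) (fun _ => 1) ∧
      Wt B (fun _ => 1) (fun _ => 1) - 8 * (Fintype.card V * Real.sqrt (Fintype.card V))
        ≤ Wt B' (fun _ => 1) (fun _ => 1) := by
  set n : ℝ := (Fintype.card V : ℝ) with hn
  have hn0 : 0 < n := by rw [hn]; exact Nat.cast_pos.2 hV
  set r := Real.sqrt n with hr
  have hr0 : 0 < r := Real.sqrt_pos.2 hn0
  have hrr : r * r = n := Real.mul_self_sqrt hn0.le
  let cov : Finset V → Finset V := fun U => U.biUnion fun u => Finset.univ.filter (B.Adj u)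
  have hcov : ∀ U a, a ∈ cov U ↔ ∃ u ∈ U, B.Adj u a := by
    intro U a; simp [cov]
  obtain ⟨U, hU, hmax⟩ := Finset.exists_max_image
    (Finset.univ.filter fun U : Finset V => r * U.card ≤ (cov U).card) Finset.card
    ⟨∅, by simp⟩
  simp only [Finset.mem_filter, Finset.mem_univ, true_and] at hU hmax
  have hUc : (U.card : ℝ) ≤ r := by
    have h1 : ((cov U).card : ℝ) ≤ n := by
      rw [hn]; exact_mod_cast Finset.card_le_univ _
    have : r * U.card ≤ r * r := by rw [hrr]; linarith
    exact le_of_mul_le_mul_left this hr0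
  have hunc : ∀ b, ((Finset.univ.filter fun a => B.Adj b a ∧ a ∉ cov U).card : ℝ) ≤ r := by
    intro b
    by_contra hcon
    push Not at hcon
    by_cases hb : b ∈ U
    · have : (Finset.univ.filter fun a => B.Adj b a ∧ a ∉ cov U) = ∅ := by
        ext a
        simp only [Finset.mem_filter, Finset.mem_univ, true_and, Finset.notMem_empty, iff_false,
          not_and, not_not]
        intro h
        exact (hcov U a).2 ⟨b, hb, h⟩
      rw [this] at hcon
      simp at hcon; linarith
    · have hsub : cov (insert b U) = cov U ∪ (Finset.univ.filter fun a => B.Adj b a ∧ a ∉ cov U) := by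
        ext a
        rw [Finset.mem_union, hcov, hcov]
        simp only [Finset.mem_insert, exists_eq_or_imp, Finset.mem_filter, Finset.mem_univ, true_and,
          hcov]
        by_cases h : ∃ u ∈ U, B.Adj u a <;> simp [h]
      have hdisj : Disjoint (cov U) (Finset.univ.filter fun a => B.Adj b a ∧ a ∉ cov U) := by
        rw [Finset.disjoint_left]
        intro a ha
        simp [ha]
      have := hmax (insert b U) (by
        rw [hsub, Finset.card_union_of_disjoint hdisj, Finset.card_insert_of_notMem hb]
        push_cast
        linarith)
      rw [Finset.card_insert_of_notMem hb] at this
      omega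
  let D : V → V → Prop := fun x y => ∃ u ∈ U, Del G B u x y
  let G' : SimpleGraph V :=
    { Adj := fun a b => G.Adj a b ∧ a ∉ U ∧ b ∉ U ∧ ¬ D a b ∧ ¬ D b a
      symm := ⟨fun a b h => ⟨h.1.symm, h.2.2.1, h.2.1, h.2.2.2.2, h.2.2.2.1⟩⟩
      loopless := ⟨fun a h => G.loopless.irrefl a h.1⟩ }
  let B' : SimpleGraph V :=
    { Adj := fun a b => B.Adj a b ∧ G'.Adj a b ∧ a ∈ cov U ∧ b ∈ cov U
      symm := ⟨fun a b h => ⟨h.1.symm, h.2.1.symm, h.2.2.2, h.2.2.1⟩⟩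
      loopless := ⟨fun a h => B.loopless.irrefl a h.1⟩ }
  have hG'G : G' ≤ G := fun a b h => h.1
  have htri : ∀ x y z, x ∈ cov U → G'.Adj x y → G'.Adj y z → G'.Adj z x → False := by
    intro x y z hx hxy hyz hzx
    obtain ⟨u, hu, hux⟩ := (hcov U x).1 hx
    apply hxy.2.2.2.1
    refine ⟨u, hu, hux, z, hxy.1, hyz.1, hzx.1, ?_, ?_⟩
    · rintro rfl; exact hxy.2.2.1 hu
    · rintro rfl; exact hzx.2.1 hu
  refine ⟨G', B', hG'G, fun a b h => h.2.1, ?_, ?_, ?_⟩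
  · intro u v x y z huv hux hxy hyz hzv
    have huv' := huv.2.1
    have hu := huv.2.2.1
    have hv := huv.2.2.2
    by_cases e1 : u = y
    · subst e1; exact htri u z v hu hyz hzv huv'.symm
    by_cases e2 : u = z
    · subst e2; exact htri u x y hu hux hxy hyz
    by_cases e3 : x = z
    · subst e3; exact htri u x v hu hux hzv huv'.symm
    by_cases e4 : x = v
    · subst e4; exact htri x y z hv hxy hyz hzv
    by_cases e5 : y = v
    · subst e5; exact htri u x y hu hux hxy huv'.symm
    exact h5 v u x y z huv.1.symm hux.1 hxy.1 hyz.1 hzv.1 (Ne.symm e4) (Ne.symm e5) e1 e2 e3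
  all_goals
    have hDsum : (∑ a, ∑ b, if D a b then (1 : ℝ) else 0) ≤ 2 * (n * r) := by
      rw [Finset.sum_comm]
      have : ∀ b, (∑ a, if D a b then (1 : ℝ) else 0) ≤ 2 * r := by
        intro b
        have h1 : ∀ a, (if D a b then (1 : ℝ) else 0) ≤ ∑ u ∈ U, if Del G B u a b then (1 : ℝ) else 0 := by
          intro a
          split_ifs with h
          · obtain ⟨u, hu, hd⟩ := h
            have := Finset.single_le_sum (f := fun u => if Del G B u a b then (1 : ℝ) else 0)
              (fun i _ => by positivity) hu
            simpa [hd] using this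
          · positivity
        calc (∑ a, if D a b then (1 : ℝ) else 0)
            ≤ ∑ a, ∑ u ∈ U, (if Del G B u a b then (1 : ℝ) else 0) := Finset.sum_le_sum fun a _ => h1 a
          _ = ∑ u ∈ U, ∑ a, (if Del G B u a b then (1 : ℝ) else 0) := Finset.sum_comm
          _ ≤ ∑ u ∈ U, (2 : ℝ) := by
            refine Finset.sum_le_sum fun u _ => ?_
            rw [sum_ind]
            exact_mod_cast Del_card G B hle h5 u b
          _ = 2 * U.card := by simp [mul_comm]
          _ ≤ 2 * r := by linarith
      calc _ ≤ ∑ b : V, 2 * r := Finset.sum_le_sum fun b _ => this b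
        _ = 2 * (n * r) := by simp [hn]; ring
    have hDsum' : (∑ a, ∑ b, if D b a then (1 : ℝ) else 0) ≤ 2 * (n * r) := by
      rw [Finset.sum_comm]; exact hDsum
    have hUsum : (∑ a, ∑ b : V, if a ∈ U then (1 : ℝ) else 0) ≤ n * r := by
      have : (∑ a, ∑ b : V, if a ∈ U then (1 : ℝ) else 0) = n * U.card := by
        simp [hn, mul_comm]
      rw [this]; exact mul_le_mul_of_nonneg_left hUc hn0.le
    have hUsum' : (∑ a : V, ∑ b : V, if b ∈ U then (1 : ℝ) else 0) ≤ n * r := by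
      rw [Finset.sum_comm]; exact hUsum
  · have : Wt G (fun _ => 1) (fun _ => 1) ≤ Wt G' (fun _ => 1) (fun _ => 1)
        + (∑ a, ∑ b : V, if a ∈ U then (1 : ℝ) else 0) + (∑ a : V, ∑ b : V, if b ∈ U then (1 : ℝ) else 0)
        + (∑ a, ∑ b, if D a b then (1 : ℝ) else 0) + (∑ a, ∑ b, if D b a then (1 : ℝ) else 0) := by
      unfold Wt
      simp only [← Finset.sum_add_distrib]
      refine Finset.sum_le_sum fun a _ => Finset.sum_le_sum fun b _ => ?_
      by_cases h0 : G.Adj a b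
      swap
      · rw [if_neg h0]; positivity
      have hiff : G'.Adj a b ↔ (G.Adj a b ∧ a ∉ U ∧ b ∉ U ∧ ¬ D a b ∧ ¬ D b a) := Iff.rfl
      by_cases h1 : a ∈ U <;> by_cases h2 : b ∈ U <;> by_cases h3 : D a b <;> by_cases h4 : D b a <;>
        simp [hiff, h0, h1, h2, h3, h4] <;> norm_num
    linarith
  · have hCsum : (∑ a, ∑ b, if (B.Adj a b ∧ b ∉ cov U) then (1 : ℝ) else 0) ≤ n * r := by
      calc _ ≤ ∑ a : V, r := Finset.sum_le_sum fun a _ => by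
              have := hunc a
              rw [sum_ind]; convert this
        _ = n * r := by simp [hn]
    have hCsum' : (∑ a, ∑ b, if (B.Adj b a ∧ a ∉ cov U) then (1 : ℝ) else 0) ≤ n * r := by
      rw [Finset.sum_comm]; exact hCsum
    have : Wt B (fun _ => 1) (fun _ => 1) ≤ Wt B' (fun _ => 1) (fun _ => 1)
        + (∑ a, ∑ b : V, if a ∈ U then (1 : ℝ) else 0) + (∑ a : V, ∑ b : V, if b ∈ U then (1 : ℝ) else 0)
        + (∑ a, ∑ b, if D a b then (1 : ℝ) else 0) + (∑ a, ∑ b, if D b a then (1 : ℝ) else 0)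
        + (∑ a, ∑ b, if (B.Adj a b ∧ b ∉ cov U) then (1 : ℝ) else 0)
        + (∑ a, ∑ b, if (B.Adj b a ∧ a ∉ cov U) then (1 : ℝ) else 0) := by
      unfold Wt
      simp only [← Finset.sum_add_distrib]
      refine Finset.sum_le_sum fun a _ => Finset.sum_le_sum fun b _ => ?_
      by_cases h0 : B.Adj a b
      swap
      · rw [if_neg h0]; positivity
      have hiff : B'.Adj a b ↔ (B.Adj a b ∧ (G.Adj a b ∧ a ∉ U ∧ b ∉ U ∧ ¬ D a b ∧ ¬ D b a) ∧
        a ∈ cov U ∧ b ∈ cov U) := Iff.rfl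
      have h0' := hle h0
      by_cases hall : (a ∉ U ∧ b ∉ U ∧ ¬ D a b ∧ ¬ D b a) ∧ a ∈ cov U ∧ b ∈ cov U
      · rw [if_pos h0, if_pos (hiff.2 ⟨h0, ⟨h0', hall.1⟩, hall.2⟩)]
        have : ∀ (p : Prop) [Decidable p], (0 : ℝ) ≤ if p then 1 else 0 := by
          intro p _; positivity
        linarith [this (a ∈ U), this (b ∈ U), this (D a b), this (D b a),
          this (B.Adj a b ∧ b ∉ cov U), this (B.Adj b a ∧ a ∉ cov U)]
      · rw [if_pos h0, if_neg (fun h => hall ⟨(hiff.1 h).2.1.2, (hiff.1 h).2.2⟩)]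
        have pos : ∀ (p : Prop) [Decidable p], (0 : ℝ) ≤ if p then 1 else 0 := by
          intro p _; positivity
        have one : ∀ (p : Prop) [Decidable p], p → (1 : ℝ) ≤ if p then 1 else 0 := by
          intro p _ hp; simp [hp]
        have q1 := pos (a ∈ U); have q2 := pos (b ∈ U); have q3 := pos (D a b)
        have q4 := pos (D b a)
        have q5 := pos (B.Adj a b ∧ b ∉ cov U); have q6 := pos (B.Adj b a ∧ a ∉ cov U)
        by_cases h1 : a ∈ U
        · linarith [one _ h1]
        by_cases h2 : b ∈ U
        · linarith [one _ h2]
        by_cases h3 : D a b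
        · linarith [one _ h3]
        by_cases h4 : D b a
        · linarith [one _ h4]
        by_cases h5 : b ∈ cov U
        · by_cases h6 : a ∈ cov U
          · exact absurd ⟨⟨h1, h2, h3, h4⟩, h6, h5⟩ hall
          · linarith [one _ (⟨h0.symm, h6⟩ : B.Adj b a ∧ a ∉ cov U)]
        · linarith [one _ (⟨h0, h5⟩ : B.Adj a b ∧ b ∉ cov U)]
    linarith

/-- neighbourhood as a finset -/
noncomputable def nb (G : SimpleGraph V) (a : V) : Finset V := Finset.univ.filter (G.Adj a)

lemma mem_nb (G : SimpleGraph V) (a b : V) : b ∈ nb G a ↔ G.Adj a b := by simp [nb]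

lemma com2 (G B : SimpleGraph V) (hle : B ≤ G) (h5 : NoC5 G B) (k : ℝ)
    (hd : ∀ a, k ≤ ((nb G a).card : ℝ)) (hk : (Fintype.card V : ℝ) + 7 ≤ 3 * k)
    (a b : V) (hab : B.Adj a b) : (nb G a ∩ nb G b).card ≤ 2 := by
  by_contra hcon
  push Not at hcon
  rw [Finset.two_lt_card] at hcon
  obtain ⟨x1, m1, x2, m2, x3, m3, n12, n13, n23⟩ := hcon
  simp only [Finset.mem_inter, mem_nb] at m1 m2 m3
  have hdis : ∀ c c', (G.Adj a c ∧ G.Adj b c) → (G.Adj a c' ∧ G.Adj b c') → c ≠ c' →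
      Disjoint (nb G c \ {a, b}) (nb G c' \ {a, b}) := by
    intro c c' hc hc' hne
    rw [Finset.disjoint_left]
    intro w hw hw'
    simp only [Finset.mem_sdiff, mem_nb, Finset.mem_insert, Finset.mem_singleton, not_or] at hw hw'
    exact h5 a b c w c' hab hc.2 hw.1 hw'.1.symm hc'.1.symm hc.1.ne (Ne.symm hw.2.1)
      (Ne.symm hw.2.2) hc'.2.ne hne
  have hcd : ∀ c, k - 2 ≤ ((nb G c \ {a, b}).card : ℝ) := by
    intro c
    have h1 := Finset.le_card_sdiff ({a, b} : Finset V) (nb G c)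
    have h2 : ({a, b} : Finset V).card ≤ 2 := Finset.card_le_two
    have h3 : (nb G c).card ≤ (nb G c \ {a, b}).card + 2 := by omega
    have h4 : ((nb G c).card : ℝ) ≤ (nb G c \ {a, b}).card + 2 := by exact_mod_cast h3
    linarith [hd c]
  have hU : ((nb G x1 \ {a, b}) ∪ (nb G x2 \ {a, b}) ∪ (nb G x3 \ {a, b})).card
      = (nb G x1 \ {a, b}).card + (nb G x2 \ {a, b}).card + (nb G x3 \ {a, b}).card := by
    rw [Finset.card_union_of_disjoint, Finset.card_union_of_disjoint (hdis _ _ m1 m2 n12)]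
    rw [Finset.disjoint_union_left]
    exact ⟨hdis _ _ m1 m3 n13, hdis _ _ m2 m3 n23⟩
  have hle' := Finset.card_le_univ
    ((nb G x1 \ {a, b}) ∪ (nb G x2 \ {a, b}) ∪ (nb G x3 \ {a, b}))
  rw [hU] at hle'
  have : ((nb G x1 \ {a, b}).card : ℝ) + (nb G x2 \ {a, b}).card + (nb G x3 \ {a, b}).card
      ≤ Fintype.card V := by exact_mod_cast hle'
  linarith [hcd x1, hcd x2, hcd x3]

lemma Wcard (G B : SimpleGraph V) (hle : B ≤ G) (h5 : NoC5 G B) (k : ℝ)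
    (hd : ∀ a, k ≤ ((nb G a).card : ℝ)) (hk : (Fintype.card V : ℝ) + 7 ≤ 3 * k)
    (a b : V) (hab : B.Adj a b) (w : V) :
    3 * k - Fintype.card V - 4 ≤ (((nb G w ∩ (nb G a ∪ nb G b)) \ {a, b}).card : ℝ) := by
  have h1 := Finset.le_card_sdiff ({a, b} : Finset V) (nb G w ∩ (nb G a ∪ nb G b))
  have h2 : ({a, b} : Finset V).card ≤ 2 := Finset.card_le_two
  have h3 := com2 G B hle h5 k hd hk a b hab
  have h4 := Finset.card_union_add_card_inter (nb G a) (nb G b)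
  have h5 := Finset.card_union_add_card_inter (nb G w) (nb G a ∪ nb G b)
  have h6 := Finset.card_le_univ (nb G w ∪ (nb G a ∪ nb G b))
  have h7 : (nb G w).card + (nb G a).card + (nb G b).card ≤
    ((nb G w ∩ (nb G a ∪ nb G b)) \ {a, b}).card + 4 + Fintype.card V := by omega
  have h8 : ((nb G w).card : ℝ) + (nb G a).card + (nb G b).card ≤
    ((nb G w ∩ (nb G a ∪ nb G b)) \ {a, b}).card + 4 + Fintype.card V := by exact_mod_cast h7
  linarith [hd w, hd a, hd b]

lemma Wtwo (G B : SimpleGraph V) (hle : B ≤ G) (h5 : NoC5 G B) (k : ℝ)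
    (hd : ∀ a, k ≤ ((nb G a).card : ℝ)) (hk : (Fintype.card V : ℝ) + 7 ≤ 3 * k)
    (a b : V) (hab : B.Adj a b) (w : V) :
    1 < ((nb G w ∩ (nb G a ∪ nb G b)) \ {a, b}).card := by
  have := Wcard G B hle h5 k hd hk a b hab w
  have h : (1 : ℝ) < (((nb G w ∩ (nb G a ∪ nb G b)) \ {a, b}).card : ℝ) := by linarith
  exact_mod_cast h

lemma split (G B : SimpleGraph V) (hle : B ≤ G) (h5 : NoC5 G B) (k : ℝ)
    (hd : ∀ a, k ≤ ((nb G a).card : ℝ)) (hk : (Fintype.card V : ℝ) + 7 ≤ 3 * k)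
    (a b : V) (hab : B.Adj a b) (w : V) (hwa : w ≠ a) (hwb : w ≠ b) :
    (∀ q, G.Adj b q → q ≠ a → ¬ G.Adj w q) ∨ (∀ p, G.Adj a p → p ≠ b → ¬ G.Adj w p) := by
  by_contra hcon
  push Not at hcon
  obtain ⟨⟨q, hbq, hqa, hwq⟩, p, hap, hpb, hwp⟩ := hcon
  have key : ∀ p q, G.Adj b q → q ≠ a → G.Adj w q → G.Adj a p → p ≠ b → G.Adj w p → q = p := by
    intro p q hbq hqa hwq hap hpb hwp
    by_contra hne
    exact h5 a b q w p hab hbq hwq.symm hwp hap.symm hqa.symm hwa.symm hwb.symm hpb.symm hne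
  have hpq := key p q hbq hqa hwq hap hpb hwp
  obtain ⟨s, hs, t, ht, hst⟩ := Finset.one_lt_card.1 (Wtwo G B hle h5 k hd hk a b hab w)
  have all : ∀ s ∈ (nb G w ∩ (nb G a ∪ nb G b)) \ {a, b}, s = p := by
    intro s hs
    simp only [Finset.mem_sdiff, Finset.mem_inter, Finset.mem_union, mem_nb, Finset.mem_insert,
      Finset.mem_singleton, not_or] at hs
    rcases hs.1.2 with h | h
    · rw [← key s q hbq hqa hwq h hs.2.2 hs.1.1]; exact hpq
    · exact key p s h hs.2.1 hs.1.1 hap hpb hwp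
  exact hst ((all s hs).trans (all t ht).symm)

lemma core (G B : SimpleGraph V) (hle : B ≤ G) (h5 : NoC5 G B) (k : ℝ)
    (hd : ∀ a, k ≤ ((nb G a).card : ℝ)) (hk : (Fintype.card V : ℝ) + 7 ≤ 3 * k)
    (a b : V) (hab : B.Adj a b) (x z : V) (hxz : G.Adj x z) (hxa : x ≠ a) (hza : z ≠ a)
    (hzb : z ≠ b)
    (hx : ∀ q, G.Adj b q → q ≠ a → ¬ G.Adj x q) (hz : ∀ q, G.Adj b q → q ≠ a → ¬ G.Adj z q) :
    b ∈ nb G a \ nb G x ∧ ((nb G a \ nb G x).card : ℝ) ≤ 2 * Fintype.card V - 4 * k + 6 := by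
  have hsub : ∀ w, (∀ q, G.Adj b q → q ≠ a → ¬ G.Adj w q) →
      (nb G w ∩ (nb G a ∪ nb G b)) \ {a, b} ⊆ nb G a ∩ nb G w := by
    intro w hw s hs
    simp only [Finset.mem_sdiff, Finset.mem_inter, Finset.mem_union, mem_nb, Finset.mem_insert,
      Finset.mem_singleton, not_or] at hs ⊢
    refine ⟨?_, hs.1.1⟩
    rcases hs.1.2 with h | h
    · exact h
    · exact absurd hs.1.1 (hw s h hs.2.1)
  constructor
  · rw [Finset.mem_sdiff, mem_nb, mem_nb]
    refine ⟨hle hab, fun hxb => ?_⟩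
    obtain ⟨p, hp, hpx⟩ := Finset.exists_mem_ne (Wtwo G B hle h5 k hd hk a b hab z) x
    have h1 := hsub z hz hp
    simp only [Finset.mem_sdiff, Finset.mem_inter, mem_nb, Finset.mem_insert,
      Finset.mem_singleton, not_or] at h1 hp
    exact h5 a b x z p hab hxb.symm hxz h1.2 h1.1.symm hxa.symm hza.symm hzb.symm
      (Ne.symm hp.2.2) hpx.symm
  · have h1 := Finset.card_le_card (hsub x hx)
    have h2 := Finset.card_sdiff_add_card_inter (nb G a) (nb G x)
    have h3 := com2 G B hle h5 k hd hk a b hab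
    have h4 := Finset.card_union_add_card_inter (nb G a) (nb G b)
    have h6 := Finset.card_le_univ (nb G a ∪ nb G b)
    have h7 : (nb G a \ nb G x).card + ((nb G x ∩ (nb G a ∪ nb G b)) \ {a, b}).card + (nb G b).card
      ≤ Fintype.card V + 2 := by omega
    have h8 : ((nb G a \ nb G x).card : ℝ) + ((nb G x ∩ (nb G a ∪ nb G b)) \ {a, b}).card
      + (nb G b).card ≤ Fintype.card V + 2 := by exact_mod_cast h7
    linarith [hd b, Wcard G B hle h5 k hd hk a b hab x]

/-- small set of exceptional neighbours -/
def Sm (G : SimpleGraph V) (L : ℝ) (w a b : V) : Prop :=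
  b ∈ nb G a \ nb G w ∧ ((nb G a \ nb G w).card : ℝ) ≤ L

lemma Sm_sum (G : SimpleGraph V) (L : ℝ) (hL : 0 ≤ L) (w : V) :
    (∑ a, ∑ b, if Sm G L w a b then (1 : ℝ) else 0) ≤ Fintype.card V * L := by
  have : ∀ a, (∑ b, if Sm G L w a b then (1 : ℝ) else 0) ≤ L := by
    intro a
    rw [sum_ind]
    by_cases h : ((nb G a \ nb G w).card : ℝ) ≤ L
    · refine le_trans ?_ h
      have hs : (Finset.univ.filter fun b => Sm G L w a b) ⊆ nb G a \ nb G w :=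
        fun b hb => (Finset.mem_filter.1 hb).2.1
      exact_mod_cast Finset.card_le_card hs
    · have : (Finset.univ.filter fun b => Sm G L w a b) = ∅ := by
        ext b; simp [Sm, h]
      rw [this]; simpa using hL
  calc _ ≤ ∑ a : V, L := Finset.sum_le_sum fun a _ => this a
    _ = _ := by simp

lemma case2 (G B : SimpleGraph V) (hle : B ≤ G) (h5 : NoC5 G B) (k : ℝ)
    (hd : ∀ a, k ≤ ((nb G a).card : ℝ)) (hk : (Fintype.card V : ℝ) + 7 ≤ 3 * k)
    (hk2 : 4 * k ≤ 2 * Fintype.card V + 6)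
    (x y z : V) (hxy : G.Adj x y) (hyz : G.Adj y z) (hzx : G.Adj z x) :
    Wt B (fun _ => 1) (fun _ => 1) ≤
      6 * (Fintype.card V * (2 * Fintype.card V - 4 * k + 6)) + 6 * Fintype.card V := by
  set L : ℝ := 2 * Fintype.card V - 4 * k + 6 with hL
  have hL0 : 0 ≤ L := by rw [hL]; linarith
  have T : ∀ t : V, (∑ a, ∑ b : V, if a = t then (1 : ℝ) else 0) = Fintype.card V := by
    intro t; simp
  have T' : ∀ t : V, (∑ a : V, ∑ b : V, if b = t then (1 : ℝ) else 0) = Fintype.card V := by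
    intro t; simp
  have S := fun w => Sm_sum G L hL0 w
  have S' : ∀ w, (∑ a, ∑ b, if Sm G L w b a then (1 : ℝ) else 0) ≤ Fintype.card V * L := by
    intro w; rw [Finset.sum_comm]; exact S w
  have main : Wt B (fun _ => 1) (fun _ => 1) ≤
      (∑ a, ∑ b : V, if a = x then (1 : ℝ) else 0) + (∑ a, ∑ b : V, if a = y then (1 : ℝ) else 0)
      + (∑ a, ∑ b : V, if a = z then (1 : ℝ) else 0)
      + (∑ a : V, ∑ b : V, if b = x then (1 : ℝ) else 0)
      + (∑ a : V, ∑ b : V, if b = y then (1 : ℝ) else 0)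
      + (∑ a : V, ∑ b : V, if b = z then (1 : ℝ) else 0)
      + (∑ a, ∑ b, if Sm G L x a b then (1 : ℝ) else 0)
      + (∑ a, ∑ b, if Sm G L y a b then (1 : ℝ) else 0)
      + (∑ a, ∑ b, if Sm G L z a b then (1 : ℝ) else 0)
      + (∑ a, ∑ b, if Sm G L x b a then (1 : ℝ) else 0)
      + (∑ a, ∑ b, if Sm G L y b a then (1 : ℝ) else 0)
      + (∑ a, ∑ b, if Sm G L z b a then (1 : ℝ) else 0) := by
    unfold Wt
    simp only [← Finset.sum_add_distrib]
    refine Finset.sum_le_sum fun a _ => Finset.sum_le_sum fun b _ => ?_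
    have pos : ∀ (p : Prop) [Decidable p], (0 : ℝ) ≤ if p then 1 else 0 := by
      intro p _; positivity
    have one : ∀ (p : Prop) [Decidable p], p → (1 : ℝ) ≤ if p then 1 else 0 := by
      intro p _ hp; simp [hp]
    have q1 := pos (a = x); have q2 := pos (a = y); have q3 := pos (a = z)
    have q4 := pos (b = x); have q5 := pos (b = y); have q6 := pos (b = z)
    have r1 := pos (Sm G L x a b); have r2 := pos (Sm G L y a b); have r3 := pos (Sm G L z a b)
    have r4 := pos (Sm G L x b a); have r5 := pos (Sm G L y b a); have r6 := pos (Sm G L z b a)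
    by_cases hab : B.Adj a b
    swap
    · rw [if_neg hab]; linarith
    rw [if_pos hab]
    by_cases e1 : a = x
    · linarith [one _ e1]
    by_cases e2 : a = y
    · linarith [one _ e2]
    by_cases e3 : a = z
    · linarith [one _ e3]
    by_cases e4 : b = x
    · linarith [one _ e4]
    by_cases e5 : b = y
    · linarith [one _ e5]
    by_cases e6 : b = z
    · linarith [one _ e6]
    have sp := split G B hle h5 k hd hk a b hab
    have cc : ∀ x z, G.Adj x z → x ≠ a → z ≠ a → z ≠ b →
      (∀ q, G.Adj b q → q ≠ a → ¬ G.Adj x q) → (∀ q, G.Adj b q → q ≠ a → ¬ G.Adj z q) →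
        Sm G L x a b := core G B hle h5 k hd hk a b hab
    have cc' : ∀ x z, G.Adj x z → x ≠ b → z ≠ b → z ≠ a →
      (∀ q, G.Adj a q → q ≠ b → ¬ G.Adj x q) → (∀ q, G.Adj a q → q ≠ b → ¬ G.Adj z q) →
        Sm G L x b a := core G B hle h5 k hd hk b a hab.symm
    rcases sp x (Ne.symm e1) (Ne.symm e4) with hx | hx <;>
      rcases sp y (Ne.symm e2) (Ne.symm e5) with hy | hy <;>
      rcases sp z (Ne.symm e3) (Ne.symm e6) with hz | hz
    · linarith [one _ (cc x y hxy (Ne.symm e1) (Ne.symm e2) (Ne.symm e5) hx hy)]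
    · linarith [one _ (cc x y hxy (Ne.symm e1) (Ne.symm e2) (Ne.symm e5) hx hy)]
    · linarith [one _ (cc x z hzx.symm (Ne.symm e1) (Ne.symm e3) (Ne.symm e6) hx hz)]
    · linarith [one _ (cc' y z hyz (Ne.symm e5) (Ne.symm e6) (Ne.symm e3) hy hz)]
    · linarith [one _ (cc y z hyz (Ne.symm e2) (Ne.symm e3) (Ne.symm e6) hy hz)]
    · linarith [one _ (cc' x z hzx.symm (Ne.symm e4) (Ne.symm e6) (Ne.symm e3) hx hz)]
    · linarith [one _ (cc' x y hxy (Ne.symm e4) (Ne.symm e5) (Ne.symm e2) hx hy)]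
    · linarith [one _ (cc' x y hxy (Ne.symm e4) (Ne.symm e5) (Ne.symm e2) hx hy)]
  rw [T, T, T, T', T', T'] at main
  linarith [S x, S y, S z, S' x, S' y, S' z]

lemma Wt_le (H : SimpleGraph V) (x y : V → ℝ) (hx : ∀ a, 0 ≤ x a) (hy : ∀ a, 0 ≤ y a) :
    Wt H x y ≤ (∑ a, x a) * ∑ b, y b := by
  unfold Wt
  rw [Finset.sum_mul_sum]
  refine Finset.sum_le_sum fun a _ => Finset.sum_le_sum fun b _ => ?_
  split_ifs
  · exact le_rfl
  · exact mul_nonneg (hx a) (hy b)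

/-- indicator of a finset -/
noncomputable def ind (U : Finset V) : V → ℝ := fun a => if a ∈ U then 1 else 0

lemma ind_nonneg (U : Finset V) (a : V) : 0 ≤ ind U a := by unfold ind; positivity

lemma sum_indU (U : Finset V) : ∑ a, ind U a = U.card := by simp [ind]

lemma Wt_single (H : SimpleGraph V) (y : V) (z : V → ℝ) : Wt H (ind {y}) z = wd H z y := by
  rw [Wt_eq]; simp [ind]

lemma caseA (G B : SimpleGraph V) (hle : B ≤ G) (hw : NoWalk G B) (n r : ℝ)
    (hn : n = Fintype.card V) (hr : 6 * 10 ^ 12 ≤ r) (hrr : r * r = n)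
    (hP : n ^ 2 / 2 - 6 * (n * r) ≤ Wt G (fun _ => 1) (fun _ => 1)) (y : V)
    (hy : (1 / 2 + 1 / 10 ^ 6) * n ≤ wd G (fun _ => 1) y) :
    Wt B (fun _ => 1) (fun _ => 1) ≤ (2 - Real.sqrt 2) / 8 * n ^ 2 + 12 * 10 ^ 6 * (n * r) := by
  have hr0 : 0 < r := by linarith
  have hn0 : 0 < n := by rw [← hrr]; positivity
  set P := Wt G (fun _ => 1) (fun _ => 1) with hPdef
  set Q := Wt B (fun _ => 1) (fun _ => 1) with hQdef
  set d := wd G (fun _ => 1) y with hd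
  set ε : ℝ := 6 * 10 ^ 6 / r with hε
  have hε0 : 0 < ε := by positivity
  have hεr : ε * r = 6 * 10 ^ 6 := by rw [hε]; field_simp
  have hε1 : ε ≤ 1 / 10 ^ 6 := by
    rw [hε, div_le_iff₀ hr0]; linarith
  have hs : ∑ a : V, ((1 - ε) / n * (fun _ : V => (1 : ℝ)) a + ε * ind {y} a) = 1 := by
    rw [Finset.sum_add_distrib, ← Finset.mul_sum, ← Finset.mul_sum, sum_indU]
    simp only [Finset.sum_const, Finset.card_univ, nsmul_eq_mul, mul_one, ← hn,
      Finset.card_singleton, Nat.cast_one]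
    field_simp; ring
  have hx : ∀ a : V, 0 ≤ (1 - ε) / n * (fun _ : V => (1 : ℝ)) a + ε * ind {y} a := by
    intro a
    have := ind_nonneg {y} a
    have h1 : 0 ≤ (1 - ε) / n := div_nonneg (by linarith) hn0.le
    simp only [mul_one]
    positivity
  have hnr : n * r = ε / (6 * 10 ^ 6) * n ^ 2 := by
    rw [hε, ← hrr]; field_simp
  have hE : 1 / 2 < Wt G (fun a => (1 - ε) / n * (fun _ : V => (1 : ℝ)) a + ε * ind {y} a)
      (fun a => (1 - ε) / n * (fun _ : V => (1 : ℝ)) a + ε * ind {y} a) := by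
    rw [Wt_quad, Wt_single, ← hPdef, ← hd]
    have h0 : 0 ≤ Wt G (ind {y}) (ind {y}) := Wt_nonneg G _ _ (ind_nonneg _) (ind_nonneg _)
    have h1 : 1 / 2 - ε / 10 ^ 6 ≤ P / n ^ 2 := by
      rw [le_div_iff₀ (by positivity)]
      rw [hnr] at hP
      linarith
    have h2 : 1 / 2 + 1 / 10 ^ 6 ≤ d / n := by rwa [le_div_iff₀ hn0]
    have e1 : ((1 - ε) / n) ^ 2 * P = (1 - ε) ^ 2 * (P / n ^ 2) := by field_simp
    have e2 : 2 * ((1 - ε) / n) * ε * d = 2 * (1 - ε) * ε * (d / n) := by field_simp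
    rw [e1, e2]
    have g1 := mul_le_mul_of_nonneg_left h1 (sq_nonneg (1 - ε))
    have hq : 0 ≤ 2 * (1 - ε) * ε := mul_nonneg (by linarith) hε0.le
    have g2 := mul_le_mul_of_nonneg_left h2 hq
    have g3 : 0 ≤ ε ^ 2 * Wt G (ind {y}) (ind {y}) := by positivity
    have g4 : (1 - ε) ^ 2 * (1 / 2 - ε / 10 ^ 6) + 2 * (1 - ε) * ε * (1 / 2 + 1 / 10 ^ 6)
      = 1 / 2 + ε * (1 / 10 ^ 6 - ε / 2 - ε ^ 2 / 10 ^ 6) := by ring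
    have g5 : 0 < 1 / 10 ^ 6 - ε / 2 - ε ^ 2 / 10 ^ 6 := by nlinarith
    have g6 := mul_pos hε0 g5
    linarith
  have hfin := weighted G B hle hw _ _ rfl hx hs hE
  rw [Wt_quad, Wt_single, ← hQdef] at hfin
  have h0 : 0 ≤ Wt B (ind {y}) (ind {y}) := Wt_nonneg B _ _ (ind_nonneg _) (ind_nonneg _)
  have h0' : 0 ≤ wd B (fun _ => 1) y := wd_nonneg B _ (fun _ => zero_le_one) y
  have hQn : Q ≤ n ^ 2 := by
    have := Wt_le B (fun _ => 1) (fun _ => 1) (fun _ => zero_le_one) (fun _ => zero_le_one)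
    simp only [Finset.sum_const, Finset.card_univ, nsmul_eq_mul, mul_one, ← hn] at this
    rw [hQdef]; linarith
  have hQ0 : 0 ≤ Q := Wt_nonneg B _ _ (fun _ => zero_le_one) (fun _ => zero_le_one)
  have g0 : 0 ≤ (1 - ε) / n := div_nonneg (by linarith) hn0.le
  have g1 : 0 ≤ 2 * ((1 - ε) / n) * ε * wd B (fun _ => 1) y := by positivity
  have g2 : ((1 - ε) / n) ^ 2 * Q ≤ (2 - Real.sqrt 2) / 8 := by
    have : 0 ≤ ε ^ 2 * Wt B (ind {y}) (ind {y}) := by positivity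
    linarith
  have g3 : (1 - ε) ^ 2 * Q ≤ (2 - Real.sqrt 2) / 8 * n ^ 2 := by
    have e1 : ((1 - ε) / n) ^ 2 * Q = (1 - ε) ^ 2 * Q / n ^ 2 := by field_simp
    rwa [e1, div_le_iff₀ (by positivity)] at g2
  have g4 : 0 ≤ ε ^ 2 * Q := by positivity
  have g5 : ε * Q ≤ ε * n ^ 2 := mul_le_mul_of_nonneg_left hQn hε0.le
  have g6 : 12 * 10 ^ 6 * (n * r) = 2 * (ε * n ^ 2) := by rw [hnr]; ring
  rw [g6]
  nlinarith

lemma sum_sub (U : Finset V) (f : V → ℝ) : ∑ b : U, f b = ∑ b, if b ∈ U then f b else 0 := by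
  rw [Finset.sum_coe_sort U f]; simp

lemma Wt_sub (H : SimpleGraph V) (U : Finset V) :
    Wt (H.comap (Subtype.val : U → V)) (fun _ => 1) (fun _ => 1) = Wt H (ind U) (ind U) := by
  unfold Wt ind
  simp only [SimpleGraph.comap_adj]
  have h1 : ∀ a : V, (∑ b : U, if H.Adj a b then (1 : ℝ) * 1 else 0)
      = ∑ b, if b ∈ U then (if H.Adj a b then (1 : ℝ) * 1 else 0) else 0 := fun a =>
    sum_sub U fun b => if H.Adj a b then (1 : ℝ) * 1 else 0
  calc _ = ∑ a : U, ∑ b : U, (if H.Adj a b then (1 : ℝ) * 1 else 0) := by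
        refine Finset.sum_congr rfl fun a _ => Finset.sum_congr rfl fun b _ => ?_
        congr
    _ = ∑ a, if a ∈ U then (∑ b : U, (if H.Adj a b then (1 : ℝ) * 1 else 0)) else 0 :=
        sum_sub U fun a => ∑ b : U, (if H.Adj a b then (1 : ℝ) * 1 else 0)
    _ = _ := by
        refine Finset.sum_congr rfl fun a _ => ?_
        rw [h1]
        split_ifs with h
        · refine Finset.sum_congr rfl fun b _ => ?_
          by_cases h1 : b ∈ U <;> by_cases h2 : H.Adj a b <;> simp [h1, h2]
        · simp

lemma nb_sub (H : SimpleGraph V) (U : Finset V) (a : U) :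
    ((nb (H.comap (Subtype.val : U → V)) a).card : ℝ) = wd H (ind U) a := by
  unfold nb wd ind
  rw [← sum_ind]
  calc _ = ∑ b : U, (if H.Adj a b then (1 : ℝ) else 0) := by
        refine Finset.sum_congr rfl fun b _ => ?_
        simp only [SimpleGraph.comap_adj]
    _ = ∑ b, if b ∈ U then (if H.Adj a b then (1 : ℝ) else 0) else 0 :=
        sum_sub U fun b => if H.Adj a b then (1 : ℝ) else 0
    _ = _ := by
        refine Finset.sum_congr rfl fun b _ => ?_
        by_cases h1 : b ∈ U <;> by_cases h2 : H.Adj a b <;> simp [h1, h2]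

lemma good_case (G B : SimpleGraph V) (hle : B ≤ G) (h5 : NoC5 G B) (n m : ℝ)
    (hn : n = Fintype.card V) (U : Finset V) (hm : m = U.card) (hmn : m ≤ n)
    (hmb : (1 - 1 / 250) * n ≤ m) (hbig : 10 ^ 5 ≤ n)
    (hP : m ^ 2 / 2 < Wt G (ind U) (ind U))
    (hd : ∀ a ∈ U, (1 / 2 - 1 / 500) * m - 1 ≤ wd G (ind U) a) :
    Wt B (fun _ => 1) (fun _ => 1) ≤ (2 - Real.sqrt 2) / 8 * n ^ 2 := by
  have hm0 : 0 < m := by linarith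
  have htri : ∃ a b c, a ∈ U ∧ b ∈ U ∧ c ∈ U ∧ G.Adj a b ∧ G.Adj b c ∧ G.Adj c a := by
    have hE : 1 / 2 < Wt G (fun a => 1 / m * ind U a + 0 * ind U a)
        (fun a => 1 / m * ind U a + 0 * ind U a) := by
      rw [Wt_quad]
      have : (1 / m) ^ 2 * Wt G (ind U) (ind U) = Wt G (ind U) (ind U) / m ^ 2 := by
        field_simp
      rw [this]
      have h2 : 1 / 2 < Wt G (ind U) (ind U) / m ^ 2 := by
        rw [lt_div_iff₀ (by positivity)]; linarith
      linarith
    obtain ⟨a, b, c, ha, hb, hc, h1, h2, h3⟩ := mantel G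
      (fun a => 1 / m * ind U a + 0 * ind U a)
      (fun a => by have := ind_nonneg U a; positivity)
      (by
        rw [Finset.sum_add_distrib, ← Finset.mul_sum, ← Finset.mul_sum, sum_indU, ← hm]
        field_simp; ring) hE
    have hmem : ∀ a, 0 < 1 / m * ind U a + 0 * ind U a → a ∈ U := by
      intro a h
      by_contra hna
      simp [ind, hna] at h
    exact ⟨a, b, c, hmem a ha, hmem b hb, hmem c hc, h1, h2, h3⟩
  obtain ⟨a, b, c, ha, hb, hc, h1, h2, h3⟩ := htri
  have hcard : (Fintype.card U : ℝ) = m := by rw [hm]; simp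
  have key := case2 (G.comap (Subtype.val : U → V)) (B.comap (Subtype.val : U → V))
    (fun u v h => hle h)
    (fun a b c d e h1 h2 h3 h4 h5' n1 n2 n3 n4 n5 => h5 a b c d e h1 h2 h3 h4 h5'
      (fun h => n1 (Subtype.ext h)) (fun h => n2 (Subtype.ext h)) (fun h => n3 (Subtype.ext h))
      (fun h => n4 (Subtype.ext h)) (fun h => n5 (Subtype.ext h)))
    ((1 / 2 - 1 / 500) * m - 1)
    (fun a => by rw [nb_sub]; exact hd a a.2)
    (by rw [hcard]; linarith) (by rw [hcard]; linarith) ⟨a, ha⟩ ⟨b, hb⟩ ⟨c, hc⟩ h1 h2 h3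
  rw [Wt_sub, hcard] at key
  have lost : Wt B (fun _ => 1) (fun _ => 1) ≤ Wt B (ind U) (ind U)
      + (∑ a, ∑ _b : V, if a ∈ U then (0 : ℝ) else 1)
      + (∑ _a : V, ∑ b : V, if b ∈ U then (0 : ℝ) else 1) := by
    unfold Wt
    simp only [← Finset.sum_add_distrib]
    refine Finset.sum_le_sum fun a _ => Finset.sum_le_sum fun b _ => ?_
    unfold ind
    by_cases e1 : a ∈ U <;> by_cases e2 : b ∈ U <;> by_cases e3 : B.Adj a b <;>
      simp [e1, e2, e3]
  have hc1 : (∑ a : V, if a ∈ U then (0 : ℝ) else 1) = n - m := by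
    have : ∀ a : V, (if a ∈ U then (0 : ℝ) else 1) = 1 - ind U a := by
      intro a; unfold ind; split_ifs <;> simp
    simp only [this]
    rw [Finset.sum_sub_distrib, sum_indU, ← hm, hn]; simp
  have hc2 : (∑ a, ∑ _b : V, if a ∈ U then (0 : ℝ) else 1) = n * (n - m) := by
    rw [← hc1, Finset.mul_sum]
    refine Finset.sum_congr rfl fun a _ => ?_
    rw [hn]; simp only [Finset.sum_const, Finset.card_univ, nsmul_eq_mul]
  have hc3 : (∑ _a : V, ∑ b : V, if b ∈ U then (0 : ℝ) else 1) = n * (n - m) := by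
    rw [hc1, hn]; simp only [Finset.sum_const, Finset.card_univ, nsmul_eq_mul]
  rw [hc2, hc3] at lost
  have hs2 : Real.sqrt 2 ≤ 1.4143 := by
    rw [Real.sqrt_le_left (by norm_num)]; norm_num
  have g1 : m * m ≤ n * n := mul_self_le_mul_self hm0.le hmn
  have g2 : n * (n - m) ≤ n * (1 / 250 * n) :=
    mul_le_mul_of_nonneg_left (by linarith) (by linarith)
  have g3 : 10 ^ 5 * n ≤ n * n := mul_le_mul_of_nonneg_right hbig (by linarith)
  have g4 : (0.0732 : ℝ) * (n * n) ≤ (2 - Real.sqrt 2) / 8 * (n * n) :=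
    mul_le_mul_of_nonneg_right (by linarith) (by positivity)
  nlinarith

lemma big (G B : SimpleGraph V) (hle : B ≤ G) (h5 : NoC5 G B) (n r : ℝ)
    (hn : n = Fintype.card V) (hr : 6 * 10 ^ 12 ≤ r) (hrr : r = Real.sqrt n)
    (hE : n ^ 2 / 2 < Wt G (fun _ => 1) (fun _ => 1)) :
    Wt B (fun _ => 1) (fun _ => 1) ≤
      (2 - Real.sqrt 2) / 8 * n ^ 2 + (12 * 10 ^ 6 + 8) * (n * r) := by
  have hnn : 0 ≤ n := by rw [hn]; positivity
  have hsq : r * r = n := by rw [hrr]; exact Real.mul_self_sqrt hnn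
  have hr0 : 0 < r := by linarith
  have hbig : 10 ^ 12 * r ≤ n := by rw [← hsq]; exact mul_le_mul_of_nonneg_right (by linarith) hr0.le
  have hn0 : 0 < n := by nlinarith
  have huniv : ind (Finset.univ : Finset V) = fun _ => 1 := by ext a; simp [ind]
  have hcu : ((Finset.univ : Finset V).card : ℝ) = n := by rw [hn]; simp
  obtain ⟨U, hU, hmax⟩ := Finset.exists_max_image
    (Finset.univ.filter fun U : Finset V => (1 - 1 / 250) * n ≤ U.card)
    (fun U => Wt G (ind U) (ind U) - (1 / 2 - 1 / 500) * (U.card : ℝ) ^ 2)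
    ⟨Finset.univ, by rw [Finset.mem_filter]; refine ⟨Finset.mem_univ _, ?_⟩; rw [hcu]; linarith⟩
  simp only [Finset.mem_filter, Finset.mem_univ, true_and] at hU hmax
  set m : ℝ := (U.card : ℝ) with hm
  have hmn : m ≤ n := by rw [hm, hn]; exact_mod_cast Finset.card_le_univ _
  have hm0 : 0 < m := by linarith
  have hPU := hmax Finset.univ (by rw [hcu]; linarith)
  rw [hcu, huniv] at hPU
  have hmn2 : m ^ 2 ≤ n ^ 2 := by gcongr
  have hPU' : (1 / 2 - 1 / 500) * m ^ 2 + 1 / 500 * n ^ 2 < Wt G (ind U) (ind U) := by linarith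
  by_cases hcase : (1 - 1 / 250) * n ≤ m - 1
  · have := good_case G B hle h5 n m hn U hm hmn hU (by linarith) (by linarith) (by
      intro a ha
      have hc : ((U.erase a).card : ℝ) = m - 1 := by
        rw [Finset.card_erase_of_mem ha, Nat.cast_sub (Finset.card_pos.2 ⟨a, ha⟩)]; simp [hm]
      have h1 := hmax (U.erase a) (by rw [hc]; exact hcase)
      have h2 : ind (U.erase a) = fun b => 1 * ind U b + (-1) * ind {a} b := by
        ext b
        unfold ind
        by_cases e1 : b = a
        · subst e1; simp [ha]
        · simp [e1]
      rw [h2, hc, Wt_quad, Wt_single] at h1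
      have h3 : 0 ≤ Wt G (ind {a}) (ind {a}) := Wt_nonneg G _ _ (ind_nonneg _) (ind_nonneg _)
      nlinarith)
    have : 0 ≤ n * r := by positivity
    linarith
  push Not at hcase
  have hV : 0 < Fintype.card V := by
    rw [hn] at hn0; exact_mod_cast hn0
  obtain ⟨G', B', hG'G, hB'G', hNW, hc1, hc2⟩ := clean G B hle h5 hV
  rw [← hn, ← hrr] at hc1 hc2
  have hUc : (fun _ : V => (1 : ℝ)) = fun a => 1 * ind U a + 1 * ind Uᶜ a := by
    ext a; unfold ind; by_cases e : a ∈ U <;> simp [e]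
  have hq : Wt G (fun _ => 1) (fun _ => 1) = Wt G (ind U) (ind U) +
      2 * Wt G (ind Uᶜ) (ind U) + Wt G (ind Uᶜ) (ind Uᶜ) := by
    rw [hUc, Wt_quad]; ring
  have hq2 : Wt G (ind U) (fun _ => 1) = Wt G (ind U) (ind U) + Wt G (ind Uᶜ) (ind U) := by
    rw [hUc, Wt_comb_right, Wt_comm G (ind U) (ind Uᶜ)]; ring
  have hPc : Wt G (ind Uᶜ) (ind Uᶜ) ≤ (n - m) * (n - m) := by
    have := Wt_le G (ind Uᶜ) (ind Uᶜ) (ind_nonneg _) (ind_nonneg _)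
    rw [sum_indU] at this
    have e : ((Uᶜ).card : ℝ) = n - m := by
      rw [Finset.card_compl, Nat.cast_sub (Finset.card_le_univ _), hn]
    rwa [e] at this
  have hD1 : n - m ≤ 1 / 250 * n := by linarith
  have hD2 : 1 / 500 * n ≤ n - m := by linarith
  have hT : m * n / 2 + 1 / 500 ^ 2 / 2 * (n * m) ≤ Wt G (ind U) (fun _ => 1) := by
    have k1 : m * n / 2 + 1 / 2 * ((n - m) * (1 / 500 * (n + m) - (n - m) / 2))
        ≤ Wt G (ind U) (fun _ => 1) := by
      rw [hq2]; nlinarith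
    have k2 : (n - m) * (1 / 500 * m) ≤ (n - m) * (1 / 500 * (n + m) - (n - m) / 2) :=
      mul_le_mul_of_nonneg_left (by linarith) (by linarith)
    have k3 : (1 / 500 * n) * (1 / 500 * m) ≤ (n - m) * (1 / 500 * m) :=
      mul_le_mul_of_nonneg_right hD2 (by positivity)
    linarith
  have hcmp : Wt G (ind U) (fun _ => 1) + Wt G' (fun _ => 1) (fun _ => 1) ≤
      Wt G' (ind U) (fun _ => 1) + Wt G (fun _ => 1) (fun _ => 1) := by
    unfold Wt
    simp only [← Finset.sum_add_distrib]
    refine Finset.sum_le_sum fun a _ => Finset.sum_le_sum fun b _ => ?_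
    unfold ind
    by_cases e1 : G'.Adj a b
    · have e2 := hG'G e1
      simp [e1, e2]
    · by_cases e2 : G.Adj a b <;> by_cases e3 : a ∈ U <;> simp [e1, e2, e3]
  have hT' : m * n / 2 + 1 / 500 ^ 2 / 2 * (n * m) - 6 * (n * r) ≤ Wt G' (ind U) (fun _ => 1) := by
    linarith
  have hy : ∃ y, (1 / 2 + 1 / 10 ^ 6) * n ≤ wd G' (fun _ => 1) y := by
    by_contra hcon
    push Not at hcon
    have k1 : Wt G' (ind U) (fun _ => 1) ≤ ∑ a, ind U a * ((1 / 2 + 1 / 10 ^ 6) * n) := by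
      rw [Wt_eq]
      exact Finset.sum_le_sum fun a _ => mul_le_mul_of_nonneg_left (hcon a).le (ind_nonneg U a)
    rw [← Finset.sum_mul, sum_indU, ← hm] at k1
    have k2 : n * (10 ^ 11 * r) ≤ n * m := mul_le_mul_of_nonneg_left (by linarith) hn0.le
    have k3 : 0 < n * r := by positivity
    nlinarith
  obtain ⟨y, hy⟩ := hy
  have := caseA G' B' hB'G' hNW n r hn hr hsq (by linarith) y hy
  linarith

lemma Wt_edges (H : SimpleGraph V) :
    Wt H (fun _ => 1) (fun _ => 1) = 2 * (H.edgeSet.ncard : ℝ) := by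
  have h1 := H.sum_degrees_eq_twice_card_edges
  have h2 : H.edgeSet.ncard = H.edgeFinset.card := by
    rw [← SimpleGraph.coe_edgeFinset, Set.ncard_coe_finset]
  rw [h2]
  have h3 : Wt H (fun _ => 1) (fun _ => 1) = ∑ a, (H.degree a : ℝ) := by
    unfold Wt
    refine Finset.sum_congr rfl fun a _ => ?_
    simp only [mul_one]
    rw [sum_ind, ← SimpleGraph.card_neighborFinset_eq_degree]
    congr 2
    ext b; simp
  rw [h3]
  exact_mod_cast h1

lemma noC5_of (G : SimpleGraph V) (B : Set (Sym2 V)) (hB : B ⊆ G.edgeSet)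
    (h : ∀ e ∈ B, ¬ occursInC G 5 e) : NoC5 G (SimpleGraph.fromEdgeSet B) := by
  intro a b c d e hab hbc hcd hde hea n1 n2 n3 n4 n5
  rw [SimpleGraph.fromEdgeSet_adj] at hab
  have hG : G.Adj a b := hB hab.1
  refine h _ hab.1 ⟨a, .cons hG (.cons hbc (.cons hcd (.cons hde (.cons hea .nil)))), ?_, by simp,
    by simp⟩
  rw [SimpleGraph.Walk.isCycle_def, SimpleGraph.Walk.isTrail_def]
  have := hG.ne; have := hbc.ne; have := hcd.ne; have := hde.ne; have := hea.ne
  refine ⟨?_, by simp, ?_⟩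
  · simp; grind
  · simp; grind

lemma conclude (G : SimpleGraph V) (R B : Set (Sym2 V)) (n : ℝ) (hn : n = Fintype.card V)
    (hbig : (6 * 10 ^ 12) ^ 2 ≤ n) (hE : n ^ 2 / 4 < G.edgeSet.ncard)
    (hRB : R ∪ B = G.edgeSet) (hdis : Disjoint R B) (h : ∀ e ∈ B, ¬ occursInC G 5 e) :
    (2 + Real.sqrt 2) / 16 * n ^ 2 - (12 * 10 ^ 6 + 8) * (n * Real.sqrt n) ≤ R.ncard := by
  have hB : B ⊆ G.edgeSet := by rw [← hRB]; exact Set.subset_union_right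
  have hset : (SimpleGraph.fromEdgeSet B).edgeSet = B := by
    rw [SimpleGraph.edgeSet_fromEdgeSet]
    ext e
    simp only [Set.mem_diff]
    exact ⟨fun h => h.1, fun h => ⟨h, fun h' => G.not_isDiag_of_mem_edgeSet (hB h) h'⟩⟩
  have hle : SimpleGraph.fromEdgeSet B ≤ G := by
    intro a b hab
    rw [SimpleGraph.fromEdgeSet_adj] at hab
    exact hB hab.1
  have h1 := big G (SimpleGraph.fromEdgeSet B) hle (noC5_of G B hB h) n (Real.sqrt n) hn
    (Real.le_sqrt_of_sq_le hbig) rfl (by rw [Wt_edges]; linarith)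
  rw [Wt_edges, hset] at h1
  have h2 : (G.edgeSet.ncard : ℝ) = R.ncard + B.ncard := by
    rw [← hRB, Set.ncard_union_eq hdis (Set.toFinite _) (Set.toFinite _)]; push_cast; rfl
  have h3 : 0 ≤ n * Real.sqrt n := mul_nonneg (by rw [hn]; positivity) (Real.sqrt_nonneg _)
  linarith

end Helpers

theorem stmt5 :
    ∃ C : ℝ, 0 < C ∧ ∀ n : ℕ, ∀ G : SimpleGraph (Fin n),
      ∀ R B : Set (Sym2 (Fin n)),
        G.edgeSet.ncard = n ^ 2 / 4 + 1 →
        R ∪ B = G.edgeSet → Disjoint R B →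
        (∀ e ∈ B, ¬ occursInC G 5 e) →
        ((2 + Real.sqrt 2) / 16) * (n : ℝ) ^ 2 - C * (n : ℝ) ^ ((15 : ℝ) / 8)
          ≤ (R.ncard : ℝ) := by
  refine ⟨10 ^ 26, by norm_num, ?_⟩
  intro n G R B hE hRB hdis h
  rcases Nat.eq_zero_or_pos n with h0 | hpos
  · subst h0
    have : ((0 : ℕ) : ℝ) ^ ((15 : ℝ) / 8) = 0 := by
      rw [Nat.cast_zero]; exact Real.zero_rpow (by norm_num)
    rw [this]; simp
  have hn1 : (1 : ℝ) ≤ n := by exact_mod_cast hpos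
  have hR : (0 : ℝ) ≤ R.ncard := by positivity
  have hs2 : Real.sqrt 2 ≤ 2 := by
    rw [Real.sqrt_le_left (by norm_num)]; norm_num
  have hs0 := Real.sqrt_nonneg 2
  have hpow : (n : ℝ) ≤ (n : ℝ) ^ ((15 : ℝ) / 8) := by
    conv_lhs => rw [← Real.rpow_one (n : ℝ)]
    exact Real.rpow_le_rpow_of_exponent_le hn1 (by norm_num)
  by_cases hbig : (6 * 10 ^ 12 : ℝ) ^ 2 ≤ n
  · have hE' : (n : ℝ) ^ 2 / 4 < G.edgeSet.ncard := by
      rw [hE]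
      have : n ^ 2 < 4 * (n ^ 2 / 4 + 1) := by omega
      have : (n : ℝ) ^ 2 < 4 * ((n ^ 2 / 4 + 1 : ℕ) : ℝ) := by exact_mod_cast this
      linarith
    have h1 := conclude G R B n (by simp) hbig hE' hRB hdis h
    have h2 : (n : ℝ) * Real.sqrt n ≤ (n : ℝ) ^ ((15 : ℝ) / 8) := by
      rw [Real.sqrt_eq_rpow]
      nth_rewrite 1 [← Real.rpow_one (n : ℝ)]
      rw [← Real.rpow_add (by linarith)]
      exact Real.rpow_le_rpow_of_exponent_le hn1 (by norm_num)
    have h3 : (0 : ℝ) ≤ (n : ℝ) * Real.sqrt n := by positivity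
    linarith
  · push Not at hbig
    have h1 : (n : ℝ) ^ 2 ≤ 10 ^ 26 * (n : ℝ) := by nlinarith
    have h2 : (2 + Real.sqrt 2) / 16 * (n : ℝ) ^ 2 ≤ 1 * (n : ℝ) ^ 2 :=
      mul_le_mul_of_nonneg_right (by linarith) (by positivity)
    linarith
end

section
/- For every ε > 0 and every integer k ≥ 3 there exists n₀ ∈ ℕ such that the following holds for all n > n₀: if G is a simple graph on n vertices with exactly ⌊n²/4⌋ + 1 edges, and the edge set of G is partitioned into a set R of red edges and a set B of blue edges such that no blue edge lies on a cycle of length 2k+1 in G, then |R| ≥ (2/9 − ε)·n². -/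
open SimpleGraph

namespace EFR

set_option linter.unusedSectionVars false

variable {V : Type*} [Fintype V] [DecidableEq V]

open Classical in
/-- adjacency indicator -/
noncomputable def g (G : SimpleGraph V) (x y : V) : ℝ := if G.Adj x y then 1 else 0

/-- number of neighbours of `v` in `S` -/
noncomputable def dg (G : SimpleGraph V) (S : Finset V) (v : V) : ℝ := ∑ w ∈ S, g G v w

/-- triangle indicator -/
noncomputable def h (G : SimpleGraph V) (x y z : V) : ℝ := g G x y * g G y z * g G x z

/-- number of (ordered) triangles at `x` -/
noncomputable def tau (G : SimpleGraph V) (x : V) : ℝ := ∑ y, ∑ z, h G x y z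

/-- number of ordered triangles inside `S` -/
noncomputable def tri (G : SimpleGraph V) (S : Finset V) : ℝ :=
  ∑ x ∈ S, ∑ y ∈ S, ∑ z ∈ S, h G x y z

lemma g_nonneg (G : SimpleGraph V) (x y : V) : 0 ≤ g G x y := by
  unfold g; split_ifs <;> norm_num

lemma g_le_one (G : SimpleGraph V) (x y : V) : g G x y ≤ 1 := by
  unfold g; split_ifs <;> norm_num

lemma g_symm (G : SimpleGraph V) (x y : V) : g G x y = g G y x := by
  by_cases hxy : G.Adj x y
  · unfold g; simp [hxy, hxy.symm]
  · have : ¬ G.Adj y x := fun hh => hxy hh.symm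
    unfold g; simp [hxy, this]

lemma g_adj {G : SimpleGraph V} {x y : V} (hxy : G.Adj x y) : g G x y = 1 := by
  unfold g; simp [hxy]

lemma g_not {G : SimpleGraph V} {x y : V} (hxy : ¬ G.Adj x y) : g G x y = 0 := by
  unfold g; simp [hxy]

lemma g_mono {G H : SimpleGraph V} (hle : H ≤ G) (x y : V) : g H x y ≤ g G x y := by
  by_cases hx : H.Adj x y
  · rw [g_adj hx, g_adj (hle hx)]
  · rw [g_not hx]; exact g_nonneg _ _ _

lemma h_nonneg (G : SimpleGraph V) (x y z : V) : 0 ≤ h G x y z :=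
  mul_nonneg (mul_nonneg (g_nonneg _ _ _) (g_nonneg _ _ _)) (g_nonneg _ _ _)

lemma h_le_one (G : SimpleGraph V) (x y z : V) : h G x y z ≤ 1 := by
  unfold h
  exact mul_le_one₀ (mul_le_one₀ (g_le_one _ _ _) (g_nonneg _ _ _) (g_le_one _ _ _))
    (g_nonneg _ _ _) (g_le_one _ _ _)

lemma h_rot (G : SimpleGraph V) (x y z : V) : h G x y z = h G y z x := by
  unfold h; rw [g_symm G z x, g_symm G y x]; ring

lemma h_swap (G : SimpleGraph V) (x y z : V) : h G x y z = h G x z y := by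
  unfold h; rw [g_symm G z y]; ring

lemma dg_nonneg (G : SimpleGraph V) (S : Finset V) (v : V) : 0 ≤ dg G S v :=
  Finset.sum_nonneg fun _ _ => g_nonneg _ _ _

lemma dg_le_card (G : SimpleGraph V) (S : Finset V) (v : V) : dg G S v ≤ S.card := by
  unfold dg
  calc _ ≤ ∑ w ∈ S, (1 : ℝ) := Finset.sum_le_sum fun _ _ => g_le_one _ _ _
    _ = S.card := by simp

lemma card_le (S : Finset V) : (S.card : ℝ) ≤ Fintype.card V := by
  exact_mod_cast S.card_le_univ

lemma dg_le (G : SimpleGraph V) (S : Finset V) (v : V) : dg G S v ≤ Fintype.card V :=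
  (dg_le_card G S v).trans (card_le S)

lemma dg_mono {G H : SimpleGraph V} (hle : H ≤ G) (S : Finset V) (v : V) : dg H S v ≤ dg G S v :=
  Finset.sum_le_sum fun _ _ => g_mono hle _ _

lemma dg_subset (G : SimpleGraph V) {S T : Finset V} (hs : S ⊆ T) (v : V) : dg G S v ≤ dg G T v :=
  Finset.sum_le_sum_of_subset_of_nonneg hs fun _ _ _ => g_nonneg _ _ _

lemma dg_compl (G : SimpleGraph V) (S : Finset V) (v : V) :
    dg G Finset.univ v = dg G S v + dg G Sᶜ v := by
  unfold dg; rw [Finset.sum_add_sum_compl]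

lemma E_comm (G : SimpleGraph V) (S T : Finset V) :
    ∑ v ∈ S, dg G T v = ∑ v ∈ T, dg G S v := by
  unfold dg; rw [Finset.sum_comm]
  exact Finset.sum_congr rfl fun _ _ => Finset.sum_congr rfl fun _ _ => g_symm _ _ _

lemma mantel_sq (G : SimpleGraph V) (S : Finset V) :
    2 * ∑ x ∈ S, (dg G S x) ^ 2 - S.card * ∑ x ∈ S, dg G S x ≤ tri G S := by
  have key : ∑ x ∈ S, ∑ y ∈ S, ∑ z ∈ S, (g G x y * (g G x z + g G y z - 1)) ≤ tri G S := by
    unfold tri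
    refine Finset.sum_le_sum fun x _ => Finset.sum_le_sum fun y _ => Finset.sum_le_sum fun z _ => ?_
    unfold h
    have h1 := g_nonneg G x y
    have h2 := mul_nonneg (sub_nonneg.2 (g_le_one G x z)) (sub_nonneg.2 (g_le_one G y z))
    nlinarith [mul_nonneg h1 h2]
  refine le_trans (le_of_eq ?_) key
  have e1 : ∀ x y, ∑ z ∈ S, (g G x y * (g G x z + g G y z - 1))
      = g G x y * dg G S x + g G x y * dg G S y - S.card * g G x y := by
    intro x y
    rw [← Finset.mul_sum, Finset.sum_sub_distrib, Finset.sum_add_distrib]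
    simp only [Finset.sum_const, nsmul_eq_mul, mul_one]
    unfold dg; ring
  simp only [e1, Finset.sum_sub_distrib, Finset.sum_add_distrib]
  have e2 : ∑ x ∈ S, ∑ y ∈ S, g G x y * dg G S x = ∑ x ∈ S, (dg G S x) ^ 2 := by
    refine Finset.sum_congr rfl fun x _ => ?_
    rw [← Finset.sum_mul]; unfold dg; ring
  have e3 : ∑ x ∈ S, ∑ y ∈ S, g G x y * dg G S y = ∑ x ∈ S, (dg G S x) ^ 2 := by
    rw [Finset.sum_comm, ← e2]
    exact Finset.sum_congr rfl fun x _ => Finset.sum_congr rfl fun y _ => by rw [g_symm]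
  rw [e2, e3]
  simp only [← Finset.mul_sum]
  unfold dg; ring

lemma mantel (G : SimpleGraph V) (S : Finset V) (κ : ℝ) (hκ : 0 ≤ κ)
    (ht : tri G S ≤ 2 * κ ^ 2 * (Fintype.card V : ℝ) ^ 3) :
    ∑ x ∈ S, dg G S x ≤ (S.card : ℝ) ^ 2 / 2 + κ * (Fintype.card V : ℝ) ^ 2 := by
  by_contra! hc
  set n : ℝ := (Fintype.card V : ℝ) with hn
  have hm : (S.card : ℝ) ≤ n := card_le S
  have hm0 : (0 : ℝ) ≤ S.card := by positivity
  have hn0 : 0 ≤ n := hm0.trans hm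
  have h1 := mantel_sq G S
  have h2 : (∑ x ∈ S, dg G S x) ^ 2 ≤ S.card * ∑ x ∈ S, (dg G S x) ^ 2 := sq_sum_le_card_mul_sum_sq
  set E := ∑ x ∈ S, dg G S x
  set m : ℝ := (S.card : ℝ)
  have hk : 0 ≤ κ * n ^ 2 := by positivity
  have h3 : E * (2 * E - m ^ 2) ≤ m * tri G S := by nlinarith
  have h4 : m * tri G S ≤ n * (2 * κ ^ 2 * n ^ 3) := by
    refine (mul_le_mul_of_nonneg_left ht hm0).trans (mul_le_mul_of_nonneg_right hm (by positivity))
  have h5 : (κ * n ^ 2) * (2 * κ * n ^ 2) < E * (2 * E - m ^ 2) := by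
    apply mul_lt_mul'' <;> nlinarith [sq_nonneg m]
  nlinarith

lemma tri_le_tau (G : SimpleGraph V) (S : Finset V) : tri G S ≤ ∑ x ∈ S, tau G x := by
  unfold tri tau
  refine Finset.sum_le_sum fun x _ => ?_
  refine (Finset.sum_le_sum fun y _ => Finset.sum_le_sum_of_subset_of_nonneg (Finset.subset_univ S)
    fun _ _ _ => h_nonneg _ _ _ _).trans ?_
  exact Finset.sum_le_sum_of_subset_of_nonneg (Finset.subset_univ S)
    fun _ _ _ => Finset.sum_nonneg fun _ _ => h_nonneg _ _ _ _

lemma tau_nonneg (G : SimpleGraph V) (x : V) : 0 ≤ tau G x :=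
  Finset.sum_nonneg fun _ _ => Finset.sum_nonneg fun _ _ => h_nonneg _ _ _ _

lemma exists_nbr (H : SimpleGraph V) (S F : Finset V) (v : V) (hF : (F.card : ℝ) < dg H S v) :
    ∃ w ∈ S, H.Adj v w ∧ w ∉ F := by
  by_contra! hc
  have : dg H S v ≤ ∑ w ∈ S, (if w ∈ F then (1 : ℝ) else 0) := by
    refine Finset.sum_le_sum fun w hw => ?_
    by_cases ha : H.Adj v w
    · simp [hc w hw ha, g_le_one]
    · rw [g_not ha]; split_ifs <;> norm_num
  have h2 : ∑ w ∈ S, (if w ∈ F then (1 : ℝ) else 0) ≤ F.card := by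
    rw [← Finset.sum_filter]; simp
    exact Finset.card_le_card fun w hw => (Finset.mem_filter.1 hw).2
  linarith

lemma core (H : SimpleGraph V) (K : ℝ) (hK : 0 ≤ K) : ∀ (N : ℕ) (Z U : Finset V),
    Z.card + U.card = N → K * (Z.card + U.card) < ∑ v ∈ Z, dg H U v →
    ∃ Z' ⊆ Z, ∃ U' : Finset V, Z'.Nonempty ∧ (∀ v ∈ Z', K ≤ dg H U' v) ∧
      (∀ u ∈ U', K ≤ dg H Z' u) := by
  intro N
  induction N with
  | zero =>
    intro Z U hN hs
    have : Z = ∅ := Finset.card_eq_zero.1 (by omega)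
    have h0 : Z.card = 0 := by omega
    have h1 : U.card = 0 := by omega
    subst this
    simp [h1] at hs
  | succ N ih =>
    intro Z U hN hs
    by_cases h1 : ∃ v ∈ Z, dg H U v < K
    · obtain ⟨v, hv, hvK⟩ := h1
      have hc := Finset.card_erase_add_one hv
      have hsum := Finset.add_sum_erase Z (dg H U) hv
      obtain ⟨Z', hZ', U', r⟩ := ih (Z.erase v) U (by omega) (by
        have : ((Z.erase v).card : ℝ) = Z.card - 1 := by rw [← hc]; push_cast; ring
        rw [this]; nlinarith)
      exact ⟨Z', hZ'.trans (Finset.erase_subset _ _), U', r⟩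
    by_cases h2 : ∃ u ∈ U, dg H Z u < K
    · obtain ⟨v, hv, hvK⟩ := h2
      have hc := Finset.card_erase_add_one hv
      have hsum := Finset.add_sum_erase U (dg H Z) hv
      rw [E_comm] at hs
      exact ih Z (U.erase v) (by omega) (by
        have : ((U.erase v).card : ℝ) = U.card - 1 := by rw [← hc]; push_cast; ring
        rw [this, E_comm]; nlinarith)
    push Not at h1 h2
    refine ⟨Z, subset_rfl, U, ?_, h1, h2⟩
    by_contra hZ
    rw [Finset.not_nonempty_iff_eq_empty] at hZ
    subst hZ
    have : 0 ≤ K * (U.card : ℝ) := by positivity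
    simp at hs; linarith

lemma long_path (H : SimpleGraph V) (K : ℝ) (Z' U' F : Finset V) (hne : Z'.Nonempty)
    (h1 : ∀ v ∈ Z', K ≤ dg H U' v) (h2 : ∀ u ∈ U', K ≤ dg H Z' u) : ∀ m : ℕ,
    (F.card + 2 * m + 2 : ℝ) < K →
    ∃ a ∈ Z', ∃ b ∈ Z', ∃ p : H.Walk a b, p.IsPath ∧ p.length = 2 * m ∧ ∀ x ∈ p.support, x ∉ F := by
  intro m
  induction m with
  | zero =>
    intro hK
    obtain ⟨v, hv⟩ := hne
    obtain ⟨u, hu, -, -⟩ := exists_nbr H U' ∅ v (by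
      have := h1 v hv; simp; push_cast at hK
      have : (0:ℝ) ≤ F.card := by positivity
      linarith)
    obtain ⟨w, hw, -, hwF⟩ := exists_nbr H Z' F u (by
      have := h2 u hu; push_cast at hK; linarith)
    exact ⟨w, hw, w, hw, Walk.nil, by simp, by simp, by simpa using hwF⟩
  | succ m ih =>
    intro hK
    push_cast at hK
    obtain ⟨a, ha, b, hb, p, hp, hl, hF⟩ := ih (by linarith)
    have hcard : p.support.toFinset.card ≤ 2 * m + 1 := by
      refine (List.toFinset_card_le _).trans ?_
      rw [Walk.length_support, hl]
    have hcu : ((F ∪ p.support.toFinset).card : ℝ) ≤ F.card + (2 * m + 1) := by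
      have := Finset.card_union_le F p.support.toFinset
      exact_mod_cast this.trans (by omega)
    obtain ⟨u, hu, hau, huF⟩ := exists_nbr H U' (F ∪ p.support.toFinset) a (by
      have := h1 a ha; linarith)
    obtain ⟨c, hc, huc, hcF⟩ := exists_nbr H Z' (F ∪ p.support.toFinset) u (by
      have := h2 u hu; linarith)
    simp only [Finset.mem_union, List.mem_toFinset, not_or] at huF hcF
    refine ⟨c, hc, b, hb, Walk.cons huc.symm (Walk.cons hau.symm p), ?_, ?_, ?_⟩
    · rw [Walk.cons_isPath_iff, Walk.cons_isPath_iff]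
      refine ⟨⟨hp, huF.2⟩, ?_⟩
      simp only [Walk.support_cons, List.mem_cons, not_or]
      exact ⟨huc.ne.symm, hcF.2⟩
    · simp [hl]; ring
    · intro x hx
      simp only [Walk.support_cons, List.mem_cons] at hx
      rcases hx with rfl | rfl | hx
      · exact hcF.1
      · exact huF.1
      · exact hF x hx

lemma close_cycle (G : SimpleGraph V) {a b : V} (p : G.Walk a b) (hp : p.IsPath) (hl : 2 ≤ p.length)
    (hab : G.Adj b a) (e : Sym2 V) (he : e ∈ p.edges) : occursInC G (p.length + 1) e := by
  refine ⟨b, Walk.cons hab p, ?_, by simp, by simp [he]⟩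
  rw [Walk.cons_isCycle_iff]
  refine ⟨hp, ?_⟩
  cases p with
  | nil => simp at hl
  | cons hac q =>
    rw [Walk.cons_isPath_iff] at hp
    intro hmem
    rw [Walk.edges_cons, List.mem_cons] at hmem
    rcases hmem with hmem | hmem
    · rw [Sym2.eq_iff] at hmem
      rcases hmem with ⟨h1, h2⟩ | ⟨h1, h2⟩
      · exact hab.ne h1
      · subst h1
        have h0 := Walk.isPath_iff_nil.1 hp.1
        have h1 := Walk.length_eq_zero_iff.2 h0
        simp [h1] at hl
    · exact hp.2 (Walk.snd_mem_support_of_mem_edges q hmem)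

lemma ext_path (G : SimpleGraph V) {a b t t' : V} (p : G.Walk a b) (hp : p.IsPath)
    (h1 : G.Adj t a) (h2 : G.Adj b t') (ht : t ∉ p.support) (ht' : t' ∉ p.support) (hne : t ≠ t') :
    ∃ q : G.Walk t t', q.IsPath ∧ q.length = p.length + 2 ∧ (∀ e ∈ p.edges, e ∈ q.edges) ∧
      ∀ x, x ∈ q.support ↔ x = t ∨ x = t' ∨ x ∈ p.support := by
  refine ⟨Walk.cons h1 (p.concat h2), ?_, by simp, ?_, ?_⟩
  · rw [Walk.cons_isPath_iff, Walk.concat_isPath_iff]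
    refine ⟨⟨hp, ht'⟩, ?_⟩
    simp [Walk.support_concat, ht, hne]
  · intro e he
    simp [Walk.edges_concat, he]
  · intro x
    simp [Walk.support_concat]
    tauto

lemma walk_edge {H : SimpleGraph V} {a b : V} (p : H.Walk a b) (hl : 0 < p.length) :
    ∃ x y, H.Adj x y ∧ s(x, y) ∈ p.edges := by
  cases p with
  | nil => simp at hl
  | cons hac q => exact ⟨_, _, hac, by simp⟩

/-- a dense blue bipartite graph contains a blue path of prescribed even length -/
lemma blue_path (G H : SimpleGraph V) (hle : H ≤ G) (Z F : Finset V) (m : ℕ) (hm : 1 ≤ m) (K : ℝ)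
    (hK : (F.card + 2 * m + 2 : ℝ) < K)
    (hs : K * (2 * Fintype.card V) < ∑ v ∈ Z, dg H Finset.univ v) :
    ∃ a ∈ Z, ∃ b ∈ Z, ∃ p : G.Walk a b, p.IsPath ∧ p.length = 2 * m ∧ (∀ x ∈ p.support, x ∉ F) ∧
      ∃ x y, H.Adj x y ∧ s(x, y) ∈ p.edges := by
  have hK0 : 0 ≤ K := by
    have : (0:ℝ) ≤ F.card + 2 * m + 2 := by positivity
    linarith
  obtain ⟨Z', hZ', U', hne, h1, h2⟩ := core H K hK0 _ Z Finset.univ rfl (by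
    refine lt_of_le_of_lt ?_ hs
    apply mul_le_mul_of_nonneg_left _ hK0
    have := card_le Z
    rw [Finset.card_univ]; linarith)
  obtain ⟨a, ha, b, hb, p, hp, hl, hF⟩ := long_path H K Z' U' F hne h1 h2 m hK
  obtain ⟨x, y, hxy, he⟩ := walk_edge p (by omega)
  refine ⟨a, hZ' ha, b, hZ' hb, p.mapLe hle, ?_, by simp [hl], by simpa using hF, x, y, hxy, ?_⟩
  · exact (Walk.isPath_mapLe hle).2 hp
  · simpa using he

lemma red_T (k : ℕ) (hk : 3 ≤ k) (μ ν : ℝ) (hμ : 0 < μ) (hν : 0 < ν) :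
    ∃ n₀ : ℝ, ∀ (V : Type) [Fintype V] [DecidableEq V] (G H : SimpleGraph V) (Z : Finset V),
      n₀ < (Fintype.card V : ℝ) → H ≤ G →
      (∀ x y, H.Adj x y → ¬ occursInC G (2 * k + 1) s(x, y)) →
      (∀ v ∈ Z, μ * (Fintype.card V : ℝ) ^ 2 ≤ tau G v) →
      ∑ v ∈ Z, dg H Finset.univ v ≤ ν * (Fintype.card V : ℝ) ^ 2 := by
  refine ⟨max 0 (2 * (2 * k + 5) / (μ * ν)), ?_⟩
  intro V _ _ G H Z hn hle hB hZ
  set n : ℝ := (Fintype.card V : ℝ) with hnn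
  have hn0 : 0 < n := (le_max_left _ _).trans_lt hn
  have hn1 : 2 * (2 * k + 5) < n * (μ * ν) := by
    rw [← div_lt_iff₀ (by positivity)]; exact (le_max_right _ _).trans_lt hn
  by_contra! hc
  have h1 : μ * n ^ 2 * (ν * n ^ 2) < ∑ v ∈ Z, dg H Finset.univ v * tau G v := by
    calc _ < μ * n ^ 2 * ∑ v ∈ Z, dg H Finset.univ v := by
          apply mul_lt_mul_of_pos_left hc; positivity
      _ ≤ _ := by
          rw [Finset.mul_sum]
          refine Finset.sum_le_sum fun v hv => ?_
          rw [mul_comm]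
          exact mul_le_mul_of_nonneg_left (hZ v hv) (dg_nonneg _ _ _)
  have h2 : ∑ v ∈ Z, dg H Finset.univ v * tau G v
      = ∑ t, ∑ t', ∑ v ∈ Z, dg H Finset.univ v * h G v t t' := by
    rw [Finset.sum_congr rfl fun t _ => Finset.sum_comm, Finset.sum_comm]
    refine Finset.sum_congr rfl fun v _ => ?_
    unfold tau; rw [Finset.mul_sum]
    exact Finset.sum_congr rfl fun t _ => by rw [Finset.mul_sum]
  have h3 : ∃ t t', μ * ν * n ^ 2 < ∑ v ∈ Z, dg H Finset.univ v * h G v t t' := by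
    by_contra! hcc
    have : ∑ t, ∑ t', ∑ v ∈ Z, dg H Finset.univ v * h G v t t'
        ≤ ∑ _t : V, ∑ _t' : V, μ * ν * n ^ 2 :=
      Finset.sum_le_sum fun t _ => Finset.sum_le_sum fun t' _ => hcc t t'
    simp only [Finset.sum_const, Finset.card_univ, nsmul_eq_mul, ← hnn] at this
    nlinarith
  obtain ⟨t, t', htt⟩ := h3
  have hpos : 0 < μ * ν * n ^ 2 := by positivity
  have hadj : G.Adj t t' := by
    by_contra hna
    have : ∑ v ∈ Z, dg H Finset.univ v * h G v t t' = 0 :=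
      Finset.sum_eq_zero fun v _ => by unfold h; rw [g_not hna]; ring
    linarith
  classical
  set Z1 := Z.filter (fun v => G.Adj v t ∧ G.Adj v t') with hZ1
  have h4 : ∑ v ∈ Z, dg H Finset.univ v * h G v t t' = ∑ v ∈ Z1, dg H Finset.univ v := by
    rw [hZ1, Finset.sum_filter]
    refine Finset.sum_congr rfl fun v _ => ?_
    unfold h; rw [g_adj hadj]
    split_ifs with hv
    · rw [g_adj hv.1, g_adj hv.2]; ring
    · rw [not_and_or] at hv
      rcases hv with hv | hv <;> rw [g_not hv] <;> ring
  obtain ⟨a, ha, b, hb, p, hp, hl, hF, x, y, hxy, he⟩ := blue_path G H hle Z1 {t, t'} (k - 1)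
    (by omega) (2 * k + 5) (by
      have : (({t, t'} : Finset V).card : ℝ) ≤ 2 := by exact_mod_cast Finset.card_le_two
      have h5 : ((k - 1 : ℕ) : ℝ) = k - 1 := by rw [Nat.cast_sub (by omega)]; simp
      rw [h5]; linarith) (by rw [← h4, ← hnn]; nlinarith)
  obtain ⟨q, hq, hql, hqe, -⟩ := ext_path G p hp (Finset.mem_filter.1 ha).2.1.symm
    (Finset.mem_filter.1 hb).2.2 (fun hm => hF t hm (by simp)) (fun hm => hF t' hm (by simp)) hadj.ne
  have := close_cycle G q hq (by omega) hadj.symm _ (hqe _ he)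
  rw [hql, hl] at this
  exact hB x y hxy (by convert this using 1; omega)

lemma red_N (k : ℕ) (hk : 3 ≤ k) (μ μ' ν : ℝ) (hμ : 0 < μ) (hμ' : 0 < μ') (hν : 0 < ν) :
    ∃ n₀ : ℝ, ∀ (V : Type) [Fintype V] [DecidableEq V] (G H : SimpleGraph V) (Z T : Finset V),
      n₀ < (Fintype.card V : ℝ) → H ≤ G →
      (∀ x y, H.Adj x y → ¬ occursInC G (2 * k + 1) s(x, y)) →
      (∀ v ∈ T, μ * (Fintype.card V : ℝ) ^ 2 ≤ tau G v) →
      (∀ v ∈ Z, μ' * (Fintype.card V : ℝ) ≤ dg G T v) →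
      ∑ v ∈ Z, dg H Finset.univ v ≤ ν * (Fintype.card V : ℝ) ^ 2 := by
  refine ⟨max 0 (2 * (2 * (2 * k + 5)) / (μ * μ' * ν)), ?_⟩
  intro V _ _ G H Z T hn hle hB hT hZ
  set n : ℝ := (Fintype.card V : ℝ) with hnn
  have hn0 : 0 < n := (le_max_left _ _).trans_lt hn
  have hn1 : 2 * (2 * (2 * k + 5)) < n * (μ * μ' * ν) := by
    rw [← div_lt_iff₀ (by positivity)]; exact (le_max_right _ _).trans_lt hn
  set c := μ * μ' * ν with hc'
  have hcpos : 0 < c := by positivity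
  by_contra! hc
  have h1 : μ * n ^ 2 * (μ' * n) * (ν * n ^ 2)
      < ∑ v ∈ Z, dg H Finset.univ v * ∑ w ∈ T, g G v w * tau G w := by
    calc _ < μ * n ^ 2 * (μ' * n) * ∑ v ∈ Z, dg H Finset.univ v := by
          apply mul_lt_mul_of_pos_left hc; positivity
      _ ≤ _ := by
          rw [Finset.mul_sum]
          refine Finset.sum_le_sum fun v hv => ?_
          rw [mul_comm]
          refine mul_le_mul_of_nonneg_left ?_ (dg_nonneg _ _ _)
          calc μ * n ^ 2 * (μ' * n) ≤ μ * n ^ 2 * dg G T v :=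
                mul_le_mul_of_nonneg_left (hZ v hv) (by positivity)
            _ = ∑ w ∈ T, g G v w * (μ * n ^ 2) := by
                unfold dg; rw [← Finset.sum_mul, mul_comm]
            _ ≤ _ := Finset.sum_le_sum fun w hw =>
                mul_le_mul_of_nonneg_left (hT w hw) (g_nonneg _ _ _)
  have h2 : ∑ v ∈ Z, dg H Finset.univ v * ∑ w ∈ T, g G v w * tau G w
      = ∑ t, ∑ t', ∑ v ∈ Z, dg H Finset.univ v * ∑ w ∈ T, g G v w * h G w t t' := by
    rw [Finset.sum_congr rfl fun t _ => Finset.sum_comm, Finset.sum_comm]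
    refine Finset.sum_congr rfl fun v _ => ?_
    simp only [← Finset.mul_sum]
    congr 1
    rw [Finset.sum_congr rfl fun t _ => Finset.sum_comm, Finset.sum_comm]
    refine Finset.sum_congr rfl fun w _ => ?_
    unfold tau
    simp only [← Finset.mul_sum]
  have h3 : ∃ t t', c * n ^ 3 < ∑ v ∈ Z, dg H Finset.univ v * ∑ w ∈ T, g G v w * h G w t t' := by
    by_contra! hcc
    have : ∑ t, ∑ t', ∑ v ∈ Z, dg H Finset.univ v * ∑ w ∈ T, g G v w * h G w t t'
        ≤ ∑ _t : V, ∑ _t' : V, c * n ^ 3 :=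
      Finset.sum_le_sum fun t _ => Finset.sum_le_sum fun t' _ => hcc t t'
    simp only [Finset.sum_const, Finset.card_univ, nsmul_eq_mul, ← hnn] at this
    rw [h2] at h1
    have e : μ * n ^ 2 * (μ' * n) * (ν * n ^ 2) = n * (n * (c * n ^ 3)) := by rw [hc']; ring
    linarith
  obtain ⟨t, t', htt⟩ := h3
  have hpos : 0 < c * n ^ 3 := by positivity
  have hadj : G.Adj t t' := by
    by_contra hna
    have : ∑ v ∈ Z, dg H Finset.univ v * ∑ w ∈ T, g G v w * h G w t t' = 0 := by
      refine Finset.sum_eq_zero fun v _ => ?_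
      rw [Finset.sum_eq_zero, mul_zero]
      intro w _
      unfold h; rw [g_not hna]; ring
    linarith
  classical
  set W : Finset V := Finset.univ.filter (fun v => G.Adj v t ∧ G.Adj v t') with hW
  set Z1 := Z.filter (fun v => c / 2 * n ≤ dg G W v) with hZ1
  have hcv : ∀ v, ∑ w ∈ T, g G v w * h G w t t' ≤ dg G W v := by
    intro v
    have : dg G W v = ∑ w, g G v w * h G w t t' := by
      unfold dg
      rw [hW, Finset.sum_filter]
      refine Finset.sum_congr rfl fun w _ => ?_
      unfold h; rw [g_adj hadj]
      split_ifs with hv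
      · rw [g_adj hv.1, g_adj hv.2]; ring
      · rw [not_and_or] at hv
        rcases hv with hv | hv <;> rw [g_not hv] <;> ring
    rw [this]
    exact Finset.sum_le_sum_of_subset_of_nonneg (Finset.subset_univ _)
      fun _ _ _ => mul_nonneg (g_nonneg _ _ _) (h_nonneg _ _ _ _)
  have h4 : ∑ v ∈ Z, dg H Finset.univ v * ∑ w ∈ T, g G v w * h G w t t'
      ≤ n * ∑ v ∈ Z1, dg H Finset.univ v + c / 2 * n ^ 3 := by
    have : ∀ v ∈ Z, dg H Finset.univ v * ∑ w ∈ T, g G v w * h G w t t' ≤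
        n * (if c / 2 * n ≤ dg G W v then dg H Finset.univ v else 0) + c / 2 * n ^ 2 := by
      intro v _
      have a1 := hcv v
      have a2 := dg_nonneg H Finset.univ v
      have a3 := dg_le H Finset.univ v
      have a4 := dg_le G W v
      rw [← hnn] at a3 a4
      have a5 : dg H Finset.univ v * ∑ w ∈ T, g G v w * h G w t t' ≤ dg H Finset.univ v * dg G W v :=
        mul_le_mul_of_nonneg_left a1 a2
      split_ifs with hv
      · have : 0 ≤ c / 2 * n ^ 2 := by positivity
        nlinarith
      · push Not at hv
        have := mul_le_mul a3 hv.le (dg_nonneg _ _ _) hn0.le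
        nlinarith
    refine (Finset.sum_le_sum this).trans ?_
    rw [Finset.sum_add_distrib, ← Finset.mul_sum, ← Finset.sum_filter, Finset.sum_const, nsmul_eq_mul]
    have := card_le Z
    rw [← hnn] at this
    have : (Z.card : ℝ) * (c / 2 * n ^ 2) ≤ n * (c / 2 * n ^ 2) :=
      mul_le_mul_of_nonneg_right this (by positivity)
    nlinarith
  have h5 : c / 2 * n ^ 2 < ∑ v ∈ Z1, dg H Finset.univ v := by
    by_contra! hh
    have := mul_le_mul_of_nonneg_left hh hn0.le
    nlinarith
  obtain ⟨a, ha, b, hb, p, hp, hl, hF, x, y, hxy, he⟩ := blue_path G H hle Z1 {t, t'} (k - 2)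
    (by omega) (2 * k + 5) (by
      have : (({t, t'} : Finset V).card : ℝ) ≤ 2 := by exact_mod_cast Finset.card_le_two
      have h5 : ((k - 2 : ℕ) : ℝ) = k - 2 := by rw [Nat.cast_sub (by omega)]; simp
      rw [h5]; linarith) (by rw [← hnn]; nlinarith)
  have hsup : p.support.toFinset.card ≤ 2 * k := by
    refine (List.toFinset_card_le _).trans ?_
    rw [Walk.length_support, hl]; omega
  have hk1 : (2 * k + 1 : ℝ) < c / 2 * n := by linarith
  obtain ⟨w, hwW, haw, hwF⟩ := exists_nbr G W p.support.toFinset a (by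
    have := (Finset.mem_filter.1 ha).2
    have h6 : (p.support.toFinset.card : ℝ) ≤ 2 * k := by exact_mod_cast hsup
    linarith)
  obtain ⟨w', hwW', hbw, hwF'⟩ := exists_nbr G W (insert w p.support.toFinset) b (by
    have := (Finset.mem_filter.1 hb).2
    have h6 : ((insert w p.support.toFinset).card : ℝ) ≤ 2 * k + 1 := by
      exact_mod_cast (Finset.card_insert_le _ _).trans (by omega)
    linarith)
  simp only [Finset.mem_insert, List.mem_toFinset, not_or] at hwF hwF'
  have hwt := (Finset.mem_filter.1 hwW).2
  have hwt' := (Finset.mem_filter.1 hwW').2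
  obtain ⟨q, hq, hql, hqe, hqs⟩ := ext_path G p hp haw.symm hbw hwF hwF'.2 (fun h => hwF'.1 h.symm)
  obtain ⟨r, hr, hrl, hre, -⟩ := ext_path G q hq hwt.1.symm hwt'.2
    (by
      rw [hqs]; push Not
      exact ⟨hwt.1.ne.symm, hwt'.1.ne.symm, fun hm => hF t hm (by simp)⟩)
    (by
      rw [hqs]; push Not
      exact ⟨hwt.2.ne.symm, hwt'.2.ne.symm, fun hm => hF t' hm (by simp)⟩) hadj.ne
  have := close_cycle G r hr (by omega) hadj.symm _ (hre _ (hqe _ he))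
  rw [hrl, hql, hl] at this
  exact hB x y hxy (by convert this using 1; omega)

lemma tau_le (G : SimpleGraph V) (x : V) : tau G x ≤ (Fintype.card V : ℝ) ^ 2 := by
  unfold tau
  calc _ ≤ ∑ _y : V, ∑ _z : V, (1 : ℝ) :=
        Finset.sum_le_sum fun _ _ => Finset.sum_le_sum fun _ _ => h_le_one _ _ _ _
    _ = _ := by simp; ring

lemma sum_out (S : Finset V) (f : V → ℝ) (c : ℝ) (hc : 0 ≤ c) (hf : ∀ v ∈ S, f v ≤ c) :
    ∑ v ∈ S, f v ≤ (Fintype.card V : ℝ) * c := by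
  refine (Finset.sum_le_sum hf).trans ?_
  rw [Finset.sum_const, nsmul_eq_mul]
  exact mul_le_mul_of_nonneg_right (card_le S) hc

lemma sum_split (S : Finset V) (f : V → ℝ) : ∑ v, f v = ∑ v ∈ S, f v + ∑ v ∈ Sᶜ, f v :=
  (Finset.sum_add_sum_compl S f).symm

lemma D_split (G : SimpleGraph V) (S : Finset V) :
    ∑ v, dg G Finset.univ v =
      ∑ v ∈ S, dg G S v + 2 * ∑ v ∈ Sᶜ, dg G S v + ∑ v ∈ Sᶜ, dg G Sᶜ v := by
  rw [sum_split S]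
  simp only [dg_compl G S, Finset.sum_add_distrib]
  rw [E_comm G S Sᶜ]; ring

/-- Blue edges bound in the case of a large set `A`. -/
lemma case1 (G H : SimpleGraph V) (hle : H ≤ G) (A : Finset V) (μ ν κ : ℝ)
    (hμ : 0 ≤ μ) (hκ : 0 ≤ κ) (hμκ : μ ≤ 2 * κ ^ 2)
    (hA : ∀ v, v ∉ A → tau G v ≤ μ * (Fintype.card V : ℝ) ^ 2)
    (hν : ∑ v ∈ A, dg H Finset.univ v ≤ ν * (Fintype.card V : ℝ) ^ 2) :
    ∑ v, dg H Finset.univ v ≤ 2 * ν * (Fintype.card V : ℝ) ^ 2 +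
      ((Fintype.card V : ℝ) - A.card) ^ 2 / 2 + κ * (Fintype.card V : ℝ) ^ 2 := by
  have h1 := D_split H A
  have h2 : ∑ v ∈ A, dg H Finset.univ v = ∑ v ∈ A, dg H A v + ∑ v ∈ Aᶜ, dg H A v := by
    simp only [dg_compl H A, Finset.sum_add_distrib]
    rw [E_comm H A Aᶜ]
  have h3 : 0 ≤ ∑ v ∈ A, dg H A v := Finset.sum_nonneg fun _ _ => dg_nonneg _ _ _
  have h4 : ∑ v ∈ Aᶜ, dg H Aᶜ v ≤ ∑ v ∈ Aᶜ, dg G Aᶜ v :=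
    Finset.sum_le_sum fun _ _ => dg_mono hle _ _
  have h5 : tri G Aᶜ ≤ 2 * κ ^ 2 * (Fintype.card V : ℝ) ^ 3 := by
    refine (tri_le_tau G Aᶜ).trans ?_
    refine (sum_out Aᶜ _ (μ * (Fintype.card V : ℝ) ^ 2) (by positivity)
      fun v hv => hA v (Finset.mem_compl.1 hv)).trans ?_
    have := mul_le_mul_of_nonneg_right hμκ (by positivity : 0 ≤ (Fintype.card V : ℝ) ^ 3)
    nlinarith
  have h6 := mantel G Aᶜ κ hκ h5
  have h7 : ((Aᶜ : Finset V).card : ℝ) = (Fintype.card V : ℝ) - A.card := by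
    rw [Finset.card_compl, Nat.cast_sub A.card_le_univ]
  rw [h7] at h6
  linarith

lemma case2_real (t s p η δ : ℝ) (hη : 0 < η) (hη1 : η ≤ 1 / 12) (hδ : δ ≤ η / 8)
    (ht : 1 / 4 ≤ t) (hs : 0 ≤ s) (hp0 : 0 ≤ p) (hp : p ≤ t) (hts : t + s ≤ 2 / 3 - η)
    (hf : 1 / 2 ≤ t ^ 2 - p ^ 2 + 2 * p * s + (1 - t) ^ 2 / 2 + δ) : False := by
  have h1 : p * s ≤ p * (2 / 3 - η - t) := mul_le_mul_of_nonneg_left (by linarith) hp0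
  by_cases h3 : 1 / 3 ≤ t
  · have h2 : -p ^ 2 + 2 * p * (2 / 3 - η - t) ≤ (2 / 3 - η - t) ^ 2 := by
      nlinarith [sq_nonneg (p - (2 / 3 - η - t))]
    nlinarith [mul_nonneg (sub_nonneg.2 h3) (by linarith : 0 ≤ 2 / 3 - η - t)]
  · push Not at h3
    have h4 : p * (2 / 3 - η - t) ≤ p * (2 / 3 - t) := mul_le_mul_of_nonneg_left (by linarith) hp0
    have h2 : -p ^ 2 + 2 * p * (2 / 3 - t) ≤ -t ^ 2 + 2 * t * (2 / 3 - t) := by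
      nlinarith [mul_nonneg (sub_nonneg.2 hp) (by linarith : 0 ≤ 2 * (2 / 3 - t) - p - t)]
    nlinarith [mul_nonneg (sub_nonneg.2 ht) (by linarith : 0 ≤ 1 / 3 - t)]

lemma case2 (G : SimpleGraph V) (T A : Finset V) (hTA : T ⊆ A) (μ κ η : ℝ)
    (hn : 0 < (Fintype.card V : ℝ))
    (hμ : 0 ≤ μ) (hκ : 0 ≤ κ) (hμκ : μ ≤ 2 * κ ^ 2) (hη : 0 < η) (hη1 : η ≤ 1 / 12)
    (hδ : 3 * μ + κ ≤ η / 8)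
    (hT : ∀ v, v ∉ T → tau G v ≤ μ * (Fintype.card V : ℝ) ^ 2)
    (hA : ∀ v, v ∉ A → dg G T v ≤ μ * (Fintype.card V : ℝ))
    (hD : (Fintype.card V : ℝ) ^ 2 / 2 ≤ ∑ v, dg G Finset.univ v)
    (ht : (Fintype.card V : ℝ) / 4 ≤ T.card)
    (ha : (A.card : ℝ) ≤ (2 / 3 - η) * (Fintype.card V : ℝ)) : False := by
  set n : ℝ := (Fintype.card V : ℝ) with hnn
  have h5 : tri G Tᶜ ≤ 2 * κ ^ 2 * n ^ 3 := by
    refine (tri_le_tau G Tᶜ).trans ?_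
    refine (sum_out Tᶜ _ (μ * n ^ 2) (by positivity)
      fun v hv => hT v (Finset.mem_compl.1 hv)).trans ?_
    have := mul_le_mul_of_nonneg_right hμκ (by positivity : 0 ≤ n ^ 3)
    nlinarith
  have h6 := mantel G Tᶜ κ hκ h5
  have h7 : ((Tᶜ : Finset V).card : ℝ) = n - T.card := by
    rw [Finset.card_compl, Nat.cast_sub T.card_le_univ]
  rw [h7, ← hnn] at h6
  have hsd : ((A \ T).card : ℝ) = A.card - T.card := by
    rw [Finset.card_sdiff_of_subset hTA, Nat.cast_sub (Finset.card_le_card hTA)]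
  have hp : ∃ p : ℝ, 0 ≤ p ∧ p ≤ T.card ∧ (∀ v ∈ A \ T, dg G T v ≤ p) ∧
      ∑ v ∈ T, dg G T v ≤ (T.card : ℝ) ^ 2 - p ^ 2 + μ * n ^ 2 := by
    by_cases hS : (A \ T).Nonempty
    · obtain ⟨v, hv, hmax⟩ := Finset.exists_max_image (A \ T) (dg G T) hS
      refine ⟨dg G T v, dg_nonneg _ _ _, dg_le_card _ _ _, hmax, ?_⟩
      have hvT : v ∉ T := (Finset.mem_sdiff.1 hv).2
      have e1 : ∑ x ∈ T, dg G T x ≤ ∑ x ∈ T, ∑ y ∈ T, (1 - g G v x * g G v y + h G v x y) := by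
        unfold dg
        refine Finset.sum_le_sum fun x _ => Finset.sum_le_sum fun y _ => ?_
        unfold h
        have a1 := g_le_one G x y
        have a2 : g G v x * g G v y ≤ 1 :=
          mul_le_one₀ (g_le_one _ _ _) (g_nonneg _ _ _) (g_le_one _ _ _)
        nlinarith [mul_nonneg (sub_nonneg.2 a1) (sub_nonneg.2 a2)]
      have e2 : ∑ x ∈ T, ∑ y ∈ T, (1 - g G v x * g G v y + h G v x y)
          = (T.card : ℝ) ^ 2 - (dg G T v) ^ 2 + ∑ x ∈ T, ∑ y ∈ T, h G v x y := by
        simp only [Finset.sum_add_distrib, Finset.sum_sub_distrib, Finset.sum_const, nsmul_eq_mul,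
          mul_one, ← Finset.mul_sum, ← Finset.sum_mul]
        unfold dg; ring
      have e3 : ∑ x ∈ T, ∑ y ∈ T, h G v x y ≤ tau G v := by
        unfold tau
        refine (Finset.sum_le_sum fun y _ => Finset.sum_le_sum_of_subset_of_nonneg
          (Finset.subset_univ T) fun _ _ _ => h_nonneg _ _ _ _).trans ?_
        exact Finset.sum_le_sum_of_subset_of_nonneg (Finset.subset_univ T)
          fun _ _ _ => Finset.sum_nonneg fun _ _ => h_nonneg _ _ _ _
      have := hT v hvT
      linarith
    · refine ⟨0, le_rfl, by positivity, fun v hv => (hS ⟨v, hv⟩).elim, ?_⟩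
      have : ∑ v ∈ T, dg G T v ≤ ∑ v ∈ T, (T.card : ℝ) :=
        Finset.sum_le_sum fun _ _ => dg_le_card _ _ _
      rw [Finset.sum_const, nsmul_eq_mul] at this
      have : 0 ≤ μ * n ^ 2 := by positivity
      nlinarith
  obtain ⟨p, hp0, hpt, hpS, hTT⟩ := hp
  have hcross : ∑ v ∈ Tᶜ, dg G T v ≤ p * (A.card - T.card) + μ * n ^ 2 := by
    have e1 : ∑ v ∈ Tᶜ, dg G T v = ∑ v ∈ A \ T, dg G T v + ∑ v ∈ Aᶜ, dg G T v := by
      rw [← Finset.sum_union]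
      · congr 1
        ext x
        simp only [Finset.mem_compl, Finset.mem_union, Finset.mem_sdiff]
        have := @hTA x
        tauto
      · rw [Finset.disjoint_left]; intro x hx hx'
        simp at hx hx'; tauto
    have e2 : ∑ v ∈ A \ T, dg G T v ≤ (A.card - T.card) * p := by
      refine (Finset.sum_le_sum hpS).trans ?_
      rw [Finset.sum_const, nsmul_eq_mul, hsd]
    have e3 := sum_out Aᶜ (dg G T) (μ * n) (by positivity) fun v hv => hA v (Finset.mem_compl.1 hv)
    rw [← hnn] at e3
    nlinarith
  have hsplit := D_split G T
  have hst : (0 : ℝ) ≤ A.card - T.card := by rw [← hsd]; positivity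
  have hfin : n ^ 2 / 2 ≤ (T.card : ℝ) ^ 2 - p ^ 2 + 2 * p * (A.card - T.card) + (n - T.card) ^ 2 / 2
      + (3 * μ + κ) * n ^ 2 := by linarith
  refine case2_real (T.card / n) ((A.card - T.card) / n) (p / n) η (3 * μ + κ) hη hη1 hδ
    ?_ (by positivity) (by positivity) ?_ ?_ ?_
  · rw [le_div_iff₀ hn]; linarith
  · gcongr
  · rw [← add_div, div_le_iff₀ hn]; linarith
  · have := div_le_div_of_nonneg_right hfin (by positivity : 0 ≤ n ^ 2)
    have e1 : n ^ 2 / 2 / n ^ 2 = 1 / 2 := by field_simp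
    rw [e1] at this
    refine this.trans (le_of_eq ?_)
    field_simp

lemma tri_split (G : SimpleGraph V) (S P : Finset V) (hP : P ⊆ S) :
    tri G S ≤ tri G P + 3 * ∑ v ∈ S \ P, tau G v := by
  have ext : ∀ (A B C : Finset V) (f : V → V → V → ℝ), (∀ x y z, 0 ≤ f x y z) →
      ∑ x ∈ A, ∑ y ∈ B, ∑ z ∈ C, f x y z ≤ ∑ x ∈ A, ∑ y, ∑ z, f x y z := by
    intro A B C f hf
    refine Finset.sum_le_sum fun x _ => ?_
    refine (Finset.sum_le_sum fun y _ => Finset.sum_le_sum_of_subset_of_nonneg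
      (Finset.subset_univ C) fun _ _ _ => hf _ _ _).trans ?_
    exact Finset.sum_le_sum_of_subset_of_nonneg (Finset.subset_univ B)
      fun _ _ _ => Finset.sum_nonneg fun _ _ => hf _ _ _
  unfold tri
  have a1 := Finset.sum_sdiff hP (f := fun x => ∑ y ∈ S, ∑ z ∈ S, h G x y z)
  have a2 : ∑ x ∈ P, ∑ y ∈ S, ∑ z ∈ S, h G x y z =
      ∑ x ∈ P, ∑ y ∈ S \ P, ∑ z ∈ S, h G x y z + ∑ x ∈ P, ∑ y ∈ P, ∑ z ∈ S, h G x y z := by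
    rw [← Finset.sum_add_distrib]
    exact Finset.sum_congr rfl fun x _ => (Finset.sum_sdiff hP).symm
  have a3 : ∑ x ∈ P, ∑ y ∈ P, ∑ z ∈ S, h G x y z =
      ∑ x ∈ P, ∑ y ∈ P, ∑ z ∈ S \ P, h G x y z + ∑ x ∈ P, ∑ y ∈ P, ∑ z ∈ P, h G x y z := by
    rw [← Finset.sum_add_distrib]
    refine Finset.sum_congr rfl fun x _ => ?_
    rw [← Finset.sum_add_distrib]
    exact Finset.sum_congr rfl fun x _ => (Finset.sum_sdiff hP).symm
  have b1 : ∑ x ∈ S \ P, ∑ y ∈ S, ∑ z ∈ S, h G x y z ≤ ∑ v ∈ S \ P, tau G v :=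
    ext _ _ _ _ fun _ _ _ => h_nonneg _ _ _ _
  have b2 : ∑ x ∈ P, ∑ y ∈ S \ P, ∑ z ∈ S, h G x y z ≤ ∑ v ∈ S \ P, tau G v := by
    rw [Finset.sum_comm]
    refine (ext _ _ _ (fun y x z => h G x y z) fun _ _ _ => h_nonneg _ _ _ _).trans (le_of_eq ?_)
    refine Finset.sum_congr rfl fun y _ => ?_
    unfold tau
    rw [Finset.sum_comm]
    exact Finset.sum_congr rfl fun _ _ => Finset.sum_congr rfl fun _ _ => h_rot _ _ _ _
  have b3 : ∑ x ∈ P, ∑ y ∈ P, ∑ z ∈ S \ P, h G x y z ≤ ∑ v ∈ S \ P, tau G v := by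
    rw [Finset.sum_congr rfl fun t _ => Finset.sum_comm, Finset.sum_comm]
    refine (ext _ _ _ (fun z x y => h G x y z) fun _ _ _ => h_nonneg _ _ _ _).trans (le_of_eq ?_)
    refine Finset.sum_congr rfl fun z _ => ?_
    unfold tau
    refine Finset.sum_congr rfl fun x _ => Finset.sum_congr rfl fun y _ => ?_
    rw [h_rot, h_rot]
  linarith

lemma tri_ptwise (G : SimpleGraph V) (T A : Finset V) (hTA : T ⊆ A)
    (hT4 : (T.card : ℝ) ≤ (Fintype.card V : ℝ) / 4)
    (ha : (A.card : ℝ) ≤ 2 / 3 * (Fintype.card V : ℝ)) (x y z : V)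
    (hx : 21 / 50 * (Fintype.card V : ℝ) < dg G Finset.univ x)
    (hy : 21 / 50 * (Fintype.card V : ℝ) < dg G Finset.univ y)
    (hz : 21 / 50 * (Fintype.card V : ℝ) < dg G Finset.univ z) :
    h G x y z * (9 / 100 * (Fintype.card V : ℝ)) ≤
      ∑ v ∈ A \ T, (h G v x y + h G v y z + h G v x z) +
        (dg G Aᶜ x + dg G Aᶜ y + dg G Aᶜ z) := by
  have hS0 : 0 ≤ ∑ v ∈ A \ T, (h G v x y + h G v y z + h G v x z) :=
    Finset.sum_nonneg fun v _ => by
      have := h_nonneg G v x y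
      have := h_nonneg G v y z
      have := h_nonneg G v x z
      linarith
  have u1 := dg_nonneg G Aᶜ x
  have u2 := dg_nonneg G Aᶜ y
  have u3 := dg_nonneg G Aᶜ z
  by_cases htr : G.Adj x y ∧ G.Adj y z ∧ G.Adj x z
  · obtain ⟨h1, h2, h3⟩ := htr
    have hh : h G x y z = 1 := by unfold h; rw [g_adj h1, g_adj h2, g_adj h3]; norm_num
    have hsd : ((A \ T).card : ℝ) = A.card - T.card := by
      rw [Finset.card_sdiff_of_subset hTA, Nat.cast_sub (Finset.card_le_card hTA)]
    have key : dg G (A \ T) x + dg G (A \ T) y + dg G (A \ T) z ≤ (A.card - T.card) +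
        ∑ v ∈ A \ T, (h G v x y + h G v y z + h G v x z) := by
      have : ((A.card : ℝ) - T.card) = ∑ v ∈ A \ T, (1 : ℝ) := by simp [← hsd]
      rw [this]
      unfold dg
      simp only [← Finset.sum_add_distrib]
      refine Finset.sum_le_sum fun v _ => ?_
      unfold h
      rw [g_adj h1, g_adj h2, g_adj h3, g_symm G x v, g_symm G y v, g_symm G z v]
      have a1 := sub_nonneg.2 (g_le_one G v x)
      have a2 := sub_nonneg.2 (g_le_one G v y)
      have a3 := sub_nonneg.2 (g_le_one G v z)
      have b1 := g_nonneg G v x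
      have b2 := g_nonneg G v y
      have b3 := g_nonneg G v z
      nlinarith [mul_nonneg (mul_nonneg a1 a2) a3, mul_nonneg (mul_nonneg b1 b2) b3]
    have dsp : ∀ w, dg G Finset.univ w ≤ T.card + dg G (A \ T) w + dg G Aᶜ w := by
      intro w
      rw [dg_compl G A w]
      have : dg G A w = dg G (A \ T) w + dg G T w := by
        unfold dg; rw [Finset.sum_sdiff hTA]
      have := dg_le_card G T w
      linarith
    have := dsp x
    have := dsp y
    have := dsp z
    rw [hh]; linarith
  · have hh : h G x y z = 0 := by
      unfold h
      by_cases h1 : G.Adj x y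
      · by_cases h2 : G.Adj y z
        · rw [g_not (x := x) (y := z) fun h3 => htr ⟨h1, h2, h3⟩]; ring
        · rw [g_not h2]; ring
      · rw [g_not h1]; ring
    rw [hh]; linarith

lemma case3 (G : SimpleGraph V) (T A : Finset V) (hTA : T ⊆ A) (μ κ : ℝ)
    (hn : 0 < (Fintype.card V : ℝ))
    (hμ : 0 ≤ μ) (hκ : 0 ≤ κ) (hκ1 : κ ≤ 1) (hμκ : μ ≤ κ ^ 2 / 35)
    (hT : ∀ v, v ∉ T → tau G v ≤ μ * (Fintype.card V : ℝ) ^ 2)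
    (hA : ∀ v, v ∉ A → dg G T v ≤ μ * (Fintype.card V : ℝ))
    (hD : (Fintype.card V : ℝ) ^ 2 / 2 ≤ ∑ v, dg G Finset.univ v)
    (ht : T.card ≤ (Fintype.card V : ℝ) / 4)
    (ha : (A.card : ℝ) ≤ 2 / 3 * (Fintype.card V : ℝ)) :
    tri G Finset.univ ≤ 90 * κ * (Fintype.card V : ℝ) ^ 3 := by
  set n : ℝ := (Fintype.card V : ℝ) with hnn
  set L := T.filter (fun x => dg G Finset.univ x ≤ 21 / 50 * n) with hL
  set Q := T \ L with hQ
  have hLT : L ⊆ T := Finset.filter_subset _ _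
  have hQdeg : ∀ x ∈ Q, 21 / 50 * n < dg G Finset.univ x := by
    intro x hx
    rw [hQ, Finset.mem_sdiff, hL, Finset.mem_filter] at hx
    by_contra! hh
    exact hx.2 ⟨hx.1, hh⟩
  have hQtri : tri G Q * (9 / 100 * n) ≤ 6 * μ * n ^ 4 := by
    have e1 : tri G Q * (9 / 100 * n) ≤ ∑ x ∈ Q, ∑ y ∈ Q, ∑ z ∈ Q,
        (∑ v ∈ A \ T, (h G v x y + h G v y z + h G v x z) +
        (dg G Aᶜ x + dg G Aᶜ y + dg G Aᶜ z)) := by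
      unfold tri
      simp only [Finset.sum_mul]
      exact Finset.sum_le_sum fun x hx => Finset.sum_le_sum fun y hy => Finset.sum_le_sum fun z hz =>
        tri_ptwise G T A hTA ht ha x y z (hQdeg x hx) (hQdeg y hy) (hQdeg z hz)
    have e2 : ∑ x ∈ Q, ∑ y ∈ Q, ∑ z ∈ Q, (dg G Aᶜ x + dg G Aᶜ y + dg G Aᶜ z)
        = 3 * (Q.card : ℝ) ^ 2 * ∑ x ∈ Q, dg G Aᶜ x := by
      simp only [Finset.sum_add_distrib, Finset.sum_const, nsmul_eq_mul, ← Finset.mul_sum]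
      ring
    have e3 : ∑ x ∈ Q, dg G Aᶜ x ≤ μ * n ^ 2 := by
      have c1 : ∑ x ∈ Q, dg G Aᶜ x ≤ ∑ x ∈ T, dg G Aᶜ x :=
        Finset.sum_le_sum_of_subset_of_nonneg Finset.sdiff_subset fun _ _ _ => dg_nonneg _ _ _
      rw [E_comm G T Aᶜ] at c1
      have c2 := sum_out Aᶜ (dg G T) (μ * n) (by positivity)
        fun v hv => hA v (Finset.mem_compl.1 hv)
      rw [← hnn] at c2
      linarith
    have e4 : 3 * (Q.card : ℝ) ^ 2 * ∑ x ∈ Q, dg G Aᶜ x ≤ 3 * n ^ 2 * (μ * n ^ 2) := by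
      have := card_le Q
      rw [← hnn] at this
      have hnonneg : 0 ≤ ∑ x ∈ Q, dg G Aᶜ x := Finset.sum_nonneg fun _ _ => dg_nonneg _ _ _
      gcongr
    have e5 : ∑ x ∈ Q, ∑ y ∈ Q, ∑ z ∈ Q, ∑ v ∈ A \ T, (h G v x y + h G v y z + h G v x z)
        ≤ 3 * μ * n ^ 4 := by
      have c1 : ∑ x ∈ Q, ∑ y ∈ Q, ∑ z ∈ Q, ∑ v ∈ A \ T, (h G v x y + h G v y z + h G v x z)
          = ∑ v ∈ A \ T, ∑ x ∈ Q, ∑ y ∈ Q, ∑ z ∈ Q, (h G v x y + h G v y z + h G v x z) := by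
        symm
        rw [Finset.sum_comm]
        refine Finset.sum_congr rfl fun x _ => ?_
        rw [Finset.sum_comm]
        refine Finset.sum_congr rfl fun y _ => ?_
        rw [Finset.sum_comm]
      rw [c1]
      have c2 : ∀ v ∈ A \ T, ∑ x ∈ Q, ∑ y ∈ Q, ∑ z ∈ Q, (h G v x y + h G v y z + h G v x z)
          ≤ 3 * n * (μ * n ^ 2) := by
        intro v hv
        have d1 : ∑ x ∈ Q, ∑ y ∈ Q, h G v x y ≤ tau G v := by
          unfold tau
          refine (Finset.sum_le_sum fun y _ => Finset.sum_le_sum_of_subset_of_nonneg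
            (Finset.subset_univ Q) fun _ _ _ => h_nonneg _ _ _ _).trans ?_
          exact Finset.sum_le_sum_of_subset_of_nonneg (Finset.subset_univ Q)
            fun _ _ _ => Finset.sum_nonneg fun _ _ => h_nonneg _ _ _ _
        have d2 : ∑ x ∈ Q, ∑ y ∈ Q, ∑ z ∈ Q, (h G v x y + h G v y z + h G v x z)
            = 3 * Q.card * ∑ x ∈ Q, ∑ y ∈ Q, h G v x y := by
          simp only [Finset.sum_add_distrib, Finset.sum_const, nsmul_eq_mul, ← Finset.mul_sum]
          ring
        rw [d2]
        have d3 := hT v (Finset.mem_sdiff.1 hv).2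
        have := card_le Q
        rw [← hnn] at this
        have d4 : 0 ≤ ∑ x ∈ Q, ∑ y ∈ Q, h G v x y :=
          Finset.sum_nonneg fun _ _ => Finset.sum_nonneg fun _ _ => h_nonneg _ _ _ _
        exact mul_le_mul (by linarith) (d1.trans d3) d4 (by positivity)
      have c3 := sum_out (A \ T) _ (3 * n * (μ * n ^ 2)) (by positivity) c2
      rw [← hnn] at c3
      nlinarith
    have e6 : ∑ x ∈ Q, ∑ y ∈ Q, ∑ z ∈ Q,
        (∑ v ∈ A \ T, (h G v x y + h G v y z + h G v x z) +
        (dg G Aᶜ x + dg G Aᶜ y + dg G Aᶜ z)) =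
        ∑ x ∈ Q, ∑ y ∈ Q, ∑ z ∈ Q, ∑ v ∈ A \ T, (h G v x y + h G v y z + h G v x z) +
        ∑ x ∈ Q, ∑ y ∈ Q, ∑ z ∈ Q, (dg G Aᶜ x + dg G Aᶜ y + dg G Aᶜ z) := by
      rw [← Finset.sum_add_distrib]
      refine Finset.sum_congr rfl fun x _ => ?_
      rw [← Finset.sum_add_distrib]
      refine Finset.sum_congr rfl fun x _ => ?_
      rw [← Finset.sum_add_distrib]
    rw [e6, e2] at e1
    nlinarith
  have hn3 : 0 < n ^ 3 := by positivity
  have hQtri' : tri G Q ≤ 67 * μ * n ^ 3 := by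
    have h0 : 0 ≤ μ * n ^ 4 := by positivity
    have : tri G Q * (9 / 100 * n) ≤ (67 * μ * n ^ 3) * (9 / 100 * n) := by nlinarith
    exact le_of_mul_le_mul_right this (by positivity)
  have hLc : tri G Lᶜ ≤ 2 * κ ^ 2 * n ^ 3 := by
    have e1 := tri_split G Lᶜ Q (fun x hx => Finset.mem_compl.2 (Finset.mem_sdiff.1 hx).2)
    have e2 := sum_out (Lᶜ \ Q) (tau G) (μ * n ^ 2) (by positivity) (by
      intro v hv
      apply hT
      rw [hQ, Finset.mem_sdiff, Finset.mem_compl, Finset.mem_sdiff] at hv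
      tauto)
    rw [← hnn] at e2
    have : μ * n ^ 3 ≤ κ ^ 2 / 35 * n ^ 3 := mul_le_mul_of_nonneg_right hμκ hn3.le
    nlinarith
  have hm := mantel G Lᶜ κ hκ hLc
  have h7 : ((Lᶜ : Finset V).card : ℝ) = n - L.card := by
    rw [Finset.card_compl, Nat.cast_sub L.card_le_univ]
  rw [h7, ← hnn] at hm
  have hLsum : ∑ v ∈ L, dg G Finset.univ v ≤ L.card * (21 / 50 * n) := by
    refine (Finset.sum_le_sum fun v hv => (Finset.mem_filter.1 hv).2).trans ?_
    rw [Finset.sum_const, nsmul_eq_mul]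
  have hLsum2 : ∑ v ∈ L, dg G Finset.univ v = ∑ v ∈ L, dg G L v + ∑ v ∈ Lᶜ, dg G L v := by
    simp only [dg_compl G L, Finset.sum_add_distrib]
    rw [E_comm G L Lᶜ]
  have h0 : 0 ≤ ∑ v ∈ L, dg G L v := Finset.sum_nonneg fun _ _ => dg_nonneg _ _ _
  have hsp := D_split G L
  have hl4 : (L.card : ℝ) ≤ n / 4 := le_trans (by exact_mod_cast Finset.card_le_card hLT) ht
  have hl0 : (0 : ℝ) ≤ L.card := by positivity
  have hLsmall : (L.card : ℝ) * (35 / 1000 * n) ≤ κ * n ^ 2 := by nlinarith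
  have hLsmall2 : (L.card : ℝ) ≤ 29 * κ * n := by
    have : (L.card : ℝ) * (35 / 1000 * n) ≤ (29 * κ * n) * (35 / 1000 * n) := by
      have : 0 ≤ κ * n ^ 2 := by positivity
      nlinarith
    exact le_of_mul_le_mul_right this (by positivity)
  have e1 := tri_split G Finset.univ Lᶜ (Finset.subset_univ _)
  have e2 : ∑ v ∈ Finset.univ \ Lᶜ, tau G v ≤ L.card * n ^ 2 := by
    have : Finset.univ \ Lᶜ = L := by ext; simp
    rw [this]
    refine (Finset.sum_le_sum fun v _ => tau_le G v).trans ?_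
    rw [Finset.sum_const, nsmul_eq_mul]
  have e3 : (L.card : ℝ) * n ^ 2 ≤ 29 * κ * n * n ^ 2 := mul_le_mul_of_nonneg_right hLsmall2 (by positivity)
  have e4 : κ ^ 2 * n ^ 3 ≤ κ * n ^ 3 := mul_le_mul_of_nonneg_right (by nlinarith) hn3.le
  nlinarith

lemma common_nbr (G : SimpleGraph V) (S F : Finset V) (a b : V)
    (hF : (S.card : ℝ) + F.card < dg G S a + dg G S b) :
    ∃ c ∈ S, G.Adj a c ∧ G.Adj b c ∧ c ∉ F := by
  classical
  obtain ⟨c, hc, hbc, hcF⟩ := exists_nbr G (S.filter (fun c => G.Adj a c)) F b (by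
    have : dg G S a + dg G S b - S.card ≤ dg G (S.filter (fun c => G.Adj a c)) b := by
      have e : (S.card : ℝ) = ∑ _w ∈ S, (1 : ℝ) := by simp
      rw [e]
      unfold dg
      rw [Finset.sum_filter, ← Finset.sum_add_distrib, ← Finset.sum_sub_distrib]
      refine Finset.sum_le_sum fun w _ => ?_
      split_ifs with hw
      · rw [g_adj hw]; linarith
      · rw [g_not hw]; linarith [g_le_one G b w]
    linarith)
  exact ⟨c, (Finset.mem_filter.1 hc).1, (Finset.mem_filter.1 hc).2, hbc, hcF⟩

lemma alt_path (G : SimpleGraph V) (X Y : Finset V) (M : ℝ)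
    (hX : ∀ u ∈ X, M ≤ dg G Y u) (hY : ∀ v ∈ Y, M ≤ dg G X v)
    (hXY : ∀ v ∈ Y, ∀ v' ∈ Y, X.card + M ≤ dg G X v + dg G X v') :
    ∀ (j : ℕ) (F : Finset V) (v y : V), v ∈ Y → y ∈ Y → v ≠ y → v ∉ F → y ∉ F →
      (F.card + 2 * j + 10 : ℝ) < M →
      ∃ p : G.Walk v y, p.IsPath ∧ p.length = 2 * (j + 1) ∧ ∀ x ∈ p.support, x ∉ F := by
  intro j
  induction j with
  | zero =>
    intro F v y hv hy hne hvF hyF hM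
    push_cast at hM
    obtain ⟨c, hc, hvc, hyc, hcF⟩ := common_nbr G X F v y (by
      have := hXY v hv y hy; linarith)
    refine ⟨Walk.cons hvc (Walk.cons hyc.symm Walk.nil), ?_, by simp, ?_⟩
    · simp [Walk.cons_isPath_iff, hvc.ne, hne, hyc.ne.symm]
    · simp [hvF, hcF, hyF]
  | succ j ih =>
    intro F v y hv hy hne hvF hyF hM
    push_cast at hM
    have c1 : ((insert y F).card : ℝ) ≤ F.card + 1 := by
      exact_mod_cast Finset.card_insert_le y F
    obtain ⟨c, hc, hvc, hcF⟩ := exists_nbr G X (insert y F) v (by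
      have := hY v hv; linarith)
    have c2 : ((insert v (insert y F)).card : ℝ) ≤ F.card + 1 + 1 := by
      exact_mod_cast (Finset.card_insert_le v _).trans (Nat.succ_le_succ (Finset.card_insert_le y F))
    obtain ⟨v1, hv1, hcv, hv1F⟩ := exists_nbr G Y (insert v (insert y F)) c (by
      have := hX c hc; linarith)
    simp only [Finset.mem_insert, not_or] at hcF hv1F
    have c3 : ((insert v (insert c F)).card : ℝ) ≤ F.card + 1 + 1 := by
      exact_mod_cast (Finset.card_insert_le v _).trans (Nat.succ_le_succ (Finset.card_insert_le c F))
    obtain ⟨p, hp, hl, hpF⟩ := ih (insert v (insert c F)) v1 y hv1 hy hv1F.2.1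
      (by simp only [Finset.mem_insert, not_or]; exact ⟨hv1F.1, hcv.ne.symm, hv1F.2.2⟩)
      (by simp only [Finset.mem_insert, not_or]; exact ⟨hne.symm, fun h => hcF.1 h.symm, hyF⟩)
      (by linarith)
    refine ⟨Walk.cons hvc (Walk.cons hcv p), ?_, ?_, ?_⟩
    · rw [Walk.cons_isPath_iff, Walk.cons_isPath_iff]
      refine ⟨⟨hp, fun hm => hpF c hm (by simp)⟩, ?_⟩
      simp only [Walk.support_cons, List.mem_cons, not_or]
      exact ⟨hvc.ne, fun hm => hpF v hm (by simp)⟩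
    · simp only [Walk.length_cons, hl]; ring
    · intro x hx
      simp only [Walk.support_cons, List.mem_cons] at hx
      rcases hx with rfl | rfl | hx
      · exact hvF
      · exact hcF.2
      · have := hpF x hx
        simp only [Finset.mem_insert, not_or] at this
        exact this.2.2

/-- Near-bipartite structure: one bad edge puts all typical edges on odd cycles. -/
lemma conn (G : SimpleGraph V) (k : ℕ) (hk : 3 ≤ k) (X Y : Finset V) (hdis : Disjoint X Y)
    (hn : (100 * k + 1000 : ℝ) ≤ Fintype.card V)
    (hXc : 49 / 100 * (Fintype.card V : ℝ) ≤ X.card) (hYc : 49 / 100 * (Fintype.card V : ℝ) ≤ Y.card)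
    (hX : ∀ u ∈ X, (Y.card : ℝ) - 3 / 1000 * Fintype.card V ≤ dg G Y u)
    (hY : ∀ v ∈ Y, (X.card : ℝ) - 3 / 1000 * Fintype.card V ≤ dg G X v)
    (w w' : V) (hww : G.Adj w w') (hw : 18 / 100 * (Fintype.card V : ℝ) ≤ dg G Y w)
    (hw' : 18 / 100 * (Fintype.card V : ℝ) ≤ dg G Y w')
    (u v : V) (hu : u ∈ X) (hv : v ∈ Y) (huv : G.Adj u v) (huw : u ≠ w) (huw' : u ≠ w')
    (hvw : v ≠ w) (hvw' : v ≠ w') : occursInC G (2 * k + 1) s(u, v) := by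
  set n : ℝ := (Fintype.card V : ℝ) with hnn
  have hk3 : (3 : ℝ) ≤ k := by exact_mod_cast hk
  obtain ⟨y, hyY, hwy, huy, hyF⟩ := common_nbr G Y {v, w'} w u (by
    have : (({v, w'} : Finset V).card : ℝ) ≤ 2 := by exact_mod_cast Finset.card_le_two
    have := hX u hu
    linarith)
  obtain ⟨y', hyY', hwy', hyF'⟩ := exists_nbr G Y {u, v, w, y} w' (by
    have : (({u, v, w, y} : Finset V).card : ℝ) ≤ 4 := by exact_mod_cast Finset.card_le_four
    linarith)
  simp only [Finset.mem_insert, Finset.mem_singleton, not_or] at hyF hyF'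
  have hvu : v ≠ u := huv.ne.symm
  obtain ⟨p, hp, hl, hpF⟩ := alt_path G X Y (48 / 100 * n)
    (fun u hu => by have := hX u hu; linarith) (fun u hu => by have := hY u hu; linarith)
    (fun v hv v' hv' => by have := hY v hv; have := hY v' hv'; linarith) (k - 3) {u, w, w', y} v y'
    hv hyY' (fun h => hyF'.2.1 h.symm)
    (by
      simp only [Finset.mem_insert, Finset.mem_singleton, not_or]
      exact ⟨hvu, hvw, hvw', fun h => hyF.1 h.symm⟩)
    (by
      simp only [Finset.mem_insert, Finset.mem_singleton, not_or]
      exact ⟨hyF'.1, hyF'.2.2.1, hwy'.ne.symm, hyF'.2.2.2⟩)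
    (by
      have : (({u, w, w', y} : Finset V).card : ℝ) ≤ 4 := by exact_mod_cast Finset.card_le_four
      have h5 : ((k - 3 : ℕ) : ℝ) = k - 3 := by rw [Nat.cast_sub (by omega)]; simp
      rw [h5]; linarith)
  have hr : (Walk.cons huy.symm (Walk.cons huv p)).IsPath := by
    rw [Walk.cons_isPath_iff, Walk.cons_isPath_iff]
    refine ⟨⟨hp, fun hm => hpF u hm (by simp)⟩, ?_⟩
    simp only [Walk.support_cons, List.mem_cons, not_or]
    exact ⟨huy.ne.symm, fun hm => hpF y hm (by simp)⟩
  obtain ⟨q, hq, hql, hqe, -⟩ := ext_path G _ hr hwy hwy'.symm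
    (by
      simp only [Walk.support_cons, List.mem_cons, not_or]
      exact ⟨hwy.ne, huw.symm, fun hm => hpF w hm (by simp)⟩)
    (by
      simp only [Walk.support_cons, List.mem_cons, not_or]
      exact ⟨fun h => hyF.2 h.symm, huw'.symm, fun hm => hpF w' hm (by simp)⟩) hww.ne
  simp only [Walk.length_cons, hl] at hql
  have := close_cycle G q hq (by omega) hww.symm s(u, v) (hqe _ (by simp))
  rw [hql] at this
  convert this using 1
  omega

lemma bad_edge (G : SimpleGraph V) (X Y : Finset V) (hdis : Disjoint X Y)
    (hn : 0 < (Fintype.card V : ℝ))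
    (hXc : 499 / 1000 * (Fintype.card V : ℝ) ≤ X.card)
    (hYc : 499 / 1000 * (Fintype.card V : ℝ) ≤ Y.card)
    (hX : ∀ u ∈ X, (Y.card : ℝ) - 3 / 1000 * Fintype.card V ≤ dg G Y u)
    (hY : ∀ v ∈ Y, (X.card : ℝ) - 3 / 1000 * Fintype.card V ≤ dg G X v)
    (hD : (Fintype.card V : ℝ) ^ 2 / 2 < ∑ v, dg G Finset.univ v) :
    (∃ w w', G.Adj w w' ∧ 18 / 100 * (Fintype.card V : ℝ) ≤ dg G Y w ∧
      18 / 100 * (Fintype.card V : ℝ) ≤ dg G Y w') ∨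
    (∃ w w', G.Adj w w' ∧ 18 / 100 * (Fintype.card V : ℝ) ≤ dg G X w ∧
      18 / 100 * (Fintype.card V : ℝ) ≤ dg G X w') := by
  set n : ℝ := (Fintype.card V : ℝ) with hnn
  have hXYc : ((X ∪ Y).card : ℝ) = X.card + Y.card := by
    exact_mod_cast Finset.card_union_of_disjoint hdis
  have hcomp : (((X ∪ Y)ᶜ : Finset V).card : ℝ) = n - (X.card + Y.card) := by
    rw [Finset.card_compl, Nat.cast_sub (Finset.card_le_univ _), hXYc]
  set D0 : Finset V := Finset.univ.filter (fun v => dg G Finset.univ v < 4 / 10 * n) with hD0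
  have hD0c : (D0.card : ℝ) ≤ 2 / 1000 * n := by
    have : D0 ⊆ (X ∪ Y)ᶜ := by
      intro v hv
      have hv2 := (Finset.mem_filter.1 hv).2
      simp only [Finset.mem_compl, Finset.mem_union, not_or]
      constructor
      · intro hvX
        have := hX v hvX
        have := dg_subset G (Finset.subset_univ Y) v
        linarith
      · intro hvX
        have := hY v hvX
        have := dg_subset G (Finset.subset_univ X) v
        linarith
    have : (D0.card : ℝ) ≤ (((X ∪ Y)ᶜ : Finset V).card : ℝ) := by
      exact_mod_cast Finset.card_le_card this
    linarith
  by_contra! hcon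
  obtain ⟨hc1, hc2⟩ := hcon
  set P := D0ᶜ.filter (fun v => 18 / 100 * n ≤ dg G Y v) with hP
  set P' := D0ᶜ.filter (fun v => ¬ 18 / 100 * n ≤ dg G Y v) with hP'
  have hPP : ∀ f : V → ℝ, ∑ v ∈ D0ᶜ, f v = ∑ v ∈ P, f v + ∑ v ∈ P', f v := by
    intro f; rw [hP, hP', Finset.sum_filter_add_sum_filter_not]
  have hP1 : ∀ v ∈ P, 18 / 100 * n ≤ dg G Y v := fun v hv => (Finset.mem_filter.1 hv).2
  have hP2 : ∀ v ∈ P', 18 / 100 * n ≤ dg G X v := by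
    intro v hv
    obtain ⟨h1, h2⟩ := Finset.mem_filter.1 hv
    push Not at h2
    have h3 : 4 / 10 * n ≤ dg G Finset.univ v := by
      by_contra! hh
      exact (Finset.mem_compl.1 h1) (Finset.mem_filter.2 ⟨Finset.mem_univ _, hh⟩)
    have h4 := dg_compl G (X ∪ Y) v
    have h5 := dg_le_card G (X ∪ Y)ᶜ v
    have h6 : dg G (X ∪ Y) v = dg G X v + dg G Y v := Finset.sum_union hdis
    linarith
  have z1 : ∀ v ∈ P, dg G P v = 0 := fun v hv => Finset.sum_eq_zero fun w hw => by
    apply g_not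
    intro ha
    exact absurd (hc1 v w ha (hP1 v hv)) (not_lt.2 (hP1 w hw))
  have z2 : ∀ v ∈ P', dg G P' v = 0 := fun v hv => Finset.sum_eq_zero fun w hw => by
    apply g_not
    intro ha
    exact absurd (hc2 v w ha (hP2 v hv)) (not_lt.2 (hP2 w hw))
  have hE : ∑ v ∈ D0ᶜ, dg G D0ᶜ v ≤ 2 * (P.card * P'.card) := by
    rw [hPP]
    have d1 : ∀ v, dg G D0ᶜ v = dg G P v + dg G P' v := fun v => hPP _
    have e1 : ∑ v ∈ P, dg G D0ᶜ v ≤ ∑ v ∈ P, (P'.card : ℝ) := by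
      refine Finset.sum_le_sum fun v hv => ?_
      rw [d1, z1 v hv, zero_add]; exact dg_le_card _ _ _
    have e2 : ∑ v ∈ P', dg G D0ᶜ v ≤ ∑ v ∈ P', (P.card : ℝ) := by
      refine Finset.sum_le_sum fun v hv => ?_
      rw [d1, z2 v hv, add_zero]; exact dg_le_card _ _ _
    rw [Finset.sum_const, nsmul_eq_mul] at e1 e2
    linarith
  have hcards : (P.card : ℝ) + P'.card = n - D0.card := by
    have := hPP (fun _ => 1)
    simp only [Finset.sum_const, nsmul_eq_mul, mul_one] at this
    rw [← this, Finset.card_compl, Nat.cast_sub (Finset.card_le_univ _)]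
  have hLsum : ∑ v ∈ D0, dg G Finset.univ v ≤ D0.card * (4 / 10 * n) := by
    refine (Finset.sum_le_sum fun v hv => (Finset.mem_filter.1 hv).2.le).trans ?_
    rw [Finset.sum_const, nsmul_eq_mul]
  have hLsum2 : ∑ v ∈ D0, dg G Finset.univ v = ∑ v ∈ D0, dg G D0 v + ∑ v ∈ D0ᶜ, dg G D0 v := by
    simp only [dg_compl G D0, Finset.sum_add_distrib]
    rw [E_comm G D0 D0ᶜ]
  have h0 : 0 ≤ ∑ v ∈ D0, dg G D0 v := Finset.sum_nonneg fun _ _ => dg_nonneg _ _ _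
  have hsp := D_split G D0
  have hd0 : (0 : ℝ) ≤ D0.card := by positivity
  have hprod : 2 * ((P.card : ℝ) * P'.card) ≤ (n - D0.card) ^ 2 / 2 := by
    rw [← hcards]; nlinarith [sq_nonneg ((P.card : ℝ) - P'.card)]
  nlinarith [mul_nonneg hd0 hn.le]

open Classical in
/-- neighbourhood -/
noncomputable def nb (G : SimpleGraph V) (x : V) : Finset V := Finset.univ.filter (fun y => G.Adj x y)

lemma sum_nb (G : SimpleGraph V) (x : V) (f : V → ℝ) : ∑ y ∈ nb G x, f y = ∑ y, g G x y * f y := by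
  unfold nb
  rw [Finset.sum_filter]
  refine Finset.sum_congr rfl fun y _ => ?_
  split_ifs with hy
  · rw [g_adj hy, one_mul]
  · rw [g_not hy, zero_mul]

lemma card_nb (G : SimpleGraph V) (x : V) : ((nb G x).card : ℝ) = dg G Finset.univ x := by
  have := sum_nb G x (fun _ => 1)
  simp only [Finset.sum_const, nsmul_eq_mul, mul_one] at this
  exact this

lemma tau_nb (G : SimpleGraph V) (x : V) : ∑ u ∈ nb G x, dg G (nb G x) u = tau G x := by
  unfold tau dg
  rw [sum_nb]
  refine Finset.sum_congr rfl fun u _ => ?_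
  rw [sum_nb, Finset.mul_sum]
  refine Finset.sum_congr rfl fun z _ => ?_
  unfold h; ring

lemma markov (S : Finset V) (f : V → ℝ) (c : ℝ) (hc : 0 < c) (hf : ∀ v ∈ S, 0 ≤ f v) :
    ((S.filter (fun v => c < f v)).card : ℝ) * c ≤ ∑ v ∈ S, f v := by
  calc _ = ∑ v ∈ S.filter (fun v => c < f v), c := by rw [Finset.sum_const, nsmul_eq_mul]
    _ ≤ ∑ v ∈ S.filter (fun v => c < f v), f v :=
        Finset.sum_le_sum fun v hv => (Finset.mem_filter.1 hv).2.le
    _ ≤ _ := Finset.sum_le_sum_of_subset_of_nonneg (Finset.filter_subset _ _)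
        fun v hv _ => hf v hv

lemma side (G : SimpleGraph V) (θ : ℝ) (hθ : 0 < θ) (hθ1 : θ ≤ 1 / 1000) (x : V)
    (hn : 0 < (Fintype.card V : ℝ))
    (hτ : tau G x ≤ θ ^ 4 * (Fintype.card V : ℝ) ^ 2)
    (hd : (1 - θ) * (Fintype.card V : ℝ) ≤ 2 * dg G Finset.univ x)
    (hsq : ∑ v, (2 * dg G Finset.univ v - Fintype.card V) ^ 2 ≤ θ ^ 4 * (Fintype.card V : ℝ) ^ 3) :
    ∃ X ⊆ nb G x, (1 / 2 - θ) * (Fintype.card V : ℝ) ≤ X.card ∧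
      ∀ u ∈ X, (1 - θ) * (Fintype.card V : ℝ) ≤ 2 * dg G Finset.univ u ∧
        dg G (nb G x) u ≤ θ * (Fintype.card V : ℝ) := by
  set n : ℝ := (Fintype.card V : ℝ) with hnn
  set B1 := Finset.univ.filter (fun v : V => (θ * n) ^ 2 < (2 * dg G Finset.univ v - n) ^ 2) with hB1
  set B2 := (nb G x).filter (fun v => θ * n < dg G (nb G x) v) with hB2
  have m1 := markov Finset.univ (fun v => (2 * dg G Finset.univ v - n) ^ 2) ((θ * n) ^ 2)
    (by positivity) (fun _ _ => sq_nonneg _)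
  have m2 := markov (nb G x) (dg G (nb G x)) (θ * n) (by positivity) (fun _ _ => dg_nonneg _ _ _)
  rw [tau_nb] at m2
  have c1 : (B1.card : ℝ) ≤ θ ^ 2 * n := by
    have : (B1.card : ℝ) * (θ * n) ^ 2 ≤ (θ ^ 2 * n) * (θ * n) ^ 2 := by
      refine (m1.trans hsq).trans (le_of_eq ?_); ring
    exact le_of_mul_le_mul_right this (by positivity)
  have c2 : (B2.card : ℝ) ≤ θ ^ 3 * n := by
    have : (B2.card : ℝ) * (θ * n) ≤ (θ ^ 3 * n) * (θ * n) := by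
      refine (m2.trans hτ).trans (le_of_eq ?_); ring
    exact le_of_mul_le_mul_right this (by positivity)
  refine ⟨nb G x \ (B1 ∪ B2), Finset.sdiff_subset, ?_, ?_⟩
  · have e1 : ((nb G x).card : ℝ) ≤ (nb G x \ (B1 ∪ B2)).card + (B1.card + B2.card) := by
      have h1 := Finset.card_le_card_sdiff_add_card (s := nb G x) (t := B1 ∪ B2)
      have h2 := Finset.card_union_le B1 B2
      exact_mod_cast h1.trans (by omega)
    rw [card_nb] at e1
    have t2 : θ ^ 2 * n ≤ θ * n / 1000 := by nlinarith [mul_nonneg hθ.le hn.le]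
    have t3 : θ ^ 3 * n ≤ θ * n / 1000 := by
      have : θ ^ 3 ≤ θ / 1000 := by nlinarith [mul_pos hθ hθ]
      nlinarith
    have : 0 < θ * n := by positivity
    linarith
  · intro u hu
    simp only [Finset.mem_sdiff, Finset.mem_union, not_or] at hu
    obtain ⟨h1, h2, h3⟩ := hu
    constructor
    · have : (2 * dg G Finset.univ u - n) ^ 2 ≤ (θ * n) ^ 2 := by
        by_contra! hh
        exact h2 (Finset.mem_filter.2 ⟨Finset.mem_univ _, hh⟩)
      have := abs_le_of_sq_le_sq' this (by positivity)
      linarith [this.1]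
    · by_contra! hh
      exact h3 (Finset.mem_filter.2 ⟨h1, hh⟩)

lemma nonnbr (G : SimpleGraph V) (θ : ℝ) (hθ : 0 < θ) (x y : V)
    (hcd : ∑ z, g G x z * g G y z ≤ θ / 2 * (Fintype.card V : ℝ))
    (hd : (1 - θ) * (Fintype.card V : ℝ) ≤ 2 * dg G Finset.univ x)
    (Y : Finset V) (hY : Y ⊆ nb G y) (u : V)
    (hu : (1 - θ) * (Fintype.card V : ℝ) ≤ 2 * dg G Finset.univ u)
    (hu2 : dg G (nb G x) u ≤ θ * (Fintype.card V : ℝ)) :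
    (Y.card : ℝ) - 3 * θ * Fintype.card V ≤ dg G Y u := by
  set n : ℝ := (Fintype.card V : ℝ) with hnn
  have e1 : (Y.card : ℝ) - dg G Y u = ∑ w ∈ Y, (1 - g G u w) := by
    rw [Finset.sum_sub_distrib]; simp [dg]
  have e2 : ∑ w ∈ Y, (1 - g G u w) ≤ ∑ w ∈ nb G y, (1 - g G u w) :=
    Finset.sum_le_sum_of_subset_of_nonneg hY fun w _ _ => sub_nonneg.2 (g_le_one _ _ _)
  have e3 : ∑ w ∈ nb G y, (1 - g G u w) ≤
      ∑ w, (g G x w * g G y w + (1 - g G x w) - (g G u w - g G x w * g G u w)) := by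
    rw [sum_nb]
    refine Finset.sum_le_sum fun w _ => ?_
    have a1 := g_nonneg G x w
    have a2 := sub_nonneg.2 (g_le_one G x w)
    have b1 := g_nonneg G y w
    have b2 := sub_nonneg.2 (g_le_one G y w)
    have c1 := g_nonneg G u w
    have c2 := sub_nonneg.2 (g_le_one G u w)
    nlinarith [mul_nonneg (mul_nonneg a1 b1) c1, mul_nonneg (mul_nonneg a2 b2) c2]
  have e4 : ∑ w, (g G x w * g G y w + (1 - g G x w) - (g G u w - g G x w * g G u w))
      = ∑ z, g G x z * g G y z + (n - dg G Finset.univ x) - (dg G Finset.univ u - dg G (nb G x) u) := by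
    have : dg G (nb G x) u = ∑ w, g G x w * g G u w := sum_nb G x _
    rw [this]
    simp only [Finset.sum_sub_distrib, Finset.sum_add_distrib]
    simp [dg, hnn]
  nlinarith

lemma good_edge (G : SimpleGraph V) (δ : ℝ) (hδ : 0 < δ) (hn : 0 < (Fintype.card V : ℝ))
    (htri : tri G Finset.univ ≤ δ * (Fintype.card V : ℝ) ^ 3)
    (hD : (Fintype.card V : ℝ) ^ 2 / 2 < ∑ v, dg G Finset.univ v) :
    ∑ v, (2 * dg G Finset.univ v - Fintype.card V) ^ 2 ≤ 2 * δ * (Fintype.card V : ℝ) ^ 3 ∧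
    ∃ x y, G.Adj x y ∧ tau G x + tau G y + Fintype.card V * ∑ z, g G x z * g G y z
      + (2 * dg G Finset.univ x - Fintype.card V) ^ 2 + (2 * dg G Finset.univ y - Fintype.card V) ^ 2
      ≤ 14 * δ * (Fintype.card V : ℝ) ^ 2 := by
  set n : ℝ := (Fintype.card V : ℝ) with hnn
  have hsq : ∑ v, (2 * dg G Finset.univ v - n) ^ 2 ≤ 2 * δ * n ^ 3 := by
    have m := mantel_sq G Finset.univ
    have e : ∑ v, (2 * dg G Finset.univ v - n) ^ 2 = 4 * ∑ v, dg G Finset.univ v ^ 2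
        - 4 * n * ∑ v, dg G Finset.univ v + n ^ 3 := by
      have : ∀ v, (2 * dg G Finset.univ v - n) ^ 2 = 4 * dg G Finset.univ v ^ 2
        - 4 * n * dg G Finset.univ v + n ^ 2 := fun v => by ring
      simp only [this, Finset.sum_add_distrib, Finset.sum_sub_distrib, ← Finset.mul_sum,
        Finset.sum_const, nsmul_eq_mul, Finset.card_univ, ← hnn]
      ring
    rw [Finset.card_univ, ← hnn] at m
    rw [e]
    nlinarith
  refine ⟨hsq, ?_⟩
  by_contra! hcon
  set q : V → ℝ := fun v => (2 * dg G Finset.univ v - n) ^ 2 with hq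
  have hq0 : ∀ v, 0 ≤ q v := fun v => sq_nonneg _
  have l1 : 14 * δ * n ^ 2 * ∑ v, dg G Finset.univ v ≤
      ∑ x, ∑ y, g G x y * (tau G x + tau G y + n * ∑ z, g G x z * g G y z + q x + q y) := by
    unfold dg
    simp only [Finset.mul_sum (s := Finset.univ) (a := 14 * δ * n ^ 2)]
    refine Finset.sum_le_sum fun x _ => Finset.sum_le_sum fun y _ => ?_
    by_cases hxy : G.Adj x y
    · rw [g_adj hxy]
      have := hcon x y hxy
      linarith
    · rw [g_not hxy]; simp
  have l2 : ∑ x, ∑ y, g G x y * (tau G x + tau G y + n * ∑ z, g G x z * g G y z + q x + q y)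
      ≤ ∑ x, ∑ y, (tau G x + tau G y + n * ∑ z, h G x y z + q x + q y) := by
    refine Finset.sum_le_sum fun x _ => Finset.sum_le_sum fun y _ => ?_
    have e : ∑ z, h G x y z = g G x y * ∑ z, g G x z * g G y z := by
      rw [Finset.mul_sum]
      exact Finset.sum_congr rfl fun z _ => by unfold h; ring
    rw [e]
    have p1 : 0 ≤ tau G x + tau G y + q x + q y := by
      have := tau_nonneg G x
      have := tau_nonneg G y
      have := hq0 x
      have := hq0 y
      linarith
    nlinarith [mul_nonneg (sub_nonneg.2 (g_le_one G x y)) p1]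
  have htau : ∑ x, tau G x = tri G Finset.univ := rfl
  have l3 : ∑ x, ∑ y, (tau G x + tau G y + n * ∑ z, h G x y z + q x + q y)
      = 3 * n * tri G Finset.univ + 2 * n * ∑ v, q v := by
    simp only [Finset.sum_add_distrib, Finset.sum_const, nsmul_eq_mul, Finset.card_univ, ← hnn,
      ← Finset.mul_sum]
    rw [htau]
    unfold tri; ring
  have l4 : 14 * δ * n ^ 2 * (n ^ 2 / 2) < 14 * δ * n ^ 2 * ∑ v, dg G Finset.univ v := by
    apply mul_lt_mul_of_pos_left hD; positivity
  have l5 : n * tri G Finset.univ ≤ n * (δ * n ^ 3) := mul_le_mul_of_nonneg_left htri hn.le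
  have l6 : n * ∑ v, q v ≤ n * (2 * δ * n ^ 3) := mul_le_mul_of_nonneg_left hsq hn.le
  nlinarith

lemma case4 (G : SimpleGraph V) (k : ℕ) (hk : 3 ≤ k) (hn : (100 * k + 1000 : ℝ) ≤ Fintype.card V)
    (htri : tri G Finset.univ ≤ (1 / 1000) ^ 4 / 14 * (Fintype.card V : ℝ) ^ 3)
    (hD : (Fintype.card V : ℝ) ^ 2 / 2 < ∑ v, dg G Finset.univ v) :
    ∃ X Y : Finset V, Disjoint X Y ∧ 499 / 1000 * (Fintype.card V : ℝ) ≤ X.card ∧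
      499 / 1000 * (Fintype.card V : ℝ) ≤ Y.card ∧
      (∀ u ∈ X, (Y.card : ℝ) - 3 / 1000 * Fintype.card V ≤ dg G Y u) ∧
      ∃ w w', ∀ u ∈ X, ∀ v ∈ Y, G.Adj u v → u ≠ w → u ≠ w' → v ≠ w → v ≠ w' →
        occursInC G (2 * k + 1) s(u, v) := by
  set n : ℝ := (Fintype.card V : ℝ) with hnn
  have hn0 : 0 < n := by
    have : (0 : ℝ) ≤ k := by positivity
    linarith
  obtain ⟨hsq, x, y, hxy, hc⟩ := good_edge G _ (by norm_num) hn0 htri hD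
  rw [← hnn] at hsq hc
  have hn2 : 0 < n ^ 2 := by positivity
  have hn3 : 0 < n ^ 3 := by positivity
  have p1 := tau_nonneg G x
  have p2 := tau_nonneg G y
  have p3 : 0 ≤ n * ∑ z, g G x z * g G y z :=
    mul_nonneg hn0.le (Finset.sum_nonneg fun _ _ => mul_nonneg (g_nonneg _ _ _) (g_nonneg _ _ _))
  have p4 := sq_nonneg (2 * dg G Finset.univ x - n)
  have p5 := sq_nonneg (2 * dg G Finset.univ y - n)
  have hdx : (1 - 1 / 1000) * n ≤ 2 * dg G Finset.univ x := by
    have : (2 * dg G Finset.univ x - n) ^ 2 ≤ (1 / 1000 * n) ^ 2 := by nlinarith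
    have := abs_le_of_sq_le_sq' this (by positivity)
    linarith [this.1]
  have hdy : (1 - 1 / 1000) * n ≤ 2 * dg G Finset.univ y := by
    have : (2 * dg G Finset.univ y - n) ^ 2 ≤ (1 / 1000 * n) ^ 2 := by nlinarith
    have := abs_le_of_sq_le_sq' this (by positivity)
    linarith [this.1]
  have hcd : ∑ z, g G x z * g G y z ≤ 1 / 1000 / 2 * n := by
    have : n * ∑ z, g G x z * g G y z ≤ n * (1 / 1000 / 2 * n) := by nlinarith
    exact le_of_mul_le_mul_left this hn0
  have hcd' : ∑ z, g G y z * g G x z ≤ 1 / 1000 / 2 * n := by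
    simpa only [mul_comm] using hcd
  have hsq' : ∑ v, (2 * dg G Finset.univ v - n) ^ 2 ≤ (1 / 1000) ^ 4 * n ^ 3 := by
    refine hsq.trans ?_
    apply mul_le_mul_of_nonneg_right _ hn3.le
    norm_num
  obtain ⟨X, hXs, hXc, hX⟩ := side G (1 / 1000) (by norm_num) le_rfl x hn0 (by rw [← hnn]; nlinarith) hdx hsq'
  obtain ⟨Y, hYs, hYc, hY⟩ := side G (1 / 1000) (by norm_num) le_rfl y hn0 (by rw [← hnn]; nlinarith) hdy hsq'
  rw [← hnn] at hXc hYc hX hY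
  have hXY : ∀ u ∈ X, (Y.card : ℝ) - 3 / 1000 * n ≤ dg G Y u := by
    intro u hu
    have := nonnbr G (1 / 1000) (by norm_num) x y hcd hdx Y hYs u (hX u hu).1 (hX u hu).2
    rw [← hnn] at this
    linarith
  have hYX : ∀ u ∈ Y, (X.card : ℝ) - 3 / 1000 * n ≤ dg G X u := by
    intro u hu
    have := nonnbr G (1 / 1000) (by norm_num) y x hcd' hdy X hXs u (hY u hu).1 (hY u hu).2
    rw [← hnn] at this
    linarith
  have hdis : Disjoint X Y := by
    rw [Finset.disjoint_left]
    intro u hu hu'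
    have a1 := hXY u hu
    have a2 := dg_subset G hYs u
    have a3 := (hY u hu').2
    linarith
  have hXc' : 499 / 1000 * n ≤ X.card := by linarith
  have hYc' : 499 / 1000 * n ≤ Y.card := by linarith
  refine ⟨X, Y, hdis, hXc', hYc', hXY, ?_⟩
  rcases bad_edge G X Y hdis hn0 hXc' hYc' hXY hYX hD with ⟨w, w', hww, h1, h2⟩ | ⟨w, w', hww, h1, h2⟩
  · refine ⟨w, w', fun u hu v hv huv a b c d => ?_⟩
    exact conn G k hk X Y hdis hn (by linarith) (by linarith) hXY hYX w w' hww h1 h2 u v hu hv huv a b c d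
  · refine ⟨w, w', fun u hu v hv huv a b c d => ?_⟩
    rw [Sym2.eq_swap]
    exact conn G k hk Y X hdis.symm hn (by linarith) (by linarith) hYX hXY w w' hww h1 h2 v u hv hu huv.symm
      c d a b

lemma sum_dg_eq (G : SimpleGraph V) : ∑ v, dg G Finset.univ v = 2 * (G.edgeSet.ncard : ℝ) := by
  classical
  have h1 : ∀ v, dg G Finset.univ v = (G.degree v : ℝ) := by
    intro v
    unfold dg g
    rw [Finset.sum_boole, ← SimpleGraph.card_neighborFinset_eq_degree]
    congr 2
    ext w
    simp
  have h2 := G.sum_degrees_eq_twice_card_edges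
  have h3 : G.edgeSet.ncard = G.edgeFinset.card := by
    rw [← SimpleGraph.coe_edgeFinset, Set.ncard_coe_finset]
  rw [h3, Finset.sum_congr rfl (fun v _ => h1 v)]
  exact_mod_cast h2

lemma red_count (G : SimpleGraph V) (X Y : Finset V) (hdis : Disjoint X Y) (R : Set (Sym2 V))
    (w w' : V) (δ : ℝ) (hpos : 0 ≤ (Y.card : ℝ) - δ - 2)
    (hd : ∀ u ∈ X, (Y.card : ℝ) - δ ≤ dg G Y u)
    (hR : ∀ u ∈ X, ∀ v ∈ Y, G.Adj u v → u ≠ w → u ≠ w' → v ≠ w → v ≠ w' → s(u, v) ∈ R) :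
    ((X.card : ℝ) - 2) * ((Y.card : ℝ) - δ - 2) ≤ R.ncard := by
  classical
  set W : Finset V := {w, w'} with hW
  have hWc : W.card ≤ 2 := Finset.card_le_two
  set P : Finset (V × V) := ((X \ W) ×ˢ (Y \ W)).filter (fun p => G.Adj p.1 p.2) with hP
  have hsub : ((P.image (fun p => s(p.1, p.2)) : Finset (Sym2 V)) : Set (Sym2 V)) ⊆ R := by
    intro e he
    simp only [Finset.coe_image, Set.mem_image, Finset.mem_coe] at he
    obtain ⟨⟨u, v⟩, hp, rfl⟩ := he
    simp only [hP, hW, Finset.mem_filter, Finset.mem_product, Finset.mem_sdiff, Finset.mem_insert,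
      Finset.mem_singleton, not_or] at hp
    obtain ⟨⟨⟨hu, h1, h2⟩, hv, h3, h4⟩, h5⟩ := hp
    exact hR u hu v hv h5 h1 h2 h3 h4
  have hcard : P.card ≤ R.ncard := by
    have h1 := Set.ncard_le_ncard hsub (Set.toFinite R)
    rw [Set.ncard_coe_finset, Finset.card_image_of_injOn] at h1
    · exact h1
    · rintro ⟨u, v⟩ hp ⟨u', v'⟩ hp' heq
      simp only [hP, Finset.coe_filter, Finset.mem_product, Finset.mem_sdiff,
        Set.mem_ofPred_eq] at hp hp'
      simp only [Sym2.eq_iff] at heq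
      rcases heq with ⟨rfl, rfl⟩ | ⟨rfl, rfl⟩
      · rfl
      · exact absurd hp'.1.2.1 (Finset.disjoint_left.mp hdis hp.1.1.1)
  have hPsum : (P.card : ℝ) = ∑ u ∈ X \ W, dg G (Y \ W) u := by
    unfold dg g
    rw [← Finset.sum_product', Finset.sum_boole]
  have hdeg : ∀ u ∈ X \ W, (Y.card : ℝ) - δ - 2 ≤ dg G (Y \ W) u := by
    intro u hu
    have h1 := hd u (Finset.mem_sdiff.mp hu).1
    have h2 : dg G Y u ≤ dg G (Y \ W) u + dg G W u := by
      unfold dg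
      rw [← Finset.sum_inter_add_sum_sdiff Y W (fun x => g G u x), add_comm]
      gcongr
      · intro _ _ _; exact g_nonneg _ _ _
      · exact Finset.inter_subset_right
    have h3 := dg_le_card G W u
    have h4 : (W.card : ℝ) ≤ 2 := by exact_mod_cast hWc
    linarith
  have hXc : (X.card : ℝ) - 2 ≤ (X \ W).card := by
    have h1 := Finset.card_le_card_sdiff_add_card (s := X) (t := W)
    have : (X.card : ℝ) ≤ (X \ W).card + 2 := by exact_mod_cast h1.trans (by omega)
    linarith
  calc ((X.card : ℝ) - 2) * ((Y.card : ℝ) - δ - 2)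
      ≤ (X \ W).card * ((Y.card : ℝ) - δ - 2) := by gcongr
    _ = ∑ u ∈ X \ W, ((Y.card : ℝ) - δ - 2) := by rw [Finset.sum_const, nsmul_eq_mul]
    _ ≤ ∑ u ∈ X \ W, dg G (Y \ W) u := Finset.sum_le_sum hdeg
    _ = P.card := hPsum.symm
    _ ≤ R.ncard := by exact_mod_cast hcard

lemma consts (ε : ℝ) (hε : 0 < ε) : ∃ η κ μ ν : ℝ, 0 < η ∧ 0 < κ ∧ 0 < μ ∧ 0 < ν ∧
    η ≤ 1 / 12 ∧ η ≤ ε ∧ κ ≤ 1 ∧ 90 * κ ≤ (1 / 1000) ^ 4 / 14 ∧ μ ≤ κ ^ 2 / 35 ∧ μ ≤ 2 * κ ^ 2 ∧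
    3 * μ + κ ≤ η / 8 ∧ κ ≤ ε / 32 ∧ ν ≤ ε / 8 := by
  set η := min ε (1 / 12) with hη
  have η0 : 0 < η := by positivity
  set κ := min (η / 32) ((1 / 1000) ^ 4 / (14 * 90)) with hκ
  have κ0 : 0 < κ := by positivity
  have k1 : κ ≤ η / 32 := min_le_left _ _
  have k2 : κ ≤ (1 / 1000) ^ 4 / (14 * 90) := min_le_right _ _
  have e1 : η ≤ ε := min_le_left _ _
  have e2 : η ≤ 1 / 12 := min_le_right _ _
  have k3 : κ ≤ 1 := by linarith
  have k4 : κ ^ 2 ≤ κ := by nlinarith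
  refine ⟨η, κ, κ ^ 2 / 35, ε / 8, η0, κ0, by positivity, by positivity, e2, e1, k3, ?_, le_rfl,
    ?_, ?_, by linarith, le_rfl⟩
  · norm_num at k2 ⊢; linarith
  · nlinarith [sq_nonneg κ]
  · linarith

theorem main (ε : ℝ) (hε : 0 < ε) (k : ℕ) (hk : 3 ≤ k) :
    ∃ n₀ : ℝ, ∀ (V : Type) [Fintype V] [DecidableEq V] (G H : SimpleGraph V) (R : Set (Sym2 V)),
      n₀ < Fintype.card V → H ≤ G →
      (∀ x y, H.Adj x y → ¬ occursInC G (2 * k + 1) s(x, y)) →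
      (∀ x y, G.Adj x y → ¬ H.Adj x y → s(x, y) ∈ R) →
      ((Fintype.card V : ℝ) ^ 2 / 2 < ∑ v, dg G Finset.univ v) →
      (2 * (R.ncard : ℝ) = ∑ v, dg G Finset.univ v - ∑ v, dg H Finset.univ v) →
      (2 / 9 - ε) * (Fintype.card V : ℝ) ^ 2 ≤ R.ncard := by
  classical
  obtain ⟨η, κ, μ, ν, η0, κ0, μ0, ν0, e1, e2, k1, k2, m1, m2, m3, k3, v1⟩ := consts ε hε
  obtain ⟨n1, h1⟩ := red_T k hk μ (ν / 2) μ0 (by positivity)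
  obtain ⟨n2, h2⟩ := red_N k hk μ μ (ν / 2) μ0 μ0 (by positivity)
  refine ⟨max (max n1 n2) (100 * k + 1000), ?_⟩
  intro V _ _ G H R hn hle hblue hred hD hRe
  have hn1 : n1 < Fintype.card V := ((le_max_left _ _).trans (le_max_left _ _)).trans_lt hn
  have hn2 : n2 < Fintype.card V := ((le_max_right _ _).trans (le_max_left _ _)).trans_lt hn
  have hn3 : (100 * k + 1000 : ℝ) ≤ Fintype.card V := (le_max_right _ _).trans hn.le
  have hk0 : (0 : ℝ) ≤ k := Nat.cast_nonneg k
  have hnpos : (0 : ℝ) < Fintype.card V := by linarith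
  set T : Finset V := Finset.univ.filter (fun v => μ * (Fintype.card V : ℝ) ^ 2 ≤ tau G v) with hTdef
  set N : Finset V := Finset.univ.filter (fun v => μ * (Fintype.card V : ℝ) ≤ dg G T v) with hNdef
  have hT : ∀ v ∈ T, μ * (Fintype.card V : ℝ) ^ 2 ≤ tau G v := fun v hv =>
    (Finset.mem_filter.mp hv).2
  have hN : ∀ v ∈ N, μ * (Fintype.card V : ℝ) ≤ dg G T v := fun v hv =>
    (Finset.mem_filter.mp hv).2
  have hT' : ∀ v ∉ T, tau G v ≤ μ * (Fintype.card V : ℝ) ^ 2 := by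
    intro v hv
    by_contra hc
    exact hv (Finset.mem_filter.mpr ⟨Finset.mem_univ _, (not_le.mp hc).le⟩)
  have hA' : ∀ v ∉ T ∪ N, dg G T v ≤ μ * (Fintype.card V : ℝ) := by
    intro v hv
    by_contra hc
    exact hv (Finset.mem_union_right _ (Finset.mem_filter.mpr ⟨Finset.mem_univ _, (not_le.mp hc).le⟩))
  have hTA : T ⊆ T ∪ N := Finset.subset_union_left
  by_cases ha : ((T ∪ N).card : ℝ) ≤ (2 / 3 - η) * Fintype.card V
  · by_cases ht : (Fintype.card V : ℝ) / 4 ≤ T.card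
    · exact (case2 G T (T ∪ N) hTA μ κ η hnpos μ0.le κ0.le m2 η0 e1 m3 hT' hA' hD.le ht ha).elim
    · have c3 := case3 G T (T ∪ N) hTA μ κ hnpos μ0.le κ0.le k1 m1 hT' hA' hD.le
        (not_le.mp ht).le (ha.trans (by nlinarith))
      have c3' : tri G Finset.univ ≤ (1 / 1000) ^ 4 / 14 * (Fintype.card V : ℝ) ^ 3 :=
        c3.trans (by gcongr)
      obtain ⟨X, Y, hdis, hX, hY, hXY, w, w', hw⟩ := case4 G k hk hn3 c3' hD
      have hrc := red_count G X Y hdis R w w' (3 / 1000 * Fintype.card V) (by linarith) hXY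
        (fun u hu v hv huv a b c d => hred u v huv
          (fun hb => hblue u v hb (hw u hu v hv huv a b c d)))
      refine le_trans ?_ hrc
      have b1 : 495 / 1000 * (Fintype.card V : ℝ) ≤ (X.card : ℝ) - 2 := by linarith
      have b2 : 490 / 1000 * (Fintype.card V : ℝ) ≤
        (Y.card : ℝ) - 3 / 1000 * Fintype.card V - 2 := by linarith
      have b3 := mul_le_mul b1 b2 (by positivity) (by linarith)
      nlinarith [sq_nonneg (Fintype.card V : ℝ), mul_pos hε (mul_pos hnpos hnpos)]
  · push Not at ha
    have r1 := h1 V G H T hn1 hle hblue hT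
    have r2 := h2 V G H N T hn2 hle hblue hT hN
    have r3 : ∑ v ∈ T ∪ N, dg H Finset.univ v ≤ ν * (Fintype.card V : ℝ) ^ 2 := by
      have q1 : ∑ v ∈ T ∪ N, dg H Finset.univ v + ∑ v ∈ T ∩ N, dg H Finset.univ v
        = ∑ v ∈ T, dg H Finset.univ v + ∑ v ∈ N, dg H Finset.univ v := Finset.sum_union_inter
      have q2 : 0 ≤ ∑ v ∈ T ∩ N, dg H Finset.univ v :=
        Finset.sum_nonneg (fun v _ => dg_nonneg _ _ _)
      linarith
    have c1 := case1 G H hle (T ∪ N) μ ν κ μ0.le κ0.le m2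
      (fun v hv => hT' v (fun h => hv (hTA h))) r3
    have a2 : ((T ∪ N).card : ℝ) ≤ Fintype.card V := by exact_mod_cast Finset.card_le_univ _
    set n : ℝ := (Fintype.card V : ℝ) with hndef
    have s1 : (n - (T ∪ N).card) ^ 2 ≤ ((1 / 3 + η) * n) ^ 2 :=
      pow_le_pow_left₀ (by linarith) (by linarith) 2
    have s2 : ((1 / 3 + η) * n) ^ 2 ≤ (1 / 9 + ε) * n ^ 2 := by
      rw [mul_pow]
      have : (1 / 3 + η) ^ 2 ≤ 1 / 9 + ε := by nlinarith
      gcongr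
    have s3 : ν * n ^ 2 ≤ ε / 8 * n ^ 2 := by gcongr
    have s4 : κ * n ^ 2 ≤ ε / 32 * n ^ 2 := by gcongr
    have s5 : 0 ≤ ε * n ^ 2 := by positivity
    nlinarith
end EFR

theorem stmt6 :
    ∀ ε : ℝ, 0 < ε → ∀ k : ℕ, 3 ≤ k → ∃ n₀ : ℕ, ∀ n : ℕ, n₀ < n →
      ∀ G : SimpleGraph (Fin n), ∀ R B : Set (Sym2 (Fin n)),
        G.edgeSet.ncard = n ^ 2 / 4 + 1 →
        R ∪ B = G.edgeSet → Disjoint R B →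
        (∀ e ∈ B, ¬ occursInC G (2 * k + 1) e) →
        (2 / 9 - ε) * (n : ℝ) ^ 2 ≤ (R.ncard : ℝ) := by
  intro ε hε k hk
  obtain ⟨n₀, h⟩ := EFR.main ε hε k hk
  refine ⟨⌈n₀⌉₊, ?_⟩
  intro n hn G R B hE hRB hdis hB
  have hn' : n₀ < (n : ℝ) := Nat.lt_of_ceil_lt hn
  have hBG : B ⊆ G.edgeSet := by rw [← hRB]; exact Set.subset_union_right
  have hadj : ∀ x y, (SimpleGraph.fromEdgeSet B).Adj x y ↔ s(x, y) ∈ B := by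
    intro x y
    rw [SimpleGraph.fromEdgeSet_adj]
    constructor
    · exact fun h => h.1
    · intro h
      exact ⟨h, (G.mem_edgeSet.mp (hBG h)).ne⟩
  have hHB : (SimpleGraph.fromEdgeSet B).edgeSet = B := by
    ext e
    induction e using Sym2.ind with
    | _ x y => rw [SimpleGraph.mem_edgeSet, hadj]
  have hcard : R.ncard + B.ncard = n ^ 2 / 4 + 1 := by
    rw [← hE, ← hRB, Set.ncard_union_eq hdis (Set.toFinite _) (Set.toFinite _)]
  have key := h (Fin n) G (SimpleGraph.fromEdgeSet B) R (by simpa using hn')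
    (fun x y hxy => G.mem_edgeSet.mp (hBG ((hadj x y).mp hxy)))
    (fun x y hxy => hB _ ((hadj x y).mp hxy))
    (fun x y hxy hnot => by
      have h1 : s(x, y) ∈ R ∪ B := by rw [hRB]; exact G.mem_edgeSet.mpr hxy
      exact h1.resolve_right (fun hb => hnot ((hadj x y).mpr hb)))
    (by
      rw [EFR.sum_dg_eq, hE, Fintype.card_fin]
      have h1 : n ^ 2 < 4 * (n ^ 2 / 4 + 1) := by omega
      have h2 : (n : ℝ) ^ 2 < 4 * ((n ^ 2 / 4 + 1 : ℕ) : ℝ) := by exact_mod_cast h1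
      linarith)
    (by
      rw [EFR.sum_dg_eq, EFR.sum_dg_eq, hHB, hE, ← hcard]
      push_cast
      ring)
  simpa using key
end
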